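/- arXiv:math/0310065 — 4 statements merged into one kernel-verified Lean document; each statement's English description precedes it below -/
import Mathlib

section
/- For all K ≥ 1, C ≥ 0 and δ ≥ 0 there exists B ≥ 0 with the following property: if X is a δ-hyperbolic geodesic metric space and γ, γ' : [0,∞) → X are (K,C)-quasi-geodesic rays with γ(0) = γ'(0) which are asymptotic, in the sense that for every M there is T such that (γ(s), γ'(t))_{γ(0)} ≥ M whenever s, t ≥ T, then every point of the image of γ lies within distance B of the image of γ'. -/
/-- The Gromov product of `x` and `y` with respect to `w`. -/
noncomputable def gromovProduct {X : Type*} [MetricSpace X] (x y w : X) : ℝ :=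
  (dist x w + dist y w - dist x y) / 2

/-- The four-point form of `δ`-hyperbolicity. -/
def IsGromovHyperbolic (X : Type*) [MetricSpace X] (δ : ℝ) : Prop :=
  ∀ x y z w : X, min (gromovProduct x z w) (gromovProduct y z w) - δ ≤ gromovProduct x y w

/-- `σ` restricts to an isometric embedding of `[0, L]`. -/
def IsGeodesicOn {X : Type*} [MetricSpace X] (σ : ℝ → X) (L : ℝ) : Prop :=
  ∀ s ∈ Set.Icc (0 : ℝ) L, ∀ t ∈ Set.Icc (0 : ℝ) L, dist (σ s) (σ t) = |s - t|

/-- A `(K, C)`-quasi-geodesic sequence. -/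
def IsQuasiGeodesicSeq {X : Type*} [MetricSpace X] (K C : ℝ) (x : ℕ → X) : Prop :=
  ∀ i j : ℕ, |(i : ℝ) - j| / K - C ≤ dist (x i) (x j) ∧ dist (x i) (x j) ≤ K * |(i : ℝ) - j| + C

section

variable {X : Type*} [MetricSpace X]

theorem gromovProduct_comm (x y w : X) : gromovProduct x y w = gromovProduct y x w := by
  unfold gromovProduct
  rw [dist_comm x y]
  ring

theorem IsGromovHyperbolic.le_gromovProduct {δ m : ℝ} (h : IsGromovHyperbolic X δ) {x y z w : X}
    (hxz : m ≤ gromovProduct x z w) (hzy : m ≤ gromovProduct z y w) :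
    m - δ ≤ gromovProduct x y w := by
  rw [gromovProduct_comm] at hzy
  have := h x y z w
  have := le_min hxz hzy
  linarith

/-- Along a chain of at most `2 ^ k` short steps staying far from `w`, the Gromov product of the
endpoints drops by at most `k * δ`. -/
theorem IsGromovHyperbolic.le_gromovProduct_chain {δ D c : ℝ} (hδ : 0 ≤ δ) (hc : 0 ≤ c)
    (h : IsGromovHyperbolic X δ) (w : X) (k : ℕ) :
    ∀ (y : ℕ → X) (n : ℕ), n ≤ 2 ^ k → (∀ i ≤ n, D ≤ dist (y i) w) →
      (∀ i < n, dist (y i) (y (i + 1)) ≤ c) →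
      D - c / 2 - k * δ ≤ gromovProduct (y 0) (y n) w := by
  induction k with
  | zero =>
    intro y n hn hD hstep
    have h0 := hD 0 (Nat.zero_le _)
    rcases Nat.le_one_iff_eq_zero_or_eq_one.1 (by simpa using hn) with rfl | rfl
    · simp only [gromovProduct, dist_self]
      push_cast
      linarith
    · have h1 := hD 1 le_rfl
      have h2 := hstep 0 one_pos
      simp only [gromovProduct, zero_add] at *
      push_cast
      linarith
  | succ k ih =>
    intro y n hn hD hstep
    push_cast
    by_cases hk : n ≤ 2 ^ k
    · have := ih y n hk hD hstep
      linarith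
    · push Not at hk
      obtain ⟨m, rfl⟩ := Nat.exists_eq_add_of_le hk.le
      have hm : m ≤ 2 ^ k := by
        rw [pow_succ] at hn
        omega
      have h1 := ih y (2 ^ k) le_rfl (fun i hi => hD i (by omega)) (fun i hi => hstep i (by omega))
      have h2 := ih (fun i => y (2 ^ k + i)) m hm (fun i hi => hD _ (by omega))
        (fun i hi => hstep (2 ^ k + i) (by omega))
      have := h.le_gromovProduct h1 h2
      linarith

theorem IsGromovHyperbolic.le_gromovProduct_of_le_two_pow {δ D c : ℝ} (hδ : 0 ≤ δ) (hc : 0 ≤ c)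
    (h : IsGromovHyperbolic X δ) (w : X) {x : ℕ → X} {N k : ℕ} (hD : ∀ i ≤ N, D ≤ dist (x i) w)
    (hstep : ∀ i, dist (x i) (x (i + 1)) ≤ c) {i j : ℕ} (hi : i ≤ N) (hj : j ≤ N)
    (hij : |(i : ℝ) - j| ≤ 2 ^ k) :
    D - c / 2 - k * δ ≤ gromovProduct (x i) (x j) w := by
  wlog hle : i ≤ j generalizing i j
  · rw [gromovProduct_comm]
    exact this hj hi (by rwa [abs_sub_comm]) (by omega)
  obtain ⟨n, rfl⟩ := Nat.exists_eq_add_of_le hle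
  have hn : n ≤ 2 ^ k := by
    have : (n : ℝ) ≤ 2 ^ k := by
      refine le_trans ?_ hij
      rw [abs_sub_comm]
      push_cast
      rw [add_sub_cancel_left]
      exact le_abs_self _
    exact_mod_cast this
  exact h.le_gromovProduct_chain hδ hc w k (fun l => x (i + l)) n hn
    (fun l hl => hD _ (by omega)) (fun l _ => hstep (i + l))

/-- A quantity bounded by the logarithm of an affine function of itself is bounded. -/
theorem exists_bound_of_le_log (δ a b c : ℝ) (hδ : 0 ≤ δ) (ha : 0 ≤ a) (hc : 0 ≤ c) :
    ∃ R : ℝ, 0 ≤ R ∧ ∀ D : ℝ, 0 ≤ D →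
      (∀ k : ℕ, a * D + b ≤ 2 ^ k → D ≤ k * δ + c) → D ≤ R := by
  have hlim : Filter.Tendsto
      (fun k : ℕ => a * δ * ((k : ℝ) ^ 1 / 2 ^ k) + (a * (δ + c) + b) * ((k : ℝ) ^ 0 / 2 ^ k))
      Filter.atTop (nhds (a * δ * 0 + (a * (δ + c) + b) * 0)) :=
    ((tendsto_pow_const_div_const_pow_of_one_lt 1 one_lt_two).const_mul _).add
      ((tendsto_pow_const_div_const_pow_of_one_lt 0 one_lt_two).const_mul _)
  obtain ⟨k₀, hk₀⟩ := Filter.eventually_atTop.1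
    (hlim.eventually (gt_mem_nhds (show a * δ * 0 + (a * (δ + c) + b) * 0 < (1 : ℝ) by norm_num)))
  refine ⟨k₀ * δ + c, by positivity, fun D hD h => ?_⟩
  have hex : ∃ k : ℕ, a * D + b ≤ 2 ^ k :=
    (pow_unbounded_of_one_lt _ one_lt_two).imp fun k hk => hk.le
  classical
  have hspec := Nat.find_spec hex
  have hmin := fun m => Nat.find_min hex (m := m)
  set k := Nat.find hex
  have hDk := h k hspec
  suffices hk : k ≤ k₀ by
    have : (k : ℝ) * δ ≤ k₀ * δ := by gcongr
    linarith
  by_contra! hk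
  obtain ⟨m, hm⟩ : ∃ m, k = m + 1 := ⟨k - 1, by omega⟩
  have h1 := hmin m (by omega)
  have h2 := hk₀ m (by omega)
  rw [hm] at hDk
  push_cast at hDk
  have h3 : a * D ≤ a * ((m + 1) * δ + c) := by gcongr
  have h4 : a * δ * ((m : ℝ) ^ 1 / 2 ^ m) + (a * (δ + c) + b) * ((m : ℝ) ^ 0 / 2 ^ m)
      = (a * ((m + 1) * δ + c) + b) / 2 ^ m := by
    ring
  rw [h4, div_lt_one (by positivity)] at h2
  linarith

theorem IsGeodesicOn.continuousOn {σ : ℝ → X} {L : ℝ} (hσ : IsGeodesicOn σ L) :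
    ContinuousOn σ (Set.Icc 0 L) := by
  refine (LipschitzOnWith.of_dist_le_mul (K := 1) fun s hs t ht => ?_).continuousOn
  rw [hσ s hs t ht, Real.dist_eq]
  simp

theorem exists_infDist_image_eq_dist (x : ℕ → X) {a b : ℕ} (hab : a ≤ b) (p : X) :
    ∃ i, a ≤ i ∧ i ≤ b ∧ Metric.infDist p (x '' Set.Icc a b) = dist p (x i) := by
  obtain ⟨_, ⟨i, hi, rfl⟩, h⟩ := (((Set.finite_Icc a b).image x).isCompact).exists_infDist_eq_dist
    ((Set.nonempty_Icc.2 hab).image x) p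
  exact ⟨i, hi.1, hi.2, h⟩

theorem infDist_image_le (x : ℕ → X) {a b i : ℕ} (hi : a ≤ i) (hi' : i ≤ b) (p : X) :
    Metric.infDist p (x '' Set.Icc a b) ≤ dist p (x i) :=
  Metric.infDist_le_dist_of_mem ⟨i, ⟨hi, hi'⟩, rfl⟩

theorem IsQuasiGeodesicSeq.abs_sub_le {K C : ℝ} (hK : 1 ≤ K) {x : ℕ → X}
    (hx : IsQuasiGeodesicSeq K C x) {i j : ℕ} {D : ℝ} (h : dist (x i) (x j) ≤ D) :
    |(i : ℝ) - j| ≤ K * (D + C) := by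
  have := (hx i j).1
  rw [mul_comm, ← div_le_iff₀ (by linarith)]
  linarith

/-- Geodesics stay uniformly close to quasi-geodesics with the same endpoints. -/
theorem exists_forall_geodesic_near_quasiGeodesic (K C δ : ℝ) (hK : 1 ≤ K) (hC : 0 ≤ C)
    (hδ : 0 ≤ δ) :
    ∃ R : ℝ, 0 ≤ R ∧ ∀ (X : Type*) [MetricSpace X], IsGromovHyperbolic X δ →
      ∀ x : ℕ → X, IsQuasiGeodesicSeq K C x → ∀ (N : ℕ) (σ : ℝ → X) (L : ℝ),
        σ 0 = x 0 → σ L = x N → IsGeodesicOn σ L →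
        ∀ r ∈ Set.Icc (0 : ℝ) L, ∃ i ≤ N, dist (σ r) (x i) ≤ R := by
  obtain ⟨R, hR, hbound⟩ := exists_bound_of_le_log δ (K * 6) (K * C) ((K + C) / 2 + 2 * δ) hδ
    (by positivity) (by positivity)
  refine ⟨R, hR, fun X _ hX x hx N σ L h0 hL hσ => ?_⟩
  intro r₁ hr₁
  obtain ⟨r, hr, hmax⟩ := isCompact_Icc.exists_isMaxOn ⟨r₁, hr₁⟩
    ((Metric.continuous_infDist_pt (x '' Set.Icc 0 N)).comp_continuousOn hσ.continuousOn)
  set f : ℝ → ℝ := fun s => Metric.infDist (σ s) (x '' Set.Icc 0 N)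
  have hmax' : ∀ s ∈ Set.Icc (0 : ℝ) L, f s ≤ f r := fun s hs => hmax hs
  have hnear : ∀ s ∈ Set.Icc (0 : ℝ) L, ∃ i ≤ N, dist (σ s) (x i) ≤ f r := by
    intro s hs
    obtain ⟨i, -, hi, h⟩ := exists_infDist_image_eq_dist x (Nat.zero_le N) (σ s)
    exact ⟨i, hi, h ▸ hmax' s hs⟩
  suffices hfr : f r ≤ R by
    obtain ⟨i, hi, h⟩ := hnear r₁ hr₁
    exact ⟨i, hi, h.trans hfr⟩
  have hD0 : 0 ≤ f r := Metric.infDist_nonneg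
  have hfar : ∀ i ≤ N, f r ≤ dist (x i) (σ r) := fun i hi => by
    rw [dist_comm]
    exact infDist_image_le x (Nat.zero_le i) hi (σ r)
  have hprod : ∀ s ∈ Set.Icc (0 : ℝ) L, |s - r| = 2 * f r →
      ∃ i ≤ N, dist (σ s) (x i) ≤ f r ∧ f r ≤ gromovProduct (σ s) (x i) (σ r) := by
    intro s hs hsr
    obtain ⟨i, hi, h⟩ := hnear s hs
    refine ⟨i, hi, h, ?_⟩
    have := hfar i hi
    have := hσ s hs r hr
    unfold gromovProduct
    linarith
  have hprod_end : ∀ i ≤ N, f r ≤ gromovProduct (x i) (x i) (σ r) := by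
    intro i hi
    have := hfar i hi
    simp only [gromovProduct, dist_self]
    linarith
  obtain ⟨u, hu, hur, hru, i, hi, hdi, hpi⟩ : ∃ u ∈ Set.Icc (0 : ℝ) L, u ≤ r ∧ r - u ≤ 2 * f r ∧
      ∃ i ≤ N, dist (σ u) (x i) ≤ f r ∧ f r ≤ gromovProduct (σ u) (x i) (σ r) := by
    by_cases h : 2 * f r ≤ r
    · have hs : r - 2 * f r ∈ Set.Icc (0 : ℝ) L := ⟨by linarith, by linarith [hr.2]⟩
      exact ⟨_, hs, by linarith, by linarith, hprod _ hs (by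
        rw [sub_sub_cancel_left, abs_neg, abs_of_nonneg (by linarith)])⟩
    · refine ⟨0, ⟨le_rfl, hr.1.trans hr.2⟩, hr.1, by linarith, 0, Nat.zero_le _, ?_⟩
      rw [h0, dist_self]
      exact ⟨hD0, hprod_end 0 (Nat.zero_le _)⟩
  obtain ⟨v, hv, hrv, hvr, j, hj, hdj, hpj⟩ : ∃ v ∈ Set.Icc (0 : ℝ) L, r ≤ v ∧ v - r ≤ 2 * f r ∧
      ∃ i ≤ N, dist (σ v) (x i) ≤ f r ∧ f r ≤ gromovProduct (σ v) (x i) (σ r) := by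
    by_cases h : r + 2 * f r ≤ L
    · have hs : r + 2 * f r ∈ Set.Icc (0 : ℝ) L := ⟨by linarith [hr.1], h⟩
      exact ⟨_, hs, by linarith, by linarith, hprod _ hs (by
        rw [add_sub_cancel_left, abs_of_nonneg (by linarith)])⟩
    · refine ⟨L, ⟨hr.1.trans hr.2, le_rfl⟩, hr.2, by linarith, N, le_rfl, ?_⟩
      rw [hL, dist_self]
      exact ⟨hD0, hprod_end N le_rfl⟩
  have hduv : dist (σ u) (σ v) = v - u := by
    rw [hσ u hu v hv, abs_sub_comm, abs_of_nonneg (by linarith)]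
  have hij : dist (x i) (x j) ≤ 6 * f r := by
    have h1 := dist_triangle4 (x i) (σ u) (σ v) (x j)
    rw [dist_comm (x i) (σ u)] at h1
    linarith
  have hij' := hx.abs_sub_le hK hij
  have hstep : ∀ i, dist (x i) (x (i + 1)) ≤ K + C := by
    intro i
    have := (hx i (i + 1)).2
    simpa using this
  refine hbound _ hD0 fun k hk => ?_
  have hchain := hX.le_gromovProduct_of_le_two_pow hδ (by linarith : 0 ≤ K + C) (σ r) hfar hstep
    hi hj (k := k) (by linarith)
  have hkδ : 0 ≤ k * δ := by positivity
  have h1 := hX.le_gromovProduct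
    (show f r - (K + C) / 2 - k * δ ≤ gromovProduct (σ u) (x i) (σ r) by linarith) hchain
  rw [gromovProduct_comm] at hpj
  have h2 := hX.le_gromovProduct h1
    (show f r - (K + C) / 2 - k * δ - δ ≤ gromovProduct (x j) (σ v) (σ r) by linarith)
  have h3 : gromovProduct (σ u) (σ v) (σ r) = 0 := by
    rw [gromovProduct, hduv, hσ u hu r hr, hσ v hv r hr, abs_sub_comm u,
      abs_of_nonneg (by linarith), abs_of_nonneg (by linarith)]
    ring
  linarith

/-- A quasi-geodesic is uniformly close to a geodesic with the same endpoints, provided the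
geodesic is close to the quasi-geodesic. -/
theorem IsQuasiGeodesicSeq.exists_dist_geodesic_le {K C R : ℝ} (hK : 1 ≤ K) {x : ℕ → X}
    (hx : IsQuasiGeodesicSeq K C x) {N : ℕ} {σ : ℝ → X} {L : ℝ} (hL0 : 0 ≤ L) (h0 : σ 0 = x 0)
    (hL : σ L = x N) (hσ : IsGeodesicOn σ L)
    (hR : ∀ r ∈ Set.Icc (0 : ℝ) L, ∃ i ≤ N, dist (σ r) (x i) ≤ R) {i : ℕ} (hi : i ≤ N) :
    ∃ r ∈ Set.Icc (0 : ℝ) L, dist (x i) (σ r) ≤ K * (K * (2 * R + C)) + C + R := by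
  set f : ℝ → ℝ := fun s => Metric.infDist (σ s) (x '' Set.Icc 0 i)
  set g : ℝ → ℝ := fun s => Metric.infDist (σ s) (x '' Set.Icc i N)
  have hfc : ContinuousOn f (Set.Icc 0 L) :=
    (Metric.continuous_infDist_pt _).comp_continuousOn hσ.continuousOn
  have hgc : ContinuousOn g (Set.Icc 0 L) :=
    (Metric.continuous_infDist_pt _).comp_continuousOn hσ.continuousOn
  have hf0 : f 0 ≤ 0 := by
    have := infDist_image_le x le_rfl (Nat.zero_le i) (σ 0)
    rwa [h0, dist_self, ← h0] at this
  have hgL : g L ≤ 0 := by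
    have := infDist_image_le x hi le_rfl (σ L)
    rwa [hL, dist_self, ← hL] at this
  obtain ⟨r, hr, hfg⟩ := intermediate_value_Icc hL0 (hfc.sub hgc)
    (show (0 : ℝ) ∈ Set.Icc (f 0 - g 0) (f L - g L) from
      ⟨by linarith [show 0 ≤ g 0 from Metric.infDist_nonneg],
        by linarith [show 0 ≤ f L from Metric.infDist_nonneg]⟩)
  have hfg' : f r = g r := sub_eq_zero.1 hfg
  have hfR : f r ≤ R := by
    obtain ⟨l, hl, hlR⟩ := hR r hr
    rcases le_total l i with h | h
    · exact (infDist_image_le x (Nat.zero_le l) h (σ r)).trans hlR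
    · rw [hfg']
      exact (infDist_image_le x h hl (σ r)).trans hlR
  obtain ⟨j, -, hj, hdj⟩ := exists_infDist_image_eq_dist x (Nat.zero_le i) (σ r)
  obtain ⟨k, hk, -, hdk⟩ := exists_infDist_image_eq_dist x hi (σ r)
  change f r = _ at hdj
  change g r = _ at hdk
  have hjk : |(j : ℝ) - k| ≤ K * (2 * R + C) := by
    refine hx.abs_sub_le hK ?_
    have := dist_triangle_left (x j) (x k) (σ r)
    linarith
  have hij : |(i : ℝ) - j| ≤ |(j : ℝ) - k| := by
    have h1 : (j : ℝ) ≤ i := by exact_mod_cast hj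
    have h2 : (i : ℝ) ≤ k := by exact_mod_cast hk
    rw [abs_of_nonneg (by linarith), abs_sub_comm, abs_of_nonneg (by linarith)]
    linarith
  have h1 : K * |(i : ℝ) - j| ≤ K * (K * (2 * R + C)) := by
    gcongr
    exact hij.trans hjk
  refine ⟨r, hr, ?_⟩
  have h2 := (hx i j).2
  have h3 := dist_triangle_right (x i) (σ r) (x j)
  linarith

/-- Two geodesics from a common origin stay close up to the Gromov product of their endpoints. -/
theorem IsGromovHyperbolic.dist_geodesic_le {δ : ℝ} (hδ : 0 ≤ δ) (hX : IsGromovHyperbolic X δ)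
    {σ τ : ℝ → X} {L L' r : ℝ} (hσ : IsGeodesicOn σ L) (hτ : IsGeodesicOn τ L') (h0 : σ 0 = τ 0)
    (hr : r ∈ Set.Icc 0 L) (hr' : r ∈ Set.Icc 0 L')
    (hprod : r ≤ gromovProduct (σ L) (τ L') (σ 0)) : dist (σ r) (τ r) ≤ 4 * δ := by
  have key : ∀ {ρ : ℝ → X} {l : ℝ}, IsGeodesicOn ρ l → r ∈ Set.Icc 0 l →
      dist (ρ r) (ρ 0) = r ∧ gromovProduct (ρ r) (ρ l) (ρ 0) = r := by
    intro ρ l hρ hrl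
    have hl : (0 : ℝ) ≤ l := hrl.1.trans hrl.2
    have h1 : dist (ρ r) (ρ 0) = r := by
      rw [hρ r hrl 0 ⟨le_rfl, hl⟩, sub_zero, abs_of_nonneg hrl.1]
    refine ⟨h1, ?_⟩
    rw [gromovProduct, h1, hρ l ⟨hl, le_rfl⟩ 0 ⟨le_rfl, hl⟩, hρ r hrl l ⟨hl, le_rfl⟩, sub_zero,
      abs_of_nonneg hl, abs_sub_comm, abs_of_nonneg (by linarith [hrl.2])]
    ring
  obtain ⟨h1, h2⟩ := key hσ hr
  obtain ⟨h3, h4⟩ := key hτ hr'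
  rw [← h0] at h3 h4
  rw [gromovProduct_comm] at h4
  have h5 := hX.le_gromovProduct h2.ge hprod
  have h6 := hX.le_gromovProduct h5
    (show r - δ ≤ gromovProduct (τ L') (τ r) (σ 0) by linarith)
  rw [gromovProduct, h1, h3] at h6
  linarith

end

/-- stability of asymptotic quasi-geodesic rays with common origin in a
δ-hyperbolic geodesic metric space. -/
theorem stmt_0 :
    ∀ K C δ : ℝ, 1 ≤ K → 0 ≤ C → 0 ≤ δ →
    ∃ B : ℝ, 0 ≤ B ∧
      ∀ (X : Type) [inst : MetricSpace X],
        -- X is geodesic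
        (∀ x y : X, ∃ σ : ℝ → X, σ 0 = x ∧ σ (dist x y) = y ∧
          ∀ s ∈ Set.Icc (0:ℝ) (dist x y), ∀ t ∈ Set.Icc (0:ℝ) (dist x y),
            dist (σ s) (σ t) = |s - t|) →
        -- X is δ-hyperbolic (four-point Gromov product condition)
        (∀ x y z w : X,
          min ((dist x w + dist z w - dist x z) / 2)
              ((dist y w + dist z w - dist y z) / 2) - δ
            ≤ (dist x w + dist y w - dist x y) / 2) →
        ∀ γ γ' : ℝ → X,
          -- γ is a (K,C)-quasi-geodesic ray
          (∀ s t : ℝ, 0 ≤ s → 0 ≤ t →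
            |s - t| / K - C ≤ dist (γ s) (γ t) ∧ dist (γ s) (γ t) ≤ K * |s - t| + C) →
          -- γ' is a (K,C)-quasi-geodesic ray
          (∀ s t : ℝ, 0 ≤ s → 0 ≤ t →
            |s - t| / K - C ≤ dist (γ' s) (γ' t) ∧ dist (γ' s) (γ' t) ≤ K * |s - t| + C) →
          -- same origin
          γ 0 = γ' 0 →
          -- asymptotic: the Gromov products (γ(s), γ'(t))_{γ(0)} tend to infinity
          (∀ M : ℝ, ∃ T : ℝ, ∀ s t : ℝ, 0 ≤ s → 0 ≤ t → T ≤ s → T ≤ t →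
            M ≤ (dist (γ s) (γ 0) + dist (γ' t) (γ 0) - dist (γ s) (γ' t)) / 2) →
          -- conclusion: every point of γ lies within B of the image of γ'
          ∀ s : ℝ, 0 ≤ s → ∃ t : ℝ, 0 ≤ t ∧ dist (γ s) (γ' t) ≤ B := by
  intro K C δ hK hC hδ
  obtain ⟨R, hR, hmorse⟩ := exists_forall_geodesic_near_quasiGeodesic.{0} K C δ hK hC hδ
  set R' : ℝ := K * (K * (2 * R + C)) + C + R
  have hR'0 : 0 ≤ R' := by positivity
  refine ⟨K + C + R' + 4 * δ + R, by positivity, ?_⟩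
  intro X _ hgeod hhyp γ γ' hγ hγ' h0 hasymp s hs
  have hX : IsGromovHyperbolic X δ := hhyp
  have hx : IsQuasiGeodesicSeq K C (fun n : ℕ => γ n) := fun i j =>
    hγ i j (Nat.cast_nonneg i) (Nat.cast_nonneg j)
  have hx' : IsQuasiGeodesicSeq K C (fun n : ℕ => γ' n) := fun i j =>
    hγ' i j (Nat.cast_nonneg i) (Nat.cast_nonneg j)
  set i : ℕ := ⌊s⌋₊
  obtain ⟨T, hT⟩ := hasymp (dist (γ 0) (γ i) + R')
  set N : ℕ := max i ⌈T⌉₊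
  have hTN : T ≤ (N : ℝ) := (Nat.le_ceil T).trans (by exact_mod_cast le_max_right _ _)
  have hprod := hT N N (Nat.cast_nonneg N) (Nat.cast_nonneg N) hTN hTN
  obtain ⟨σ, hσ0, hσL, hσ⟩ := hgeod (γ 0) (γ N)
  obtain ⟨τ, hτ0, hτL, hτ⟩ := hgeod (γ 0) (γ' N)
  obtain ⟨r, hr, hir⟩ := hx.exists_dist_geodesic_le hK dist_nonneg (by simpa using hσ0) hσL hσ
    (hmorse X hX _ hx N σ _ (by simpa using hσ0) hσL hσ) (le_max_left i ⌈T⌉₊)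
  have hrM : r ≤ dist (γ 0) (γ i) + R' := by
    have h1 := hσ 0 ⟨le_rfl, dist_nonneg⟩ r hr
    rw [zero_sub, abs_neg, abs_of_nonneg hr.1, hσ0] at h1
    have h2 := dist_triangle (γ 0) (γ i) (σ r)
    linarith
  have hr' : r ∈ Set.Icc 0 (dist (γ 0) (γ' N)) := by
    refine ⟨hr.1, ?_⟩
    have := dist_triangle_right (γ N) (γ 0) (γ' N)
    have := dist_triangle (γ N) (γ' N) (γ 0)
    rw [dist_comm (γ 0)]
    linarith
  have hστ : dist (σ r) (τ r) ≤ 4 * δ := by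
    refine hX.dist_geodesic_le hδ hσ hτ (hσ0.trans hτ0.symm) hr hr' ?_
    rw [hσL, hτL, hσ0]
    exact hrM.trans hprod
  obtain ⟨j, -, hj⟩ := hmorse X hX _ hx' N τ _ (by simpa [h0] using hτ0) hτL hτ r hr'
  refine ⟨j, Nat.cast_nonneg j, ?_⟩
  have hsi : dist (γ s) (γ i) ≤ K + C := by
    have h1 := (hγ s i hs (Nat.cast_nonneg i)).2
    have h2 : |s - i| ≤ 1 := by
      rw [abs_le]
      constructor <;> linarith [Nat.floor_le hs, Nat.lt_floor_add_one s]
    have h3 : K * |s - i| ≤ K * 1 := by gcongr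
    linarith
  have h1 := dist_triangle (γ s) (γ i) (γ' j)
  have h2 := dist_triangle4 (γ i) (σ r) (τ r) (γ' j)
  linarith
end

section
/- Let G be a group with a (K,C)-quasi-action A on a simplicial tree T, let g ∈ G and x ∈ T. Then either the set {A(gⁿ, x) : n ∈ ℤ} has finite diameter (g quasi-acts elliptically), or there exist K' ≥ 1 and C' ≥ 0 such that the map n ↦ A(gⁿ, x) is a (K',C')-quasi-isometric embedding of ℤ (with its usual metric) into T (g quasi-acts hyperbolically). -/
namespace SimpleGraph.IsTree

variable {V : Type*} {T : SimpleGraph V}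

/-- In a tree, the neighbour of `x` that is closer to `a` is unique. -/
theorem eq_of_adj_of_dist_succ (hT : T.IsTree) {x y z a : V} (hy : T.Adj x y) (hz : T.Adj x z)
    (hya : T.dist y a + 1 = T.dist x a) (hza : T.dist z a + 1 = T.dist x a) : y = z := by
  obtain ⟨p, hp⟩ := hT.connected.exists_walk_length_eq_dist y a
  obtain ⟨q, hq⟩ := hT.connected.exists_walk_length_eq_dist z a
  have hp' : (Walk.cons hy p).IsPath :=
    Walk.isPath_of_length_eq_dist _ (by simp [hp, hya])
  have hq' : (Walk.cons hz q).IsPath :=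
    Walk.isPath_of_length_eq_dist _ (by simp [hq, hza])
  have h := (hT.existsUnique_path x a).unique hp' hq'
  simpa using congrArg (fun w => w.getVert 1) h

theorem exists_adj_dist_succ (hT : T.IsTree) {x a : V} {n : ℕ} (h : T.dist x a = n + 1) :
    ∃ y, T.Adj x y ∧ T.dist y a = n := by
  obtain ⟨p, hp⟩ := hT.connected.exists_walk_length_eq_dist x a
  cases p with
  | nil => simp at h
  | @cons _ y _ hxy p =>
    refine ⟨y, hxy, ?_⟩
    have h1 := T.dist_le p
    have h2 := hT.connected.dist_triangle (u := x) (v := y) (w := a)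
    have h3 := dist_eq_one_iff_adj.2 hxy
    rw [Walk.length_cons] at hp
    omega

/-- Either `x` lies between `a` and `b`, or some neighbour of `x` is closer to both. -/
theorem dist_eq_add_or_exists_adj (hT : T.IsTree) (a b x : V) :
    T.dist a b = T.dist x a + T.dist x b ∨
      ∃ y, T.Adj x y ∧ T.dist y a + 1 = T.dist x a ∧ T.dist y b + 1 = T.dist x b := by
  induction h : T.dist x b generalizing x with
  | zero =>
    left
    obtain rfl := hT.connected.dist_eq_zero_iff.1 h
    rw [dist_comm, add_zero]
  | succ n ih =>
    obtain ⟨y, hxy, hyb⟩ := hT.exists_adj_dist_succ h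
    have hxya := hT.dist_eq_dist_add_one_of_adj a hxy
    rw [dist_comm (u := a) (v := x), dist_comm (u := a) (v := y)] at hxya
    rcases hxya with hxya | hxya
    · exact Or.inr ⟨y, hxy, hxya.symm, by rw [hyb]⟩
    · rcases ih y hyb with h' | ⟨z, hyz, hza, hzb⟩
      · left
        omega
      · obtain rfl := hT.eq_of_adj_of_dist_succ hyz hxy.symm hza hxya.symm
        omega

/-- The four point condition: trees are `0`-hyperbolic. -/
theorem dist_add_dist_le_max (hT : T.IsTree) (x y z w : V) :
    T.dist x y + T.dist z w ≤
      max (T.dist x z + T.dist y w) (T.dist x w + T.dist y z) := by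
  induction h : T.dist x y generalizing x with
  | zero =>
    obtain rfl := hT.connected.dist_eq_zero_iff.1 h
    have := hT.connected.dist_triangle (u := z) (v := x) (w := w)
    rw [dist_comm (u := z) (v := x)] at this
    omega
  | succ n ih =>
    have h1 := hT.connected.dist_triangle (u := z) (v := x) (w := w)
    rw [dist_comm (u := z) (v := x)] at h1
    rcases hT.dist_eq_add_or_exists_adj y z x with hz | ⟨u, hxu, huy, huz⟩
    · omega
    rcases hT.dist_eq_add_or_exists_adj y w x with hw | ⟨v, hxv, hvy, hvw⟩
    · omega
    obtain rfl := hT.eq_of_adj_of_dist_succ hxu hxv huy hvy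
    have := ih u (by omega)
    omega

theorem exists_geodesic (hT : T.IsTree) (u v : V) :
    ∃ (l : ℕ) (q : ℕ → V), 0 < l ∧ q 0 = u ∧ q l = v ∧
      (∀ s, T.dist u (q s) + T.dist (q s) v ≤ T.dist u v) ∧
      ∀ s, T.dist (q s) (q (s + 1)) ≤ 1 := by
  obtain ⟨p, hp⟩ := hT.connected.exists_walk_length_eq_dist u v
  refine ⟨p.length + 1, p.getVert, by omega, p.getVert_zero, p.getVert_of_length_le (by omega),
    fun s => ?_, fun s => ?_⟩
  · have h1 := T.dist_le (p.take s)
    have h2 := T.dist_le (p.drop s)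
    rw [Walk.take_length] at h1
    rw [Walk.drop_length] at h2
    omega
  · by_cases hs : s < p.length
    · exact (dist_eq_one_iff_adj.2 (p.adj_getVert_succ hs)).le
    · rw [p.getVert_of_length_le (by omega), p.getVert_of_length_le (by omega)]
      simp

end SimpleGraph.IsTree

theorem exists_le_and_lt_succ {f : ℕ → ℝ} {c : ℝ} {l : ℕ} (h0 : f 0 ≤ c) (hl : c < f l) :
    ∃ s < l, f s ≤ c ∧ c < f (s + 1) := by
  by_contra! h
  have key : ∀ s ≤ l, f s ≤ c := by
    intro s
    induction s with
    | zero => exact fun _ => h0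
    | succ s ih => exact fun hs => h s (by omega) (ih (by omega))
  exact absurd (key l le_rfl) (not_le.2 hl)

/-- If increments of a Lipschitz sequence over a fixed time `r` are all large in absolute value,
then they have constant sign, so the sequence escapes linearly. -/
theorem le_abs_sub_of_lt_abs_sub {f : ℕ → ℝ} {L : ℝ} {r m : ℕ} (hL : 0 ≤ L)
    (hlip : ∀ t, |f (t + 1) - f t| ≤ L) (hr : ∀ t ≤ m * r, 2 * L < |f (t + r) - f t|) :
    2 * L * m ≤ |f (m * r) - f 0| := by
  wlog hpos : 0 ≤ f (0 + r) - f 0 generalizing f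
  · have h := this (f := fun t => -f t)
      (fun t => by rw [neg_sub_neg, abs_sub_comm]; exact hlip t)
      (fun t ht => by rw [neg_sub_neg, abs_sub_comm]; exact hr t ht) (by linarith)
    rwa [neg_sub_neg, abs_sub_comm] at h
  have key : ∀ t ≤ m * r, 2 * L < f (t + r) - f t := by
    intro t
    induction t with
    | zero =>
      intro h
      have := hr 0 h
      rwa [abs_of_nonneg hpos] at this
    | succ t ih =>
      intro h
      have h1 := ih (by omega)
      have h2 := abs_le.1 (hlip t)
      have h3 := abs_le.1 (hlip (t + r))
      rcases lt_abs.1 (hr (t + 1) h) with h4 | h4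
      · exact h4
      · rw [show t + 1 + r = t + r + 1 by ring] at h4
        linarith
  have sum : ∀ s ≤ m, 2 * L * s ≤ f (s * r) - f 0 := by
    intro s
    induction s with
    | zero => simp
    | succ s ih =>
      intro h
      have h1 := ih (by omega)
      have h2 := key (s * r) (Nat.mul_le_mul_right r (by omega))
      rw [show (s + 1) * r = s * r + r by ring]
      push_cast
      linarith
  exact (sum m le_rfl).trans (le_abs_self _)

section FourPoint

variable {X : Type*} [PseudoMetricSpace X]

/-- The four point condition defining `0`-hyperbolic spaces. -/
def FourPoint (X : Type*) [PseudoMetricSpace X] : Prop :=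
  ∀ x y z w : X, dist x y + dist z w ≤ max (dist x z + dist y w) (dist x w + dist y z)

/-- Any two points are joined by a discrete geodesic with steps at most `1`. -/
def DiscretelyGeodesic (X : Type*) [PseudoMetricSpace X] : Prop :=
  ∀ u v : X, ∃ (l : ℕ) (q : ℕ → X), 0 < l ∧ q 0 = u ∧ q l = v ∧
    (∀ s, dist u (q s) + dist (q s) v ≤ dist u v) ∧ ∀ s, dist (q s) (q (s + 1)) ≤ 1

theorem FourPoint.exists_dist_le_of_chain (h4 : FourPoint X) {u v p : X} {S : ℝ} (hS : 0 ≤ S)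
    (hp : dist u p + dist p v ≤ dist u v) {b : ℕ → X} {l : ℕ} (h0 : b 0 = u) (hl : b l = v)
    (hstep : ∀ s < l, dist (b s) (b (s + 1)) ≤ S) : ∃ s ≤ l, dist (b s) p ≤ S := by
  by_cases hpv : dist p v ≤ S
  · exact ⟨l, le_rfl, by rwa [hl, dist_comm]⟩
  obtain ⟨s, hs, h1, h2⟩ := exists_le_and_lt_succ (f := fun s => dist u (b s) - dist v (b s))
    (c := dist u p - dist p v) (l := l)
    (by
      have := dist_triangle u p v
      simp only [h0, dist_self, dist_comm v u]
      linarith [dist_nonneg (x := u) (y := p)])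
    (by
      simp only [hl, dist_self]
      linarith [dist_nonneg (x := u) (y := p)])
  refine ⟨s, hs.le, ?_⟩
  set w := b s
  set w' := b (s + 1)
  have h3 := hstep s hs
  have e1 := h4 w p u v
  have e2 := h4 w' p u v
  have e3 := h4 w v w' u
  simp only [dist_comm w u, dist_comm w v, dist_comm w' u, dist_comm w' v, dist_comm p u,
    dist_comm v u] at *
  rcases le_max_iff.1 e1 with e1 | e1 <;> rcases le_max_iff.1 e2 with e2 | e2 <;>
    rcases le_max_iff.1 e3 with e3 | e3 <;>
    linarith [dist_nonneg (x := w) (y := p), dist_nonneg (x := w') (y := p)]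

theorem FourPoint.between_of_far (h4 : FourPoint X) {u u' q v : X} {B : ℝ}
    (hq : dist u' q + dist q v ≤ dist u' v) (hu : dist u u' ≤ B) (hfar : B < dist u q) :
    dist u q + dist q v ≤ dist u v := by
  have e := h4 u q u' v
  rw [dist_comm q u'] at e
  rcases le_max_iff.1 e with e | e
  · linarith [dist_nonneg (x := u') (y := q)]
  · linarith

theorem FourPoint.dist_le_abs_sub (h4 : FourPoint X) {u v w w' : X} {D : ℝ}
    (hw : dist u w + dist w v ≤ dist u v + 2 * D)
    (hw' : dist u w' + dist w' v ≤ dist u v + 2 * D) :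
    dist w w' - 2 * D ≤ |dist u w' - dist u w| := by
  have e := h4 w w' u v
  rw [dist_comm w u, dist_comm w' u] at e
  rcases le_max_iff.1 e with e | e
  · rw [abs_sub_comm]
    exact le_trans (by linarith) (le_abs_self _)
  · exact le_trans (by linarith) (le_abs_self _)

theorem DiscretelyGeodesic.exists_midpoint (hg : DiscretelyGeodesic X) {u v : X}
    (h : 0 < dist u v) : ∃ p, dist u p + dist p v ≤ dist u v ∧
      dist u v / 2 - 1 ≤ dist u p ∧ dist u v / 2 - 1 ≤ dist p v := by
  obtain ⟨l, q, -, h0, hl, hbet, hstep⟩ := hg u v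
  obtain ⟨s, -, h1, h2⟩ := exists_le_and_lt_succ (f := fun s => dist u (q s))
    (c := dist u v / 2) (l := l)
    (by simp only [h0, dist_self]; linarith) (by simp only [hl]; linarith)
  have h3 := dist_triangle u (q s) (q (s + 1))
  have h4 := dist_triangle u (q s) v
  exact ⟨q s, hbet s, by linarith [hstep s], by linarith⟩

variable {a : ℤ → X} {L K E : ℝ}

theorem dist_add_natCast_le (hstep : ∀ n, dist (a n) (a (n + 1)) ≤ L) (n : ℤ) (t : ℕ) :
    dist (a n) (a (n + t)) ≤ L * t := by
  induction t with
  | zero => simp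
  | succ t ih =>
    have h1 := dist_triangle (a n) (a (n + t)) (a (n + t + 1))
    have h2 := hstep (n + t)
    push_cast
    rw [← add_assoc]
    linarith

theorem FourPoint.exists_orbit_near (h4 : FourPoint X) (hL : 0 ≤ L)
    (hstep : ∀ n, dist (a n) (a (n + 1)) ≤ L) {i j : ℤ} (hij : i ≤ j) {p : X}
    (hp : dist (a i) p + dist p (a j) ≤ dist (a i) (a j)) : ∃ k, dist (a k) p ≤ L := by
  obtain ⟨s, -, hs⟩ := h4.exists_dist_le_of_chain (b := fun s : ℕ => a (i + s))
    (l := (j - i).toNat) hL hp (by simp)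
    (by simp only [Int.toNat_of_nonneg (sub_nonneg.2 hij)]; congr 1; ring)
    (fun s _ => by
      have := hstep (i + s)
      push_cast
      rwa [← add_assoc])
  exact ⟨_, hs⟩

/-- Lying near the geodesic between two orbit points is invariant under translation, with
uniform constants. -/
theorem FourPoint.exists_near_translate (h4 : FourPoint X) (hg : DiscretelyGeodesic X)
    (hK : 0 ≤ K) (hE : 0 ≤ E) (hL : 0 ≤ L) (hstep : ∀ n, dist (a n) (a (n + 1)) ≤ L)
    (hhom : ∀ m n t, dist (a (m + t)) (a (n + t)) ≤ K * dist (a m) (a n) + E)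
    {i j k : ℤ} (hij : i ≤ j) {p : X} (hp : dist (a i) p + dist p (a j) ≤ dist (a i) (a j))
    (hk : dist (a k) p ≤ L) (t : ℤ) :
    ∃ q, dist (a (i + t)) q + dist q (a (j + t)) ≤ dist (a (i + t)) (a (j + t)) ∧
      dist (a (k + t)) q ≤ K * (K * (2 * L + 1) + E + L) + E + L := by
  obtain ⟨l, q, hl, h0, hl', hbet, hq⟩ := hg (a (i + t)) (a (j + t))
  have hn : ∀ s, ∃ n, dist (a n) (q s) ≤ L ∧ (s = 0 → n = i + t) ∧ (s = l → n = j + t) := by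
    intro s
    by_cases hs0 : s = 0
    · exact ⟨i + t, by rw [hs0, h0, dist_self]; exact hL, fun _ => rfl, by omega⟩
    by_cases hsl : s = l
    · exact ⟨j + t, by rw [hsl, hl', dist_self]; exact hL, by omega, fun _ => rfl⟩
    obtain ⟨n, hn⟩ := h4.exists_orbit_near hL hstep (by omega) (hbet s)
    exact ⟨n, hn, by omega, by omega⟩
  choose n hn hn0 hnl using hn
  obtain ⟨s, -, hs⟩ := h4.exists_dist_le_of_chain (b := fun s => a (n s + -t)) (l := l)
    (S := K * (2 * L + 1) + E) (by positivity) hp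
    (by simp [hn0 0 rfl]) (by simp [hnl l rfl])
    (fun s _ => by
      have h1 := hhom (n s) (n (s + 1)) (-t)
      have h2 := dist_triangle4 (a (n s)) (q s) (q (s + 1)) (a (n (s + 1)))
      have h3 := hn (s + 1)
      rw [dist_comm] at h3
      have h5 : dist (a (n s)) (a (n (s + 1))) ≤ 2 * L + 1 := by linarith [hn s, hq s]
      linarith [mul_le_mul_of_nonneg_left h5 hK])
  refine ⟨q s, hbet s, ?_⟩
  have h1 := hhom k (n s + -t) t
  rw [neg_add_cancel_right] at h1
  have h2 := dist_triangle_right (a k) (a (n s + -t)) p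
  have h3 : dist (a k) (a (n s + -t)) ≤ K * (2 * L + 1) + E + L := by linarith
  have h5 := dist_triangle (a (k + t)) (a (n s)) (q s)
  linarith [mul_le_mul_of_nonneg_left h3 hK, hn s]

/-- An unbounded quasi-homogeneous sequence in a discretely geodesic `0`-hyperbolic space
escapes linearly along some arithmetic progression. -/
theorem FourPoint.exists_linear_escape (h4 : FourPoint X) (hg : DiscretelyGeodesic X)
    (hK : 1 ≤ K) (hE : 0 ≤ E) (hL : 1 ≤ L) (hstep : ∀ n, dist (a n) (a (n + 1)) ≤ L)
    (hhom : ∀ m n t, dist (a (m + t)) (a (n + t)) ≤ K * dist (a m) (a n) + E)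
    (hunb : ∀ D : ℝ, ∃ i j, i ≤ j ∧ D < dist (a i) (a j)) :
    ∃ r : ℕ, 0 < r ∧ ∀ (n : ℤ) (m : ℕ), (m : ℝ) ≤ K * dist (a n) (a (n + m * r)) + E := by
  set D := K * (K * (2 * L + 1) + E + L) + E + L with hD
  have hD0 : 0 ≤ D := by positivity
  obtain ⟨r, hr0, hr⟩ : ∃ r : ℕ, 0 < r ∧ ∀ n : ℤ, 2 * L + 2 * D < dist (a n) (a (n + r)) := by
    obtain ⟨i, j, hij, h⟩ := hunb (K * (2 * L + 2 * D) + E)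
    refine ⟨(j - i).toNat, ?_, fun n => ?_⟩
    · have : i ≠ j := by
        rintro rfl
        rw [dist_self] at h
        have : 0 ≤ K * (2 * L + 2 * D) + E := by positivity
        linarith
      omega
    · have h1 := hhom n (n + (j - i).toNat) (i - n)
      rw [Int.toNat_of_nonneg (sub_nonneg.2 hij), show n + (i - n) = i by ring,
        show n + (j - i) + (i - n) = j by ring] at h1
      rw [Int.toNat_of_nonneg (sub_nonneg.2 hij)]
      exact lt_of_mul_lt_mul_left (by linarith) (by linarith : (0 : ℝ) ≤ K)
  refine ⟨r, hr0, fun n m => ?_⟩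
  set N := (m + 1) * r with hN
  obtain ⟨i, j, hij, hbig⟩ := hunb (2 * (2 * (L * N) + L + D + 1))
  have hLN : 0 ≤ L * N := by positivity
  obtain ⟨p, hp, hip, hpj⟩ := hg.exists_midpoint (lt_of_le_of_lt (by positivity) hbig)
  obtain ⟨k, hk⟩ := h4.exists_orbit_near (by linarith) hstep hij hp
  have hnear : ∀ t : ℕ, t ≤ N →
      dist (a i) (a (k + t)) + dist (a (k + t)) (a j) ≤ dist (a i) (a j) + 2 * D := by
    intro t ht
    obtain ⟨q, hq, hqk⟩ := h4.exists_near_translate hg (by linarith) hE (by linarith) hstep hhom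
      hij hp hk t
    rw [← hD] at hqk
    have htN : L * (t : ℝ) ≤ L * N :=
      mul_le_mul_of_nonneg_left (by exact_mod_cast ht) (by linarith)
    have hit := (dist_add_natCast_le hstep i t).trans htN
    have hjt := (dist_add_natCast_le hstep j t).trans htN
    have hkt := (dist_add_natCast_le hstep k t).trans htN
    have hpq : dist p q ≤ L + L * N + D := by
      have h1 := dist_triangle4 p (a k) (a (k + t)) q
      rw [dist_comm p (a k)] at h1
      linarith
    have hiq : L * N < dist (a i) q := by
      have := dist_triangle_right (a i) p q
      linarith
    have hjq : L * N < dist (a j) q := by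
      have := dist_triangle_right (a j) p q
      rw [dist_comm (a j) p] at this
      linarith
    have h1 := h4.between_of_far hq hit hiq
    rw [add_comm, dist_comm q, dist_comm (a i) q, dist_comm (a i)] at h1
    have h2 := h4.between_of_far h1 hjt hjq
    rw [dist_comm (a j) (a i)] at h2
    have h3 := dist_triangle_right (a i) (a (k + t)) q
    have h5 := dist_triangle (a (k + t)) q (a j)
    rw [dist_comm q (a i)] at h2
    rw [dist_comm q (a j)] at h5
    linarith
  have hesc := le_abs_sub_of_lt_abs_sub (f := fun t : ℕ => dist (a i) (a (k + t))) (L := L)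
    (r := r) (m := m) (by linarith)
    (fun t => by
      have h1 := abs_dist_sub_le (a (k + t + 1)) (a (k + t)) (a i)
      rw [dist_comm _ (a i), dist_comm _ (a i)] at h1
      push_cast
      rw [← add_assoc]
      exact h1.trans (by rw [dist_comm]; exact hstep _))
    (fun t ht => by
      have h1 := h4.dist_le_abs_sub (hnear t (by rw [hN, add_mul]; omega))
        (hnear (t + r) (by rw [hN, add_mul]; omega))
      have h2 := hr (k + t)
      push_cast at h1 ⊢
      rw [← add_assoc] at h1 ⊢
      linarith)
  have h1 := abs_dist_sub_le (a k) (a (k + m * r)) (a i)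
  rw [dist_comm _ (a i), dist_comm _ (a i), abs_sub_comm] at h1
  push_cast at hesc
  rw [add_zero] at hesc
  have h2 := hhom n (n + m * r) (k - n)
  rw [show n + (k - n) = k by ring, show n + m * r + (k - n) = k + m * r by ring] at h2
  have h3 : (m : ℝ) ≤ 2 * L * m := le_mul_of_one_le_left (by positivity) (by linarith)
  linarith

theorem FourPoint.bounded_or_quasiIsometricEmbedding (h4 : FourPoint X)
    (hg : DiscretelyGeodesic X) (hK : 1 ≤ K) (hE : 0 ≤ E)
    (hhom : ∀ m n t, dist (a (m + t)) (a (n + t)) ≤ K * dist (a m) (a n) + E) :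
    (∃ D : ℝ, ∀ m n, dist (a m) (a n) ≤ D) ∨
    (∃ K' C' : ℝ, 1 ≤ K' ∧ 0 ≤ C' ∧ ∀ m n : ℤ,
      |(m : ℝ) - (n : ℝ)| / K' - C' ≤ dist (a m) (a n) ∧
        dist (a m) (a n) ≤ K' * |(m : ℝ) - (n : ℝ)| + C') := by
  refine or_iff_not_imp_left.2 fun hunb => ?_
  push Not at hunb
  obtain ⟨L, hL, hstep⟩ : ∃ L : ℝ, 1 ≤ L ∧ ∀ n, dist (a n) (a (n + 1)) ≤ L := by
    refine ⟨K * dist (a 0) (a 1) + E + 1, ?_, fun n => ?_⟩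
    · have : 0 ≤ K * dist (a 0) (a 1) := by positivity
      linarith
    · have := hhom 0 1 n
      rw [zero_add, add_comm 1 n] at this
      linarith
  obtain ⟨r, hr, hesc⟩ := h4.exists_linear_escape hg hK hE hL hstep hhom fun D => by
    obtain ⟨i, j, h⟩ := hunb D
    rcases le_total i j with hij | hij
    · exact ⟨i, j, hij, h⟩
    · exact ⟨j, i, hij, by rwa [dist_comm]⟩
  have hr1 : (1 : ℝ) ≤ r := by exact_mod_cast hr
  have hKr : 1 ≤ K * r := one_le_mul_of_one_le_of_one_le hK hr1
  refine ⟨K * r + L, 1 + E + L * r, by linarith, by positivity, fun m n => ?_⟩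
  wlog hmn : m ≤ n generalizing m n
  · have := this n m (by omega)
    rwa [abs_sub_comm, dist_comm]
  obtain ⟨t, rfl⟩ := Int.le.dest hmn
  have habs : |(m : ℝ) - ((m + t : ℤ) : ℝ)| = t := by
    push_cast
    rw [sub_add_cancel_left, abs_neg, Nat.abs_cast]
  rw [habs]
  have ht0 : (0 : ℝ) ≤ t := by positivity
  have hup := dist_add_natCast_le hstep m t
  refine ⟨?_, hup.trans ?_⟩
  · have h1 := hesc m (t / r)
    have h2 := dist_add_natCast_le hstep (m + (t / r : ℕ) * r) (t % r)
    have h3 : m + ((t / r : ℕ) : ℤ) * r + (t % r : ℕ) = m + t := by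
      have : ((t / r * r + t % r : ℕ) : ℤ) = t := by rw [Nat.div_add_mod']
      push_cast at this ⊢
      linarith
    rw [h3] at h2
    have h4 : ((t % r : ℕ) : ℝ) ≤ r := by exact_mod_cast (Nat.mod_lt t hr).le
    have h5 : (t : ℝ) = (t / r : ℕ) * r + (t % r : ℕ) := by
      exact_mod_cast (Nat.div_add_mod' t r).symm
    have h6 := dist_triangle_right (a m) (a (m + (t / r : ℕ) * r)) (a (m + t))
    have h7 : L * ((t % r : ℕ) : ℝ) ≤ L * r := mul_le_mul_of_nonneg_left h4 (by linarith)
    have h8 : ((t / r : ℕ) : ℝ) ≤ K * (dist (a m) (a (m + t)) + L * r) + E :=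
      h1.trans (by
        gcongr
        linarith)
    have h9 : (t : ℝ) / (K * r + L) ≤ t / (K * r) := by
      gcongr
      linarith
    have h10 : (t : ℝ) / (K * r) ≤ dist (a m) (a (m + t)) + L * r + E + 1 := by
      rw [div_le_iff₀ (by linarith), h5]
      have h11 : ((t / r : ℕ) : ℝ) * r ≤ (K * (dist (a m) (a (m + t)) + L * r) + E) * r := by
        gcongr
      have h12 : E * r ≤ E * (K * r) :=
        mul_le_mul_of_nonneg_left (le_mul_of_one_le_left (by positivity) hK) hE
      have h13 : (r : ℝ) ≤ K * r := le_mul_of_one_le_left (by positivity) hK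
      nlinarith
    linarith
  · have h1 : L * (t : ℝ) ≤ (K * r + L) * t := by
      gcongr
      linarith
    have h2 : 0 ≤ L * r := by positivity
    linarith

end FourPoint

/-- The metric space of vertices of a connected graph. -/
noncomputable abbrev SimpleGraph.Connected.metricSpace {V : Type*} {T : SimpleGraph V}
    (hT : T.Connected) : MetricSpace V where
  dist u v := T.dist u v
  dist_self u := by simp
  dist_comm u v := by rw [SimpleGraph.dist_comm]
  dist_triangle u v w := by exact_mod_cast hT.dist_triangle
  eq_of_dist_eq_zero h := hT.dist_eq_zero_iff.1 (by exact_mod_cast h)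


/-- in a quasi-action on a simplicial tree, each group element quasi-acts
either elliptically or hyperbolically. -/
theorem stmt_7 (G : Type) [Group G]
    (V : Type) (T : SimpleGraph V) (hT : T.IsTree)
    (K C : ℝ) (hK : 1 ≤ K) (hC : 0 ≤ C)
    (A : G → V → V)
    -- each A(g,−) is a (K,C)-quasi-isometry of the tree
    (hQI : ∀ g : G,
      (∀ u v : V, (T.dist u v : ℝ) / K - C ≤ (T.dist (A g u) (A g v) : ℝ) ∧
        (T.dist (A g u) (A g v) : ℝ) ≤ K * (T.dist u v : ℝ) + C) ∧
      ∀ v : V, ∃ u : V, (T.dist v (A g u) : ℝ) ≤ C)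
    -- quasi-action cocycle condition
    (hcoc : ∀ g h : G, ∀ u : V, (T.dist (A g (A h u)) (A (g * h) u) : ℝ) ≤ C)
    (g : G) (x : V) :
    -- g quasi-acts elliptically: the orbit of x under powers of g has finite diameter
    (∃ D : ℝ, ∀ m n : ℤ, (T.dist (A (g ^ m) x) (A (g ^ n) x) : ℝ) ≤ D) ∨
    -- or g quasi-acts hyperbolically: n ↦ A(gⁿ,x) is a quasi-isometric embedding of ℤ
    (∃ K' C' : ℝ, 1 ≤ K' ∧ 0 ≤ C' ∧
      ∀ m n : ℤ, |(m : ℝ) - (n : ℝ)| / K' - C' ≤ (T.dist (A (g ^ m) x) (A (g ^ n) x) : ℝ) ∧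
        (T.dist (A (g ^ m) x) (A (g ^ n) x) : ℝ) ≤ K' * |(m : ℝ) - (n : ℝ)| + C') := by
  let := hT.connected.metricSpace
  have hd (u v : V) : dist u v = (T.dist u v : ℝ) := rfl
  have h4 : FourPoint V := fun x y z w => by
    have := hT.dist_add_dist_le_max x y z w
    simp only [hd]
    exact_mod_cast this
  have hg : DiscretelyGeodesic V := fun u v => by
    obtain ⟨l, q, hl, h0, hl', hbet, hstep⟩ := hT.exists_geodesic u v
    refine ⟨l, q, hl, h0, hl', fun s => ?_, fun s => ?_⟩ <;> simp only [hd]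
    · exact_mod_cast hbet s
    · exact_mod_cast hstep s
  refine h4.bounded_or_quasiIsometricEmbedding hg (a := fun n : ℤ => A (g ^ n) x) (E := 3 * C)
    hK (by linarith) fun m n t => ?_
  have h1 : dist (A (g ^ t) (A (g ^ m) x)) (A (g ^ (m + t)) x) ≤ C := by
    rw [add_comm, zpow_add]
    exact hcoc _ _ _
  have h2 : dist (A (g ^ t) (A (g ^ n) x)) (A (g ^ (n + t)) x) ≤ C := by
    rw [add_comm, zpow_add]
    exact hcoc _ _ _
  have h3 : dist (A (g ^ t) (A (g ^ m) x)) (A (g ^ t) (A (g ^ n) x)) ≤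
      K * dist (A (g ^ m) x) (A (g ^ n) x) + C := ((hQI (g ^ t)).1 _ _).2
  have h5 := dist_triangle4 (A (g ^ (m + t)) x) (A (g ^ t) (A (g ^ m) x))
    (A (g ^ t) (A (g ^ n) x)) (A (g ^ (n + t)) x)
  rw [dist_comm (A (g ^ (m + t)) x) (A (g ^ t) (A (g ^ m) x))] at h5
  linarith
end

section
/- Let G be a finitely generated group with a (K,C)-quasi-action A on a simplicial tree T, and suppose there is a geodesic ray γ : ℕ → T (i.e. d(γ(m), γ(n)) = |m − n| for all m,n) whose end is fixed by G, in the sense that for every g ∈ G and every M there is N such that (A(g, γ(m)), γ(n))_{γ(0)} ≥ M for all m, n ≥ N. Then there exists a pseudocharacter χ : G → ℝ such that for every g ∈ G, χ(g) = 0 if and only if the set {A(gⁿ, γ(0)) : n ∈ ℤ} has finite diameter. -/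
/-- A pseudocharacter on a group: bounded defect and homogeneity on cyclic subgroups. -/
def IsPseudocharacter {G : Type} [Group G] (f : G → ℝ) : Prop :=
  (∃ D : ℝ, ∀ g h : G, |f (g * h) - f g - f h| ≤ D) ∧
  ∀ (g : G) (n : ℤ), f (g ^ n) = (n : ℝ) * f g

/-! ### Homogenization of quasimorphisms -/

/-- A map with bounded defect is at bounded distance from a pseudocharacter. -/
theorem exists_isPseudocharacter_of_bounded_defect {G : Type} [Group G] (q : G → ℝ) (D : ℝ)
    (hq : ∀ g h : G, |q (g * h) - q g - q h| ≤ D) :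
    ∃ χ : G → ℝ, IsPseudocharacter χ ∧ ∀ g, |χ g - q g| ≤ D := by
  have hstep : ∀ g : G, ∀ n : ℕ,
      dist (q (g ^ 2 ^ n) / 2 ^ n) (q (g ^ 2 ^ (n + 1)) / 2 ^ (n + 1)) ≤ D / 2 / 2 ^ n := by
    intro g n
    have h := hq (g ^ 2 ^ n) (g ^ 2 ^ n)
    rw [← pow_add, ← two_mul, ← pow_succ'] at h
    have hpos : (0 : ℝ) < 2 ^ n := by positivity
    have hEq : q (g ^ 2 ^ n) / 2 ^ n - q (g ^ 2 ^ (n + 1)) / 2 ^ (n + 1)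
        = -(q (g ^ 2 ^ (n + 1)) - q (g ^ 2 ^ n) - q (g ^ 2 ^ n)) / (2 * 2 ^ n) := by
      field_simp
      ring
    rw [Real.dist_eq, hEq, abs_div, abs_neg, abs_of_pos (by positivity : (0 : ℝ) < 2 * 2 ^ n),
      div_div]
    gcongr
  have hlim : ∀ g : G, ∃ a : ℝ,
      Filter.Tendsto (fun n : ℕ => q (g ^ 2 ^ n) / 2 ^ n) Filter.atTop (nhds a) := fun g =>
    cauchySeq_tendsto_of_complete (cauchySeq_of_le_geometric_two (hstep g))
  choose χ hχ using hlim
  have hclose : ∀ g, |χ g - q g| ≤ D := by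
    intro g
    have h := dist_le_of_le_geometric_two_of_tendsto₀ (hstep g) (hχ g)
    rw [Real.dist_eq, abs_sub_comm] at h
    simpa using h
  have hpow : ∀ k : ℤ, ∃ B : ℝ, ∀ x : G, |q (x ^ k) - k * q x| ≤ B := by
    intro k
    induction k using Int.induction_on with
    | zero => exact ⟨|q 1|, fun x => by simp⟩
    | succ i ih =>
      obtain ⟨B, hB⟩ := ih
      refine ⟨B + D, fun x => ?_⟩
      have h1 := hB x
      have h2 := hq (x ^ (i : ℤ)) x
      rw [← zpow_add_one] at h2
      push_cast at h1 ⊢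
      rw [abs_le] at *
      constructor <;> linarith [h1.1, h1.2, h2.1, h2.2]
    | pred i ih =>
      obtain ⟨B, hB⟩ := ih
      refine ⟨B + D, fun x => ?_⟩
      have h1 := hB x
      have h2 := hq (x ^ (-(i : ℤ) - 1)) x
      rw [← zpow_add_one, sub_add_cancel] at h2
      push_cast at h1 ⊢
      rw [abs_le] at *
      constructor <;> linarith [h1.1, h1.2, h2.1, h2.2]
  refine ⟨χ, ⟨⟨4 * D, fun g h => ?_⟩, fun g k => ?_⟩, hclose⟩
  · have h1 := hclose (g * h)
    have h2 := hclose g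
    have h3 := hclose h
    have h4 := hq g h
    rw [abs_le] at *
    constructor <;> linarith [h1.1, h1.2, h2.1, h2.2, h3.1, h3.2, h4.1, h4.2]
  · obtain ⟨B, hB⟩ := hpow k
    have h1 : Filter.Tendsto
        (fun n : ℕ => q ((g ^ k) ^ 2 ^ n) / 2 ^ n - k * (q (g ^ 2 ^ n) / 2 ^ n))
        Filter.atTop (nhds (χ (g ^ k) - k * χ g)) := (hχ (g ^ k)).sub ((hχ g).const_mul _)
    have h2 : Filter.Tendsto (fun n : ℕ => B * (1 / 2 : ℝ) ^ n) Filter.atTop (nhds (B * 0)) :=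
      (tendsto_pow_atTop_nhds_zero_of_lt_one (by norm_num) (by norm_num)).const_mul B
    rw [mul_zero] at h2
    have h3 : ∀ n : ℕ, ‖q ((g ^ k) ^ 2 ^ n) / 2 ^ n - k * (q (g ^ 2 ^ n) / 2 ^ n)‖
        ≤ B * (1 / 2 : ℝ) ^ n := by
      intro n
      have h4 := hB (g ^ 2 ^ n)
      have hEq : q ((g ^ k) ^ 2 ^ n) / 2 ^ n - k * (q (g ^ 2 ^ n) / 2 ^ n)
          = (q ((g ^ 2 ^ n) ^ k) - k * q (g ^ 2 ^ n)) * (1 / 2 : ℝ) ^ n := by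
        rw [← zpow_natCast (g ^ k), zpow_comm, zpow_natCast, one_div, inv_pow]
        ring
      rw [hEq, Real.norm_eq_abs, abs_mul, abs_of_pos (by positivity : (0 : ℝ) < (1 / 2) ^ n)]
      gcongr
    exact sub_eq_zero.mp (tendsto_nhds_unique h1 (squeeze_zero_norm h3 h2))

/-! ### Betweenness in trees -/

/-- The vertex `y` lies on a geodesic from `x` to `z`. -/
def SimpleGraph.IsBetween {V : Type*} (T : SimpleGraph V) (x y z : V) : Prop :=
  T.dist x y + T.dist y z = T.dist x z

namespace SimpleGraph

/-- A geodesic in a tree is covered by any two geodesics with which it forms a triangle. -/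
theorem IsTree.isBetween_or_isBetween {V : Type*} {T : SimpleGraph V} (hT : T.IsTree)
    {x y z : V} (h : T.IsBetween x y z) (w : V) : T.IsBetween x y w ∨ T.IsBetween w y z := by
  classical
  unfold IsBetween at *
  obtain ⟨p, hp⟩ := hT.connected.exists_walk_length_eq_dist x y
  obtain ⟨q, hq⟩ := hT.connected.exists_walk_length_eq_dist y z
  obtain ⟨r, hr⟩ := hT.connected.exists_walk_length_eq_dist x w
  obtain ⟨s, hs⟩ := hT.connected.exists_walk_length_eq_dist w z
  have hpq : (p.append q).IsPath :=
    (p.append q).isPath_of_length_eq_dist (by rw [Walk.length_append, hp, hq, h])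
  have heq : p.append q = (r.append s).bypass :=
    (hT.existsUnique_path x z).unique hpq (Walk.bypass_isPath _)
  have hy : y ∈ (r.append s).support := by
    refine Walk.support_bypass_subset_support _ (heq ▸ ?_)
    simp
  have key : ∀ {a b : V} (t : T.Walk a b), t.length = T.dist a b → y ∈ t.support →
      T.dist a y + T.dist y b = T.dist a b := by
    intro a b t ht hyt
    refine le_antisymm ?_ hT.connected.dist_triangle
    rw [← ht, ← t.take_spec hyt, Walk.length_append]
    exact add_le_add (dist_le _) (dist_le _)
  rw [Walk.mem_support_append_iff] at hy
  exact hy.imp (key r hr) (key s hs)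

/-- Any three vertices of a tree have a median. -/
theorem IsTree.exists_median {V : Type*} {T : SimpleGraph V} (hT : T.IsTree) (x y z : V) :
    ∃ w, T.IsBetween x w y ∧ T.IsBetween x w z ∧ T.IsBetween y w z := by
  classical
  obtain ⟨p, hp⟩ := hT.connected.exists_walk_length_eq_dist x y
  have hx : ∀ i ≤ p.length, T.dist x (p.getVert i) = i ∧
      T.dist (p.getVert i) y = p.length - i := by
    intro i hi
    have h1 := dist_le (p.take i)
    have h2 := dist_le (p.drop i)
    rw [Walk.take_length] at h1
    rw [Walk.drop_length] at h2
    have h3 := hT.connected.dist_triangle (u := x) (v := p.getVert i) (w := y)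
    omega
  have hbt : ∀ i ≤ p.length, T.IsBetween x (p.getVert i) y := by
    intro i hi
    have := hx i hi
    unfold IsBetween
    omega
  set t := Nat.findGreatest (fun i => T.IsBetween x (p.getVert i) z) p.length with ht
  have htl : t ≤ p.length := Nat.findGreatest_le _
  have htz : T.IsBetween x (p.getVert t) z :=
    Nat.findGreatest_spec (P := fun i => T.IsBetween x (p.getVert i) z) (Nat.zero_le _)
      (by simp [IsBetween])
  refine ⟨p.getVert t, hbt t htl, htz, ?_⟩
  rcases htl.eq_or_lt with h | h
  · rw [h, Walk.getVert_length]
    simp [IsBetween]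
  · have h1 : ¬ T.IsBetween x (p.getVert (t + 1)) z :=
      Nat.findGreatest_is_greatest (P := fun i => T.IsBetween x (p.getVert i) z)
        (Nat.lt_succ_self _) h
    have h2 := (hT.isBetween_or_isBetween (hbt (t + 1) h) z).resolve_left h1
    have hadj := p.adj_getVert_succ h
    have h3 := hT.dist_ne_of_adj z hadj
    have h4 := hx t htl
    have h5 := hx (t + 1) h
    have h6 := hT.connected.dist_triangle (u := x) (v := p.getVert (t + 1)) (w := z)
    have h7 := hT.connected.dist_triangle (u := z) (v := p.getVert t) (w := p.getVert (t + 1))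
    have h8 := hT.connected.dist_triangle (u := z) (v := p.getVert (t + 1)) (w := p.getVert t)
    have h9 := dist_eq_one_iff_adj.mpr hadj
    have h10 := dist_eq_one_iff_adj.mpr hadj.symm
    unfold IsBetween at *
    simp only [T.dist_comm (u := z), T.dist_comm (u := y) (v := p.getVert t)] at *
    omega

/-- A coarse path in a tree passes close to every vertex between its endpoints. -/
theorem IsTree.exists_dist_le_of_isBetween {V : Type*} {T : SimpleGraph V} (hT : T.IsTree)
    {R : ℕ} {y : V} (n : ℕ) (u : ℕ → V) (hu : ∀ i < n, T.dist (u i) (u (i + 1)) ≤ R)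
    (hy : T.IsBetween (u 0) y (u n)) : ∃ i ≤ n, T.dist (u i) y ≤ R := by
  induction n with
  | zero =>
    refine ⟨0, le_rfl, ?_⟩
    have : T.dist (u 0) y + T.dist y (u 0) = T.dist (u 0) (u 0) := hy
    rw [dist_self] at this
    omega
  | succ n ih =>
    rcases hT.isBetween_or_isBetween hy (u n) with h | h
    · obtain ⟨i, hi, h⟩ := ih (fun i hi => hu i (by omega)) h
      exact ⟨i, by omega, h⟩
    · refine ⟨n, by omega, ?_⟩
      have h1 := hu n (by omega)
      have : T.dist (u n) y + T.dist y (u (n + 1)) = T.dist (u n) (u (n + 1)) := h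
      omega

/-- Geodesics from `x` to points `v n` converging to the end of a ray `γ` eventually share
vertices of `γ`. -/
theorem IsTree.eventually_isBetween {V : Type*} {T : SimpleGraph V} (hT : T.IsTree)
    {γ v : ℕ → V} (hray : ∀ i j, T.dist (γ i) (γ (i + j)) = j)
    (hv : ∀ M : ℕ, ∃ N : ℕ, ∀ m n : ℕ, N ≤ m → N ≤ n →
      2 * M + T.dist (v m) (γ n) ≤ T.dist (v m) (γ 0) + T.dist (γ n) (γ 0))
    (x : V) {s : ℕ} (hs : T.dist x (γ 0) < s) :
    ∀ᶠ n in Filter.atTop, T.IsBetween x (γ s) (v n) := by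
  obtain ⟨N, hN⟩ := hv (s + 1)
  filter_upwards [Filter.eventually_ge_atTop N] with n hn
  obtain ⟨m, hm⟩ : ∃ m, N ≤ s + m := ⟨N, by omega⟩
  have h0 := hray 0 s
  have h1 := hray 0 (s + m)
  have h2 := hray s m
  rw [zero_add] at h0 h1
  have hB : T.IsBetween (γ 0) (γ s) (γ (s + m)) := by
    unfold IsBetween
    omega
  have h3 := hN n (s + m) hn hm
  have hx : T.IsBetween x (γ s) (γ (s + m)) := by
    refine (hT.isBetween_or_isBetween hB x).resolve_left fun h => ?_
    unfold IsBetween at h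
    rw [T.dist_comm (u := γ 0) (v := x)] at h
    omega
  refine (hT.isBetween_or_isBetween hx (v n)).resolve_right fun h => ?_
  have h4 := hT.connected.dist_triangle (u := v n) (v := γ s) (w := γ 0)
  unfold IsBetween at h
  rw [T.dist_comm (u := γ s) (v := γ 0)] at h4
  rw [T.dist_comm (u := γ (s + m)) (v := γ 0)] at h3
  omega

end SimpleGraph

/-! ### An isometric action modelling a quasi-action -/

section QuasiAction

variable {G V : Type} [Group G]

/-- The graph on `G × V`, thinking of `(g, x)` as the point `A g x`, in which two vertices are
adjacent when all their translates are `L`-close. The group `G` acts on it by isometries. -/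
def translateGraph (T : SimpleGraph V) (A : G → V → V) (L : ℕ) : SimpleGraph (G × V) where
  Adj P Q := P ≠ Q ∧ ∀ k : G, T.dist (A (k * P.1) P.2) (A (k * Q.1) Q.2) ≤ L
  symm := ⟨fun _ _ h => ⟨h.1.symm, fun k => by rw [T.dist_comm]; exact h.2 k⟩⟩
  loopless := ⟨fun _ h => h.1 rfl⟩

/-- The data of a quasi-action on a tree, with a single integral constant. -/
structure IsTreeQuasiAction (T : SimpleGraph V) (A : G → V → V) (L : ℕ) : Prop where
  isTree : T.IsTree
  dist_le_of_adj : ∀ g u v, T.Adj u v → T.dist (A g u) (A g v) ≤ L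
  dist_comp_le : ∀ g h u, T.dist (A g (A h u)) (A (g * h) u) ≤ L

namespace IsTreeQuasiAction

variable {T : SimpleGraph V} {A : G → V → V} {L : ℕ}

local notation "Γ" => translateGraph T A L

theorem exists_walk_of_forall_dist_le {P Q : G × V}
    (h : ∀ k : G, T.dist (A (k * P.1) P.2) (A (k * Q.1) Q.2) ≤ L) :
    ∃ p : (Γ).Walk P Q, p.length ≤ 1 := by
  by_cases hPQ : P = Q
  · subst hPQ
    exact ⟨.nil, by simp⟩
  · exact ⟨.cons (show (Γ).Adj P Q from ⟨hPQ, h⟩) .nil, by simp⟩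

theorem exists_walk_one (hA : IsTreeQuasiAction T A L) {u v : V} (p : T.Walk u v) :
    ∃ q : (Γ).Walk (1, u) (1, v), q.length ≤ p.length := by
  induction p with
  | nil => exact ⟨.nil, by simp⟩
  | cons hadj p ih =>
    obtain ⟨q, hq⟩ := ih
    obtain ⟨r, hr⟩ := exists_walk_of_forall_dist_le (T := T) (A := A) (L := L)
      (P := (1, _)) (Q := (1, _)) (fun k => hA.dist_le_of_adj (k * 1) _ _ hadj)
    refine ⟨r.append q, ?_⟩
    rw [SimpleGraph.Walk.length_append, SimpleGraph.Walk.length_cons]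
    omega

theorem exists_walk_to_one (hA : IsTreeQuasiAction T A L) (P : G × V) (v : V) :
    ∃ q : (Γ).Walk P (1, v), q.length ≤ T.dist (A P.1 P.2) v + 1 := by
  obtain ⟨p, hp⟩ := hA.isTree.connected.exists_walk_length_eq_dist (A P.1 P.2) v
  obtain ⟨q, hq⟩ := hA.exists_walk_one p
  obtain ⟨r, hr⟩ := exists_walk_of_forall_dist_le (T := T) (A := A) (L := L)
    (P := P) (Q := (1, A P.1 P.2)) (fun k => by
      rw [mul_one, T.dist_comm]
      exact hA.dist_comp_le k P.1 P.2)
  refine ⟨r.append q, ?_⟩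
  rw [SimpleGraph.Walk.length_append]
  omega

theorem dist_one_le (hA : IsTreeQuasiAction T A L) (P : G × V) (v : V) :
    (Γ).dist P (1, v) ≤ T.dist (A P.1 P.2) v + 1 :=
  let ⟨q, hq⟩ := hA.exists_walk_to_one P v
  (SimpleGraph.dist_le q).trans hq

theorem connected (hA : IsTreeQuasiAction T A L) : (Γ).Connected := by
  have : Nonempty V := hA.isTree.connected.nonempty
  inhabit V
  rw [SimpleGraph.connected_iff_exists_forall_reachable]
  exact ⟨(1, default), fun P => (hA.exists_walk_to_one P default).choose.reachable.symm⟩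

theorem dist_tree_le_of_adj {P Q : G × V} (h : (Γ).Adj P Q) :
    T.dist (A P.1 P.2) (A Q.1 Q.2) ≤ L := by
  simpa using h.2 1

theorem dist_tree_le (hA : IsTreeQuasiAction T A L) (P Q : G × V) :
    T.dist (A P.1 P.2) (A Q.1 Q.2) ≤ L * (Γ).dist P Q := by
  obtain ⟨p, hp⟩ := hA.connected.exists_walk_length_eq_dist P Q
  rw [← hp]
  clear hp
  induction p with
  | nil => simp
  | cons hadj p ih =>
    have h1 := dist_tree_le_of_adj hadj
    rw [SimpleGraph.Walk.length_cons, mul_add, mul_one]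
    exact (hA.isTree.connected.dist_triangle.trans (add_le_add h1 ih)).trans_eq (add_comm _ _)

theorem exists_walk_translate (g : G) {P Q : G × V} (p : (Γ).Walk P Q) :
    ∃ q : (Γ).Walk (g * P.1, P.2) (g * Q.1, Q.2), q.length ≤ p.length := by
  induction p with
  | nil => exact ⟨.nil, by simp⟩
  | cons hadj p ih =>
    obtain ⟨q, hq⟩ := ih
    obtain ⟨r, hr⟩ := exists_walk_of_forall_dist_le (T := T) (A := A) (L := L)
      (P := (g * _, _)) (Q := (g * _, _))
      (fun k => by simpa only [mul_assoc] using hadj.2 (k * g))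
    refine ⟨r.append q, ?_⟩
    rw [SimpleGraph.Walk.length_append, SimpleGraph.Walk.length_cons]
    omega

theorem dist_translate (hA : IsTreeQuasiAction T A L) (g : G) (P Q : G × V) :
    (Γ).dist (g * P.1, P.2) (g * Q.1, Q.2) = (Γ).dist P Q := by
  have key : ∀ (g : G) (P Q : G × V),
      (Γ).dist (g * P.1, P.2) (g * Q.1, Q.2) ≤ (Γ).dist P Q := by
    intro g P Q
    obtain ⟨p, hp⟩ := hA.connected.exists_walk_length_eq_dist P Q
    obtain ⟨q, hq⟩ := exists_walk_translate g p
    exact hp ▸ (SimpleGraph.dist_le q).trans hq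
  refine le_antisymm (key g P Q) ?_
  simpa using key g⁻¹ (g * P.1, P.2) (g * Q.1, Q.2)

/-- Distances in the translate graph are coarsely additive along geodesics of the tree. -/
theorem dist_add_dist_le (hA : IsTreeQuasiAction T A L) {P Q : G × V} {y : V}
    (h : T.IsBetween (A P.1 P.2) y (A Q.1 Q.2)) :
    (Γ).dist P (1, y) + (Γ).dist Q (1, y) ≤ (Γ).dist P Q + 2 * (L + 1) := by
  obtain ⟨p, hp⟩ := hA.connected.exists_walk_length_eq_dist P Q
  obtain ⟨i, hi, hiy⟩ := hA.isTree.exists_dist_le_of_isBetween p.length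
    (fun i => A (p.getVert i).1 (p.getVert i).2)
    (fun i hi => dist_tree_le_of_adj (p.adj_getVert_succ hi)) (by simpa using h)
  have h1 := SimpleGraph.dist_le (p.take i)
  have h2 := SimpleGraph.dist_le (p.drop i)
  rw [SimpleGraph.Walk.take_length] at h1
  rw [SimpleGraph.Walk.drop_length] at h2
  have h3 := hA.dist_one_le (p.getVert i) y
  have h4 := hA.connected.dist_triangle (u := P) (v := p.getVert i) (w := (1, y))
  have h5 := hA.connected.dist_triangle (u := Q) (v := p.getVert i) (w := (1, y))
  rw [(Γ).dist_comm (u := Q) (v := p.getVert i)] at h5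
  omega

/-- The Busemann cocycle of a fixed end, together with its coarse invariance. -/
theorem exists_busemann (hA : IsTreeQuasiAction T A L) {γ : ℕ → V}
    (hray : ∀ i j, T.dist (γ i) (γ (i + j)) = j)
    (hfix : ∀ (g : G) (M : ℕ), ∃ N : ℕ, ∀ m n : ℕ, N ≤ m → N ≤ n →
      2 * M + T.dist (A g (γ m)) (γ n) ≤ T.dist (A g (γ m)) (γ 0) + T.dist (γ n) (γ 0))
    (P Q : G × V) :
    ∃ b : ℝ, |b| ≤ (Γ).dist P Q ∧ ∀ g : G, ∀ᶠ n in Filter.atTop,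
      |((Γ).dist (g * P.1, P.2) (1, γ n) : ℝ) - (Γ).dist (g * Q.1, Q.2) (1, γ n) - b|
        ≤ 2 * (L + 1) := by
  set s := T.dist (A P.1 P.2) (γ 0) + T.dist (A Q.1 Q.2) (γ 0) + 1 with hs
  refine ⟨(Γ).dist P (1, γ s) - (Γ).dist Q (1, γ s), ?_, fun g => ?_⟩
  · have h1 : ((Γ).dist P (1, γ s) : ℝ) ≤ (Γ).dist P Q + (Γ).dist Q (1, γ s) := by
      exact_mod_cast hA.connected.dist_triangle
    have h2 : ((Γ).dist Q (1, γ s) : ℝ) ≤ (Γ).dist Q P + (Γ).dist P (1, γ s) := by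
      exact_mod_cast hA.connected.dist_triangle
    rw [(Γ).dist_comm (u := Q) (v := P)] at h2
    rw [abs_le]
    constructor <;> linarith
  · filter_upwards [hA.isTree.eventually_isBetween hray (hfix g⁻¹) (A P.1 P.2) (s := s) (by omega),
      hA.isTree.eventually_isBetween hray (hfix g⁻¹) (A Q.1 Q.2) (s := s) (by omega)] with n hP hQ
    have key : ∀ R : G × V, (Γ).dist (g * R.1, R.2) (1, γ n) = (Γ).dist R (g⁻¹, γ n) := by
      intro R
      simpa using hA.dist_translate g R (g⁻¹, γ n)
    rw [key, key]
    have h1 : ((Γ).dist P (1, γ s) + (Γ).dist (g⁻¹, γ n) (1, γ s) : ℝ)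
        ≤ (Γ).dist P (g⁻¹, γ n) + 2 * (L + 1) := by
      exact_mod_cast hA.dist_add_dist_le (Q := (g⁻¹, γ n)) hP
    have h2 : ((Γ).dist Q (1, γ s) + (Γ).dist (g⁻¹, γ n) (1, γ s) : ℝ)
        ≤ (Γ).dist Q (g⁻¹, γ n) + 2 * (L + 1) := by
      exact_mod_cast hA.dist_add_dist_le (Q := (g⁻¹, γ n)) hQ
    have h3 : ((Γ).dist P (g⁻¹, γ n) : ℝ)
        ≤ (Γ).dist P (1, γ s) + (Γ).dist (1, γ s) (g⁻¹, γ n) := by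
      exact_mod_cast hA.connected.dist_triangle
    have h4 : ((Γ).dist Q (g⁻¹, γ n) : ℝ)
        ≤ (Γ).dist Q (1, γ s) + (Γ).dist (1, γ s) (g⁻¹, γ n) := by
      exact_mod_cast hA.connected.dist_triangle
    rw [(Γ).dist_comm (u := (1, γ s))] at h3 h4
    rw [abs_le]
    constructor <;> linarith

/-- The displacement of a base point measured by the Busemann cocycle of a fixed end is a
quasimorphism, and it detects the cyclic subgroups with bounded orbits. -/
theorem exists_quasimorphism (hA : IsTreeQuasiAction T A L) {γ : ℕ → V}
    (hray : ∀ i j, T.dist (γ i) (γ (i + j)) = j)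
    (hfix : ∀ (g : G) (M : ℕ), ∃ N : ℕ, ∀ m n : ℕ, N ≤ m → N ≤ n →
      2 * M + T.dist (A g (γ m)) (γ n) ≤ T.dist (A g (γ m)) (γ 0) + T.dist (γ n) (γ 0)) :
    ∃ (q : G → ℝ) (D : ℝ), (∀ g h, |q (g * h) - q g - q h| ≤ D) ∧
      (∀ g, |q g| ≤ (Γ).dist (g, γ 0) (1, γ 0)) ∧
      ∀ (g : G) (B : ℝ), (∀ n : ℕ, |q (g ^ n)| ≤ B) →
        ∃ B' : ℝ, ∀ n : ℕ, ((Γ).dist (g ^ n, γ 0) (1, γ 0) : ℝ) ≤ B' := by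
  choose b hb hbinv using hA.exists_busemann hray hfix
  have hO : ∀ g h : G, ∀ᶠ n in Filter.atTop, |((Γ).dist (g * h, γ 0) (1, γ n) : ℝ)
      - (Γ).dist (g, γ 0) (1, γ n) - b (h, γ 0) (1, γ 0)| ≤ 2 * (L + 1) := by
    intro g h
    simpa using hbinv (h, γ 0) (1, γ 0) g
  refine ⟨fun g => b (g, γ 0) (1, γ 0), 3 * (2 * (L + 1)), fun g h => ?_,
    fun g => hb _ _, fun g B hB => ?_⟩
  · have e1 := hO 1 (g * h)
    have e2 := hO 1 g
    have e3 := hO g h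
    rw [one_mul] at e1 e2
    obtain ⟨n, h1, h2, h3⟩ := (e1.and (e2.and e3)).exists
    rw [abs_le] at *
    constructor <;> linarith [h1.1, h1.2, h2.1, h2.2, h3.1, h3.2]
  · set r := (Γ).dist (g, γ 0) (1, γ 0) with hr
    have hstep : ∀ i : ℕ, T.dist (A (g ^ i) (γ 0)) (A (g ^ (i + 1)) (γ 0)) ≤ L * r := by
      intro i
      have h1 := hA.dist_tree_le (g ^ i, γ 0) (g ^ (i + 1), γ 0)
      have h2 := hA.dist_translate (g ^ i) (1, γ 0) (g, γ 0)
      simp only [mul_one, ← pow_succ] at h2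
      rwa [h2, (Γ).dist_comm] at h1
    refine ⟨2 * (2 * (L + 1) + (L * r + 1) + 2 * (2 * (L + 1) + B)), fun k => ?_⟩
    have hfin : ∀ᶠ n in Filter.atTop, ∀ i ∈ Finset.range (k + 1),
        |((Γ).dist (g ^ i, γ 0) (1, γ n) : ℝ) - (Γ).dist (1, γ 0) (1, γ n)
          - b (g ^ i, γ 0) (1, γ 0)| ≤ 2 * (L + 1) := by
      rw [Filter.eventually_all_finset]
      intro i _
      simpa using hO 1 (g ^ i)
    obtain ⟨n, hn⟩ := hfin.exists
    have hn' : ∀ i ≤ k, |((Γ).dist (g ^ i, γ 0) (1, γ n) : ℝ) - (Γ).dist (1, γ 0) (1, γ n)|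
        ≤ 2 * (L + 1) + B := by
      intro i hi
      have h1 := hn i (Finset.mem_range.mpr (by omega))
      have h2 := hB i
      rw [abs_le] at *
      constructor <;> linarith [h1.1, h1.2, h2.1, h2.2]
    obtain ⟨w, hw1, hw2, hw3⟩ :=
      hA.isTree.exists_median (A 1 (γ 0)) (A (g ^ k) (γ 0)) (A 1 (γ n))
    obtain ⟨i, hi, hiw⟩ := hA.isTree.exists_dist_le_of_isBetween k
      (fun i => A (g ^ i) (γ 0)) (fun i _ => hstep i) (by simpa using hw1)
    have hclose : ((Γ).dist (g ^ i, γ 0) (1, w) : ℝ) ≤ L * r + 1 := by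
      exact_mod_cast (hA.dist_one_le (g ^ i, γ 0) w).trans (Nat.add_le_add_right hiw 1)
    have htri : ((Γ).dist (g ^ i, γ 0) (1, γ n) : ℝ)
        ≤ (Γ).dist (g ^ i, γ 0) (1, w) + (Γ).dist (1, w) (1, γ n) := by
      exact_mod_cast hA.connected.dist_triangle
    rw [(Γ).dist_comm (u := (1, w))] at htri
    have hbound : ∀ j ≤ k, T.IsBetween (A (g ^ j) (γ 0)) w (A 1 (γ n)) →
        ((Γ).dist (g ^ j, γ 0) (1, w) : ℝ)
          ≤ 2 * (L + 1) + (L * r + 1) + 2 * (2 * (L + 1) + B) := by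
      intro j hj hbt
      have h1 : ((Γ).dist (g ^ j, γ 0) (1, w) + (Γ).dist (1, γ n) (1, w) : ℝ)
          ≤ (Γ).dist (g ^ j, γ 0) (1, γ n) + 2 * (L + 1) := by
        exact_mod_cast hA.dist_add_dist_le (P := (g ^ j, γ 0)) (Q := (1, γ n)) hbt
      have h2 := abs_le.mp (hn' i hi)
      have h3 := abs_le.mp (hn' j hj)
      linarith [h2.1, h2.2, h3.1, h3.2]
    have h1 := hbound 0 (by omega) (by simpa using hw2)
    have h2 := hbound k le_rfl hw3
    have h3 : ((Γ).dist (g ^ k, γ 0) (1, γ 0) : ℝ)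
        ≤ (Γ).dist (g ^ k, γ 0) (1, w) + (Γ).dist (1, w) (1, γ 0) := by
      exact_mod_cast hA.connected.dist_triangle
    rw [(Γ).dist_comm (u := (1, w))] at h3
    rw [pow_zero] at h1
    linarith

end IsTreeQuasiAction

end QuasiAction

/-- a quasi-action of a finitely generated group on a simplicial tree fixing
an end of the tree gives rise to a pseudocharacter vanishing exactly on the elements which
quasi-act elliptically. -/
theorem stmt_9 (G : Type) [Group G] (hFG : Group.FG G)
    (V : Type) (T : SimpleGraph V) (hT : T.IsTree)
    (K C : ℝ) (hK : 1 ≤ K) (hC : 0 ≤ C)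
    (A : G → V → V)
    -- each A(g,−) is a (K,C)-quasi-isometry of the tree
    (hQI : ∀ g : G,
      (∀ u v : V, (T.dist u v : ℝ) / K - C ≤ (T.dist (A g u) (A g v) : ℝ) ∧
        (T.dist (A g u) (A g v) : ℝ) ≤ K * (T.dist u v : ℝ) + C) ∧
      ∀ v : V, ∃ u : V, (T.dist v (A g u) : ℝ) ≤ C)
    -- quasi-action cocycle condition
    (hcoc : ∀ g h : G, ∀ u : V, (T.dist (A g (A h u)) (A (g * h) u) : ℝ) ≤ C)
    -- γ is a geodesic ray in the tree
    (γ : ℕ → V)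
    (hray : ∀ m n : ℕ, (T.dist (γ m) (γ n) : ℝ) = |(m : ℝ) - (n : ℝ)|)
    -- the end of γ is fixed by G: for every g the Gromov products
    -- (A(g,γ(m)), γ(n))_{γ(0)} tend to infinity
    (hfix : ∀ g : G, ∀ M : ℝ, ∃ N : ℕ, ∀ m n : ℕ, N ≤ m → N ≤ n →
      M ≤ ((T.dist (A g (γ m)) (γ 0) : ℝ) + (T.dist (γ n) (γ 0) : ℝ)
            - (T.dist (A g (γ m)) (γ n) : ℝ)) / 2) :
    ∃ χ : G → ℝ, IsPseudocharacter χ ∧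
      ∀ g : G, (χ g = 0 ↔
        ∃ D : ℝ, ∀ m n : ℤ, (T.dist (A (g ^ m) (γ 0)) (A (g ^ n) (γ 0)) : ℝ) ≤ D) := by
  obtain ⟨L, hL⟩ := exists_nat_ge (K + C)
  have hA : IsTreeQuasiAction T A L := by
    refine ⟨hT, fun g u v huv => ?_, fun g h u => ?_⟩
    · have h1 := ((hQI g).1 u v).2
      rw [SimpleGraph.dist_eq_one_iff_adj.mpr huv, Nat.cast_one, mul_one] at h1
      exact_mod_cast h1.trans hL
    · have h1 := (hcoc g h u).trans (by linarith : C ≤ L)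
      exact_mod_cast h1
  have hray' : ∀ i j, T.dist (γ i) (γ (i + j)) = j := by
    intro i j
    have h := hray i (i + j)
    rw [Nat.cast_add, sub_add_cancel_left, abs_neg, Nat.abs_cast] at h
    exact_mod_cast h
  have hfix' : ∀ (g : G) (M : ℕ), ∃ N : ℕ, ∀ m n : ℕ, N ≤ m → N ≤ n →
      2 * M + T.dist (A g (γ m)) (γ n) ≤ T.dist (A g (γ m)) (γ 0) + T.dist (γ n) (γ 0) := by
    intro g M
    obtain ⟨N, hN⟩ := hfix g M
    refine ⟨N, fun m n hm hn => ?_⟩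
    have h := hN m n hm hn
    have h' : (2 * M + T.dist (A g (γ m)) (γ n) : ℝ)
        ≤ T.dist (A g (γ m)) (γ 0) + T.dist (γ n) (γ 0) := by linarith
    exact_mod_cast h'
  obtain ⟨q, D, hqD, hqle, hqbdd⟩ := hA.exists_quasimorphism hray' hfix'
  obtain ⟨χ, hχ, hχq⟩ := exists_isPseudocharacter_of_bounded_defect q D hqD
  refine ⟨χ, hχ, fun g => ⟨fun hg => ?_, fun ⟨B, hB⟩ => ?_⟩⟩
  · obtain ⟨B, hB⟩ := hqbdd g D fun n => by
      have h1 := hχ.2 g n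
      have h2 := hχq (g ^ n)
      rw [hg, mul_zero, zpow_natCast] at h1
      rwa [h1, zero_sub, abs_neg] at h2
    have hZ : ∀ n : ℤ, ((translateGraph T A L).dist (g ^ n, γ 0) (1, γ 0) : ℝ) ≤ B := by
      intro n
      obtain ⟨k, rfl | rfl⟩ := n.eq_nat_or_neg
      · simpa using hB k
      · have h := hA.dist_translate (g ^ k) (g ^ (-(k : ℤ)), γ 0) (1, γ 0)
        simp only [zpow_neg, zpow_natCast, mul_inv_cancel, mul_one] at h ⊢
        rw [← h, SimpleGraph.dist_comm]
        exact hB k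
    refine ⟨L * (B + B), fun m n => ?_⟩
    have h1 : (T.dist (A (g ^ m) (γ 0)) (A (g ^ n) (γ 0)) : ℝ)
        ≤ L * (translateGraph T A L).dist (g ^ m, γ 0) (g ^ n, γ 0) := by
      exact_mod_cast hA.dist_tree_le (g ^ m, γ 0) (g ^ n, γ 0)
    have h2 : ((translateGraph T A L).dist (g ^ m, γ 0) (g ^ n, γ 0) : ℝ)
        ≤ (translateGraph T A L).dist (g ^ m, γ 0) (1, γ 0)
          + (translateGraph T A L).dist (1, γ 0) (g ^ n, γ 0) := by
      exact_mod_cast hA.connected.dist_triangle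
    rw [SimpleGraph.dist_comm (u := (1, γ 0))] at h2
    refine h1.trans ?_
    gcongr
    linarith [hZ m, hZ n]
  · have hbd : ∀ n : ℕ, n * |χ g| ≤ D + (B + T.dist (A 1 (γ 0)) (γ 0) + 1) := by
      intro n
      have h1 := hχ.2 g n
      have h2 := hχq (g ^ n)
      have h3 := hqle (g ^ n)
      have h4 : ((translateGraph T A L).dist (g ^ n, γ 0) (1, γ 0) : ℝ)
          ≤ T.dist (A (g ^ n) (γ 0)) (γ 0) + 1 := by
        exact_mod_cast hA.dist_one_le (g ^ n, γ 0) (γ 0)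
      have h5 : (T.dist (A (g ^ n) (γ 0)) (γ 0) : ℝ)
          ≤ T.dist (A (g ^ n) (γ 0)) (A 1 (γ 0)) + T.dist (A 1 (γ 0)) (γ 0) := by
        exact_mod_cast hT.connected.dist_triangle
      have h6 := hB n 0
      rw [zpow_natCast, zpow_zero] at h6
      rw [zpow_natCast, Int.cast_natCast] at h1
      have h7 : (n : ℝ) * |χ g| = |χ (g ^ n)| := by rw [h1, abs_mul, Nat.abs_cast]
      have h8 := abs_sub_abs_le_abs_sub (χ (g ^ n)) (q (g ^ n))
      linarith
    by_contra hne
    obtain ⟨n, hn⟩ := exists_nat_gt ((D + (B + T.dist (A 1 (γ 0)) (γ 0) + 1)) / |χ g|)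
    rw [div_lt_iff₀ (abs_pos.mpr hne)] at hn
    linarith [hbd n]
end

section
/- Let K be a number field with ring of integers 𝒪, and let n ≥ 3. Then SL(n,𝒪) has Property (QFA): for every simplicial tree T, every quasi-action A of SL(n,𝒪) on T, and every x ∈ T, the orbit {A(g, x) : g ∈ SL(n,𝒪)} has finite diameter. In particular this holds for SL(n,ℤ). -/
/-- Property (QFA): every quasi-action of `G` on any simplicial tree has bounded orbits. -/
def HasPropertyQFA (G : Type*) [Group G] : Prop :=
  ∀ (V : Type) (T : SimpleGraph V), T.IsTree →
    ∀ K C : ℝ, 1 ≤ K → 0 ≤ C →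
      ∀ A : G → V → V,
        -- each A(g,−) is a (K,C)-quasi-isometry of the tree
        (∀ g : G,
          (∀ u v : V, (T.dist u v : ℝ) / K - C ≤ (T.dist (A g u) (A g v) : ℝ) ∧
            (T.dist (A g u) (A g v) : ℝ) ≤ K * (T.dist u v : ℝ) + C) ∧
          ∀ v : V, ∃ u : V, (T.dist v (A g u) : ℝ) ≤ C) →
        -- quasi-action cocycle condition
        (∀ g h : G, ∀ u : V, (T.dist (A g (A h u)) (A (g * h) u) : ℝ) ≤ C) →
        -- every orbit has finite diameter
        ∀ x : V, ∃ D : ℝ, ∀ g g' : G, (T.dist (A g x) (A g' x) : ℝ) ≤ D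



open Relation

/-- Trees are tripods: a point between `x` and `z` is between `x` and `y` or between `y` and `z`. -/
theorem SimpleGraph.IsTree.between_or_between {V : Type*} {T : SimpleGraph V} (hT : T.IsTree)
    {x z p : V} (h : T.dist x p + T.dist p z = T.dist x z) (y : V) :
    T.dist x p + T.dist p y = T.dist x y ∨ T.dist y p + T.dist p z = T.dist y z := by
  classical
  have hc := hT.connected
  have key : ∀ {a b : V} (w : T.Walk a b), w.length = T.dist a b → p ∈ w.support →
      T.dist a p + T.dist p b = T.dist a b := by
    intro a b w hw hp
    have h1 := T.dist_le (w.takeUntil p hp)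
    have h2 := T.dist_le (w.dropUntil p hp)
    have h3 : (w.takeUntil p hp).length + (w.dropUntil p hp).length = w.length := by
      rw [← SimpleGraph.Walk.length_append, SimpleGraph.Walk.take_spec]
    have h4 := hc.dist_triangle (u := a) (v := p) (w := b)
    omega
  obtain ⟨w₁, h₁⟩ := hc.exists_walk_length_eq_dist x y
  obtain ⟨w₂, h₂⟩ := hc.exists_walk_length_eq_dist y z
  obtain ⟨u₁, g₁⟩ := hc.exists_walk_length_eq_dist x p
  obtain ⟨u₂, g₂⟩ := hc.exists_walk_length_eq_dist p z
  have hu : (u₁.append u₂).IsPath := by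
    apply SimpleGraph.Walk.isPath_of_length_eq_dist
    rw [SimpleGraph.Walk.length_append]; omega
  have hp : p ∈ (w₁.append w₂).support := by
    apply SimpleGraph.Walk.support_bypass_subset_support
    have := hT.isAcyclic.subsingleton_path x z
    have := congrArg Subtype.val (Subsingleton.elim (⟨_, hu⟩ : T.Path x z)
      ⟨_, (w₁.append w₂).bypass_isPath⟩)
    simp only at this
    rw [← this, SimpleGraph.Walk.mem_support_append_iff]
    exact Or.inl u₁.end_mem_support
  rw [SimpleGraph.Walk.mem_support_append_iff] at hp
  exact hp.imp (key _ h₁) (key _ h₂)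

/-- A coarse chain in a tree passes near every point between its endpoints. -/
theorem SimpleGraph.IsTree.exists_near_of_chain {V : Type*} {T : SimpleGraph V} (hT : T.IsTree)
    {D : ℕ} {S : Set V} {x y p : V} (hx : x ∈ S)
    (hc : ReflTransGen (fun u v => v ∈ S ∧ T.dist u v ≤ D) x y)
    (hp : T.dist x p + T.dist p y = T.dist x y) : ∃ q ∈ S, T.dist p q ≤ D := by
  induction hc with
  | refl =>
    refine ⟨x, hx, ?_⟩
    have := T.dist_self (v := x)
    omega
  | @tail b c hb hbc ih =>
    rcases hT.between_or_between hp b with h | h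
    · exact ih h
    · exact ⟨c, hbc.1, by omega⟩

/-- An integer-valued pseudometric that is discretely geodesic, hyperbolic, and has the
bottleneck property that coarse chains pass near every point between their endpoints. -/
structure IsQuasiTree {X : Type*} (d : X → X → ℕ) (δ : ℕ) : Prop where
  self : ∀ x, d x x = 0
  symm : ∀ x y, d x y = d y x
  triangle : ∀ x y z, d x z ≤ d x y + d y z
  geodesic : ∀ x y k, k ≤ d x y → ∃ p, d x p = k ∧ k + d p y = d x y
  fourPoint : ∀ x y z w, d x z + d y w ≤ max (d x y + d z w) (d y z + d x w) + δ
  bottleneck : ∀ D, ∃ Δ, ∀ (S : Set X) (x y p : X), x ∈ S →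
    ReflTransGen (fun u v => v ∈ S ∧ d u v ≤ D) x y → d x p + d p y = d x y →
      ∃ q ∈ S, d p q ≤ Δ

namespace SimpleGraph

variable {X : Type*} {Z : SimpleGraph X}

theorem Connected.exists_geodesic_point (hZ : Z.Connected) (x y : X) (k : ℕ)
    (hk : k ≤ Z.dist x y) : ∃ p, Z.dist x p = k ∧ k + Z.dist p y = Z.dist x y := by
  obtain ⟨w, hw⟩ := hZ.exists_walk_length_eq_dist x y
  refine ⟨w.getVert k, ?_⟩
  have h1 := Z.dist_le (w.take k)
  have h2 := Z.dist_le (w.drop k)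
  have h3 := hZ.dist_triangle (u := x) (v := w.getVert k) (w := y)
  simp only [Walk.take_length, Walk.drop_length] at h1 h2
  omega

theorem Connected.geodesic_chain (hZ : Z.Connected) (x y : X) :
    ReflTransGen (fun u v => Z.dist x v + Z.dist v y = Z.dist x y ∧ Z.dist u v ≤ 1) x y := by
  have key : ∀ n, ∀ u, Z.dist u y = n → Z.dist x u + Z.dist u y = Z.dist x y →
      ReflTransGen (fun u v => Z.dist x v + Z.dist v y = Z.dist x y ∧ Z.dist u v ≤ 1) u y := by
    intro n
    induction n with
    | zero =>
      intro u hu _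
      rw [(hZ.dist_eq_zero_iff).1 hu]
    | succ n ih =>
      intro u hu hxu
      obtain ⟨p, hp1, hp2⟩ := hZ.exists_geodesic_point u y 1 (by omega)
      have h3 := hZ.dist_triangle (u := x) (v := u) (w := p)
      have h4 := hZ.dist_triangle (u := x) (v := p) (w := y)
      have h5 : Z.dist x p + Z.dist p y = Z.dist x y := by omega
      exact ReflTransGen.head ⟨h5, hp1.le⟩ (ih p (by omega) h5)
  exact key _ x rfl (by simp)

/-- A graph quasi-isometric to a tree is a quasi-tree. -/
theorem Connected.exists_isQuasiTree (hZ : Z.Connected) {V : Type*} {T : SimpleGraph V}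
    (hT : T.IsTree) (f : X → V) (r : ℕ) (hf₁ : ∀ p q, T.dist (f p) (f q) ≤ r * Z.dist p q)
    (hf₂ : ∀ p q, Z.dist p q ≤ T.dist (f p) (f q) + 2) :
    ∃ δ, IsQuasiTree Z.dist δ := by
  have tri := fun x y z => hZ.dist_triangle (u := x) (v := y) (w := z)
  have triT := fun x y z => hT.connected.dist_triangle (u := x) (v := y) (w := z)
  have image_chain : ∀ {D : ℕ} {S : Set X} {x y : X},
      ReflTransGen (fun u v => v ∈ S ∧ Z.dist u v ≤ D) x y →
      ReflTransGen (fun u v => v ∈ f '' S ∧ T.dist u v ≤ r * D) (f x) (f y) := by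
    intro D S x y h
    refine ReflTransGen.lift f (fun a b hab => ?_) _ _ h
    exact ⟨⟨b, hab.1, rfl⟩, (hf₁ a b).trans (Nat.mul_le_mul_left r hab.2)⟩
  have bn : ∀ D, ∃ Δ, ∀ (S : Set X) (x y p : X), x ∈ S →
      ReflTransGen (fun u v => v ∈ S ∧ Z.dist u v ≤ D) x y →
      Z.dist x p + Z.dist p y = Z.dist x y → ∃ q ∈ S, Z.dist p q ≤ Δ := by
    intro D
    refine ⟨r * (2 * r + 2) + r + r * D + 3, fun S x y p hx hc hp => ?_⟩
    -- a coarse median of `f x`, `f p`, `f y`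
    obtain ⟨m, m', hm₁, hm₂, hm', hmm⟩ : ∃ m m' : V,
        T.dist (f x) m + T.dist m (f p) = T.dist (f x) (f p) ∧
        T.dist (f p) m + T.dist m (f y) = T.dist (f p) (f y) ∧
        T.dist (f x) m' + T.dist m' (f y) = T.dist (f x) (f y) ∧ T.dist m m' ≤ 1 := by
      by_contra! hcon
      have key : ∀ k, k ≤ T.dist (f p) (f x) → ∀ v, T.dist (f p) v = k →
          k + T.dist v (f x) = T.dist (f p) (f x) →
          T.dist (f p) v + T.dist v (f y) = T.dist (f p) (f y) := by
        intro k
        induction k with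
        | zero =>
          intro _ v hv _
          rw [← (hT.connected.dist_eq_zero_iff).1 hv]; simp
        | succ k ih =>
          intro hk v hv hvx
          obtain ⟨u, hu1, hu2⟩ := hT.connected.exists_geodesic_point (f p) v k (by omega)
          have e1 := triT (f p) u (f x)
          have e2 := triT u v (f x)
          have hu := ih (by omega) u hu1 (by omega)
          rcases hT.between_or_between (p := v) (x := f p) (z := f x) (by omega) (f y) with h | h
          · exact h
          · have := hcon u v (by rw [T.dist_comm (u := f x), T.dist_comm (v := f p),
              T.dist_comm (u := f x)]; omega) hu
              (by rw [T.dist_comm (u := f x), T.dist_comm (v := f y), T.dist_comm (u := f x)]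
                  omega)
            omega
      have h := key _ le_rfl (f x) rfl (by simp)
      have := hcon (f x) (f x) (by simp) h (by simp)
      simp at this
    obtain ⟨_, ⟨q, hq, rfl⟩, hqm⟩ := hT.exists_near_of_chain (Set.mem_image_of_mem f hx)
      (image_chain hc) hm'
    obtain ⟨_, ⟨a, ha, rfl⟩, ham⟩ := hT.exists_near_of_chain
      (S := f '' {v | Z.dist x v + Z.dist v p = Z.dist x p}) ⟨x, by simp, rfl⟩
      (image_chain (D := 1) (hZ.geodesic_chain x p)) hm₁
    obtain ⟨_, ⟨b, hb, rfl⟩, hbm⟩ := hT.exists_near_of_chain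
      (S := f '' {v | Z.dist p v + Z.dist v y = Z.dist p y}) ⟨p, by simp, rfl⟩
      (image_chain (D := 1) (hZ.geodesic_chain p y)) hm₂
    simp only [Set.mem_ofPred_eq] at ha hb
    have h1 := hf₂ a b
    have h2 := triT (f a) m (f b)
    have h3 := T.dist_comm (u := f a) (v := m)
    have h4 := tri x a y
    have h5 := tri a b y
    have h6 : Z.dist p a ≤ 2 * r + 2 := by
      have := Z.dist_comm (u := p) (v := a)
      omega
    have h7 := hf₁ p a
    have h8 : r * Z.dist p a ≤ r * (2 * r + 2) := Nat.mul_le_mul_left r h6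
    have h9 := hf₂ p q
    have h10 := triT (f p) (f a) (f q)
    have h11 := triT (f a) m (f q)
    have h12 := triT m m' (f q)
    refine ⟨q, hq, ?_⟩
    omega
  obtain ⟨Δ, hΔ⟩ := bn 1
  refine ⟨4 * Δ + 4, fun x => Z.dist_self, fun x y => Z.dist_comm, tri,
    hZ.exists_geodesic_point, fun x y z w => ?_, bn⟩
  by_contra! hcon
  -- a point on the geodesic from `x` to `w`, deeper than the chain through `x`, `y`, `z`
  have s1 := Z.dist_comm (u := x) (v := w)
  have s2 := Z.dist_comm (u := y) (v := w)
  have s3 := Z.dist_comm (u := z) (v := w)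
  have s4 := Z.dist_comm (u := x) (v := z)
  obtain ⟨k, hk1, hk2, hk3⟩ : ∃ k, 2 * k + Z.dist x y + Z.dist x z ≤
      Z.dist x w + Z.dist y w + Z.dist x z ∧ 2 * k + Z.dist y z ≤ Z.dist y w + Z.dist z w ∧
      Z.dist x w + Z.dist z w + 4 * Δ + 3 ≤ Z.dist x z + 2 * k := by
    have t1 := tri y x w
    have t2 := tri y z w
    have t3 := tri x z w
    have t4 := tri x y w
    have t5 := tri z y w
    have t6 := tri x w z
    have t7 := Z.dist_comm (u := x) (v := y)
    have t8 := Z.dist_comm (u := z) (v := y)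
    rcases le_total (Z.dist x w + Z.dist y w - Z.dist x y) (Z.dist y w + Z.dist z w - Z.dist y z)
      with h | h
    · exact ⟨(Z.dist x w + Z.dist y w - Z.dist x y) / 2, by omega, by omega, by omega⟩
    · exact ⟨(Z.dist y w + Z.dist z w - Z.dist y z) / 2, by omega, by omega, by omega⟩
  have t3 := tri x z w
  have t4 := tri x y w
  have t6 := tri x w z
  have t9 := tri y x w
  obtain ⟨p, hp1, hp2⟩ := hZ.exists_geodesic_point w x (k - Δ - 1)
    (by have := Z.dist_comm (u := x) (v := y); omega)
  set S : Set X := {v | Z.dist x v + Z.dist v y = Z.dist x y} ∪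
    {v | Z.dist y v + Z.dist v z = Z.dist y z} ∪ {v | Z.dist z v + Z.dist v w = Z.dist z w}
  have hch : ReflTransGen (fun u v => v ∈ S ∧ Z.dist u v ≤ 1) x w := by
    refine (ReflTransGen.mono ?_ _ _ (hZ.geodesic_chain x y)).trans
      ((ReflTransGen.mono ?_ _ _ (hZ.geodesic_chain y z)).trans
        (ReflTransGen.mono ?_ _ _ (hZ.geodesic_chain z w)))
    · exact fun a b h => ⟨Or.inl (Or.inl h.1), h.2⟩
    · exact fun a b h => ⟨Or.inl (Or.inr h.1), h.2⟩
    · exact fun a b h => ⟨Or.inr h.1, h.2⟩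
  obtain ⟨q, hq, hpq⟩ := hΔ S x w p (Or.inl (Or.inl (by simp))) hch (by
    have := Z.dist_comm (u := x) (v := p)
    have := Z.dist_comm (u := p) (v := w)
    omega)
  have u1 := tri w p q
  have u2 := Z.dist_comm (u := q) (v := w)
  have s5 := Z.dist_comm (u := x) (v := y)
  rcases hq with (hq | hq) | hq <;> simp only [Set.mem_ofPred_eq] at hq
  · have v1 := tri x q w
    have v2 := tri y q w
    have v3 := Z.dist_comm (u := y) (v := q)
    omega
  · have v1 := tri y q w
    have v2 := tri z q w
    have v3 := Z.dist_comm (u := z) (v := q)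
    omega
  · have v1 := tri x p z
    have v2 := tri p q z
    have v3 := Z.dist_comm (u := z) (v := q)
    have v4 := Z.dist_comm (u := x) (v := p)
    have v5 := tri w q p
    have v6 := Z.dist_comm (u := q) (v := p)
    omega

end SimpleGraph

/-- Every isometric action of `G` on a quasi-tree has bounded orbits. -/
def HasBoundedQuasiTreeOrbits (G : Type) [Group G] : Prop :=
  ∀ (X : Type) (d : X → X → ℕ) (δ : ℕ) (φ : G →* Equiv.Perm X), IsQuasiTree d δ →
    (∀ g x y, d (φ g x) (φ g y) = d x y) → ∀ x, ∃ B, ∀ g, d x (φ g x) ≤ B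

/-- A quasi-action on a tree is modelled by an isometric action on a quasi-tree. -/
theorem HasBoundedQuasiTreeOrbits.hasPropertyQFA {G : Type} [Group G]
    (hG : HasBoundedQuasiTreeOrbits G) : HasPropertyQFA G := by
  intro V T hT K C hK hC A hA hAC x
  obtain ⟨r, hr⟩ := exists_nat_ge (K + C)
  let Z : SimpleGraph (G × V) :=
    { Adj := fun p q => p ≠ q ∧ ∀ k, T.dist (A (k * p.1) p.2) (A (k * q.1) q.2) ≤ r
      symm := ⟨fun p q h => ⟨h.1.symm, fun k => by rw [T.dist_comm]; exact h.2 k⟩⟩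
      loopless := ⟨fun p h => h.1 rfl⟩ }
  have step : ∀ p q : G × V, (∀ k, T.dist (A (k * p.1) p.2) (A (k * q.1) q.2) ≤ r) →
      ∃ w : Z.Walk p q, w.length ≤ 1 := by
    intro p q h
    by_cases hpq : p = q
    · subst hpq; exact ⟨.nil, by simp⟩
    · exact ⟨.cons ⟨hpq, h⟩ .nil, by simp⟩
  have link : ∀ n, ∀ u v : V, T.dist u v = n →
      ∃ w : Z.Walk (1, u) (1, v), w.length ≤ n := by
    intro n
    induction n with
    | zero =>
      intro u v h
      rw [(hT.connected.dist_eq_zero_iff).1 h]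
      exact ⟨.nil, le_rfl⟩
    | succ n ih =>
      intro u v h
      obtain ⟨p, hp1, hp2⟩ := hT.connected.exists_geodesic_point u v 1 (by omega)
      obtain ⟨w₂, hw₂⟩ := ih p v (by omega)
      obtain ⟨w₁, hw₁⟩ := step (1, u) (1, p) (fun k => by
        have := ((hA (k * 1)).1 u p).2
        rw [hp1] at this
        have h' : (T.dist (A (k * 1) u) (A (k * 1) p) : ℝ) ≤ r :=
          this.trans (by push_cast; linarith)
        exact_mod_cast h')
      exact ⟨w₁.append w₂, by rw [SimpleGraph.Walk.length_append]; omega⟩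
  have drop : ∀ p : G × V, ∃ w : Z.Walk p (1, A p.1 p.2), w.length ≤ 1 := by
    intro p
    refine step _ _ fun k => ?_
    have := hAC k p.1 p.2
    rw [T.dist_comm] at this
    have h' : (T.dist (A (k * p.1) p.2) (A (k * 1) (A p.1 p.2)) : ℝ) ≤ r := by
      rw [mul_one]
      exact this.trans (by linarith)
    exact_mod_cast h'
  have walk : ∀ p q : G × V, ∃ w : Z.Walk p q,
      w.length ≤ T.dist (A p.1 p.2) (A q.1 q.2) + 2 := by
    intro p q
    obtain ⟨w₁, h₁⟩ := drop p
    obtain ⟨w₂, h₂⟩ := link _ _ _ (rfl : T.dist (A p.1 p.2) (A q.1 q.2) = _)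
    obtain ⟨w₃, h₃⟩ := drop q
    refine ⟨w₁.append (w₂.append w₃.reverse), ?_⟩
    simp only [SimpleGraph.Walk.length_append, SimpleGraph.Walk.length_reverse]
    omega
  have hZ : Z.Connected := by
    have : Nonempty (G × V) := ⟨(1, x)⟩
    exact SimpleGraph.Connected.mk fun p q => ⟨(walk p q).choose⟩
  have upper : ∀ p q : G × V, T.dist (A p.1 p.2) (A q.1 q.2) ≤ r * Z.dist p q := by
    intro p q
    obtain ⟨w, hw⟩ := hZ.exists_walk_length_eq_dist p q
    rw [← hw]
    clear hw
    induction w with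
    | nil => simp
    | @cons a b c h w ih =>
      have h1 := h.2 1
      rw [one_mul, one_mul] at h1
      have h2 := hT.connected.dist_triangle (u := A a.1 a.2) (v := A b.1 b.2) (w := A c.1 c.2)
      rw [SimpleGraph.Walk.length_cons]
      linarith [Nat.mul_succ r w.length]
  obtain ⟨δ, hδ⟩ := hZ.exists_isQuasiTree hT (fun p => A p.1 p.2) r upper
    (fun p q => (Z.dist_le _).trans (walk p q).choose_spec)
  let φ : G →* Equiv.Perm (G × V) :=
    { toFun := fun g => (Equiv.mulLeft g).prodCongr (Equiv.refl V)
      map_one' := by ext p <;> simp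
      map_mul' := fun g h => by ext p <;> simp [mul_assoc] }
  have adj : ∀ g p q, Z.Adj p q → Z.Adj (φ g p) (φ g q) := by
    intro g p q h
    refine ⟨fun e => h.1 ((φ g).injective e), fun k => ?_⟩
    have := h.2 (k * g)
    simpa [φ, mul_assoc] using this
  have contr : ∀ g p q, Z.dist (φ g p) (φ g q) ≤ Z.dist p q := by
    intro g p q
    obtain ⟨w, hw⟩ := hZ.exists_walk_length_eq_dist p q
    let ψ : Z →g Z := ⟨φ g, fun h => adj g _ _ h⟩
    have := Z.dist_le (w.map ψ)
    rw [SimpleGraph.Walk.length_map, hw] at this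
    exact this
  obtain ⟨B, hB⟩ := hG _ _ δ φ hδ (fun g p q => le_antisymm (contr g p q) (by
    have := contr g⁻¹ (φ g p) (φ g q)
    rwa [← Equiv.Perm.mul_apply, ← Equiv.Perm.mul_apply, ← map_mul, inv_mul_cancel, map_one,
      Equiv.Perm.one_apply, Equiv.Perm.one_apply] at this)) (1, x)
  refine ⟨(r * (2 * B) : ℕ), fun g g' => ?_⟩
  have h1 := upper (φ g (1, x)) (φ g' (1, x))
  have h2 := hZ.dist_triangle (u := φ g (1, x)) (v := (1, x)) (w := φ g' (1, x))
  have h3 := Z.dist_comm (u := φ g (1, x)) (v := (1, x))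
  have h4 : r * Z.dist (φ g (1, x)) (φ g' (1, x)) ≤ r * (2 * B) :=
    Nat.mul_le_mul_left r (by have := hB g; have := hB g'; omega)
  have h5 := h1.trans h4
  simp only [φ, MonoidHom.coe_mk, OneHom.coe_mk, Equiv.prodCongr_apply, Prod.map_apply,
    Equiv.coe_mulLeft, mul_one, Equiv.coe_refl, id] at h5
  exact_mod_cast h5

/-- An isometric action on a quasi-tree. -/
structure IsQuasiTreeAction {G X : Type*} [Group G] (d : X → X → ℕ) (δ : ℕ)
    (φ : G →* Equiv.Perm X) : Prop extends IsQuasiTree d δ where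
  isom : ∀ g x y, d (φ g x) (φ g y) = d x y

namespace IsQuasiTreeAction

variable {G X : Type*} [Group G] {d : X → X → ℕ} {δ : ℕ} {φ : G →* Equiv.Perm X}

theorem comp (h : IsQuasiTreeAction d δ φ) {H : Type*} [Group H] (j : H →* G) :
    IsQuasiTreeAction d δ (φ.comp j) :=
  ⟨h.toIsQuasiTree, fun g => h.isom (j g)⟩

theorem mul_le (h : IsQuasiTreeAction d δ φ) (a b : G) (x : X) :
    d x (φ (a * b) x) ≤ d x (φ a x) + d x (φ b x) := by
  have h1 := h.triangle x (φ a x) (φ a (φ b x))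
  rw [h.isom] at h1
  rwa [map_mul, Equiv.Perm.mul_apply]

theorem inv_eq (h : IsQuasiTreeAction d δ φ) (a : G) (x : X) :
    d x (φ a⁻¹ x) = d x (φ a x) := by
  rw [← h.isom a x (φ a⁻¹ x), ← Equiv.Perm.mul_apply, ← map_mul, mul_inv_cancel, map_one,
    Equiv.Perm.one_apply, h.symm]

theorem one_eq (h : IsQuasiTreeAction d δ φ) (x : X) : d x (φ 1 x) = 0 := by
  rw [map_one, Equiv.Perm.one_apply, h.self]

theorem mul_mul_eq (h : IsQuasiTreeAction d δ φ) (a b c : G) (x : X) :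
    d (φ (a * b) x) (φ (a * c) x) = d (φ b x) (φ c x) := by
  simp only [map_mul, Equiv.Perm.mul_apply, h.isom]

theorem pow_le (h : IsQuasiTreeAction d δ φ) (a : G) (x : X) (n : ℕ) :
    d x (φ (a ^ n) x) ≤ n * d x (φ a x) := by
  induction n with
  | zero => simp [h.self]
  | succ n ih =>
    have := h.mul_le (a ^ n) a x
    rw [pow_succ, Nat.succ_mul]
    omega

/-- An isometry whose square moves a point much farther than itself has linear growth. -/
theorem le_pow (h : IsQuasiTreeAction d δ φ) (a : G) (x : X)
    (ha : d x (φ a x) + δ < d x (φ (a ^ 2) x)) (n : ℕ) : n ≤ d x (φ (a ^ n) x) := by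
  have key : ∀ n, d x (φ (a ^ n) x) + 1 ≤ d x (φ (a ^ (n + 1)) x) := by
    intro n
    induction n with
    | zero =>
      have := h.pow_le a x 2
      rw [pow_zero, h.one_eq, pow_one]
      omega
    | succ n ih =>
      have h1 := h.fourPoint x (φ a x) (φ (a ^ 2) x) (φ (a ^ (n + 2)) x)
      have e1 := h.mul_mul_eq a 1 (a ^ (n + 1)) x
      have e2 := h.mul_mul_eq (a ^ 2) 1 (a ^ n) x
      have e3 := h.mul_mul_eq a 1 a x
      rw [← pow_succ', mul_one, map_one, Equiv.Perm.one_apply] at e1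
      rw [← pow_add, mul_one, map_one, Equiv.Perm.one_apply, add_comm 2] at e2
      rw [← pow_two, mul_one, map_one, Equiv.Perm.one_apply] at e3
      rw [e1, e2, e3] at h1
      rcases max_cases (d x (φ a x) + d x (φ (a ^ n) x))
        (d x (φ a x) + d x (φ (a ^ (n + 2)) x)) with ⟨h2, -⟩ | ⟨h2, -⟩ <;>
        simp only [add_assoc, Nat.reduceAdd] at * <;> omega
  induction n with
  | zero => exact Nat.zero_le _
  | succ n ih => exact (Nat.succ_le_succ ih).trans (key n)

/-- If no power of `z` has linear growth then `z` has bounded orbits. -/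
theorem exists_pow_le (h : IsQuasiTreeAction d δ φ) (z : G) (x : X)
    (hz : ∀ k, ∃ n, d x (φ ((z ^ k) ^ n) x) < n) : ∃ B, ∀ k : ℕ, d x (φ (z ^ k) x) ≤ B := by
  have hsq : ∀ k, d x (φ ((z ^ k) ^ 2) x) ≤ d x (φ (z ^ k) x) + δ := by
    intro k
    by_contra! hk
    obtain ⟨n, hn⟩ := hz k
    have := h.le_pow (z ^ k) x hk n
    omega
  obtain ⟨Δ, hΔ⟩ := h.bottleneck (d x (φ z x))
  refine ⟨6 * Δ + 4 * δ + 8, fun k => ?_⟩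
  set L := d x (φ (z ^ k) x) with hL
  obtain ⟨p, hp1, hp2⟩ := h.geodesic x (φ (z ^ k) x) (L / 2) (Nat.div_le_self _ _)
  have hc : ∀ m ≤ k, Relation.ReflTransGen
      (fun u v => v ∈ {v | ∃ i ≤ k, v = φ (z ^ i) x} ∧ d u v ≤ d x (φ z x)) x (φ (z ^ m) x) := by
    intro m
    induction m with
    | zero => intro _; rw [pow_zero, map_one, Equiv.Perm.one_apply]
    | succ m ih =>
      intro hm
      refine (ih (by omega)).tail ⟨⟨m + 1, hm, rfl⟩, ?_⟩
      have := h.mul_mul_eq (z ^ m) 1 z x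
      rw [mul_one, ← pow_succ, map_one, Equiv.Perm.one_apply] at this
      exact this.le
  obtain ⟨_, ⟨i, hi, rfl⟩, hpi⟩ :=
    hΔ {v | ∃ i ≤ k, v = φ (z ^ i) x} x _ p ⟨0, by omega, by simp⟩ (hc k le_rfl) (by omega)
  obtain ⟨j, rfl⟩ := Nat.exists_eq_add_of_le hi
  have a1 := h.triangle x p (φ (z ^ i) x)
  have a2 := h.triangle (φ (z ^ i) x) p (φ (z ^ (i + j)) x)
  have a3 := h.symm p (φ (z ^ i) x)
  have b1 := h.mul_mul_eq (z ^ i) 1 (z ^ j) x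
  have b2 := h.mul_mul_eq (z ^ j) (z ^ i) 1 x
  have b3 := h.mul_mul_eq (z ^ i) (z ^ j) (z ^ i) x
  rw [← pow_add, mul_one, map_one, Equiv.Perm.one_apply] at b1
  rw [← pow_add, add_comm j, mul_one, map_one, Equiv.Perm.one_apply] at b2
  rw [← pow_add, ← pow_two] at b3
  have b4 := h.symm x (φ (z ^ i) x)
  have b5 := h.symm (φ (z ^ i) x) (φ (z ^ j) x)
  have c1 := h.fourPoint x (φ (z ^ i) x) (φ (z ^ (i + j)) x) (φ (z ^ j) x)
  have c2 := h.triangle x (φ ((z ^ i) ^ 2) x) (φ (z ^ (i + j)) x)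
  have c3 := h.symm (φ ((z ^ i) ^ 2) x) (φ (z ^ (i + j)) x)
  have c4 := hsq i
  rcases max_cases (d x (φ (z ^ i) x) + d (φ (z ^ (i + j)) x) (φ (z ^ j) x))
    (d (φ (z ^ i) x) (φ (z ^ (i + j)) x) + d x (φ (z ^ j) x)) with ⟨h2, -⟩ | ⟨h2, -⟩ <;> omega

/-- If sufficiently many pairs of elements have a common coarse fixed point, then orbits are
bounded. -/
theorem exists_le_of_common_fixed (h : IsQuasiTreeAction d δ φ) (x : X) (S : Set G)
    (hS : Subgroup.closure S = ⊤) (D R : ℕ) (hD : ∀ s ∈ S, d x (φ s x) ≤ D)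
    (hR : ∀ a b : G, ∃ y, d y (φ a y) ≤ R ∧ d y (φ b y) ≤ R) :
    ∃ B, ∀ g, d x (φ g x) ≤ B := by
  obtain ⟨Δ, hΔ⟩ := h.bottleneck D
  have hc : ∀ g : G, Relation.ReflTransGen
      (fun u v => v ∈ Set.range (fun g => φ g x) ∧ d u v ≤ D) x (φ g x) := by
    intro g
    have step : ∀ a s : G, d x (φ s x) ≤ D → d (φ a x) (φ (a * s) x) ≤ D := by
      intro a s hs
      have := h.mul_mul_eq a 1 s x
      rw [mul_one, map_one, Equiv.Perm.one_apply] at this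
      omega
    have hg : g ∈ Subgroup.closure S := hS ▸ Subgroup.mem_top g
    induction hg using Subgroup.closure_induction_right with
    | one => rw [map_one, Equiv.Perm.one_apply]
    | mul_right a ha s hs ih => exact ih.tail ⟨⟨_, rfl⟩, step a s (hD s hs)⟩
    | mul_inv_cancel a ha s hs ih =>
      exact ih.tail ⟨⟨_, rfl⟩, step a s⁻¹ (by rw [h.inv_eq]; exact hD s hs)⟩
  refine ⟨2 * (2 * R + Δ + δ + 2), fun g => ?_⟩
  obtain ⟨p, hp1, hp2⟩ := h.geodesic x (φ g x) (d x (φ g x) / 2) (Nat.div_le_self _ _)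
  obtain ⟨_, ⟨b, rfl⟩, hb⟩ :=
    hΔ (Set.range fun g => φ g x) x _ p ⟨1, by simp⟩ (hc g) (by omega)
  obtain ⟨y, hy1, hy2⟩ := hR g b
  have a1 := h.fourPoint x p (φ g x) y
  have a2 := h.triangle (φ g x) (φ g y) y
  have a3 := h.triangle (φ b x) p y
  have a4 := h.triangle (φ b y) y (φ b x)
  have a5 := h.symm y (φ b x)
  have a6 := h.symm (φ b y) y
  have a7 := h.symm (φ g y) y
  have a8 := h.symm (φ b y) (φ b x)
  have a9 := h.symm p (φ b x)
  simp only [h.isom] at a2 a4 a8 hb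
  rcases max_cases (d x p + d (φ g x) y) (d p (φ g x) + d x y) with ⟨h2, -⟩ | ⟨h2, -⟩ <;> omega

end IsQuasiTreeAction

/-- A bounded subset of a quasi-tree has a center which is coarsely fixed by every isometry that
coarsely preserves the subset. -/
theorem IsQuasiTree.exists_center {X : Type*} {d : X → X → ℕ} {δ : ℕ} (h : IsQuasiTree d δ)
    (S : Set X) (s : X) (hs : s ∈ S) (M : ℕ) (hM : ∀ b ∈ S, d s b ≤ M) :
    ∃ c, ∀ (f : X → X) (R : ℕ), (∀ x y, d (f x) (f y) = d x y) →
      (∀ b ∈ S, ∃ b' ∈ S, d b (f b') ≤ R) → d c (f c) ≤ 2 * R + 2 * δ + 1 := by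
  classical
  have hex : ∃ n, ∃ c, ∀ b ∈ S, d c b ≤ n := ⟨M, s, hM⟩
  obtain ⟨c, hc⟩ := Nat.find_spec hex
  refine ⟨c, fun f R hf hR => ?_⟩
  obtain ⟨m, hm1, hm2⟩ := h.geodesic c (f c) (d c (f c) / 2) (Nat.div_le_self _ _)
  obtain ⟨b, hb, hmb⟩ : ∃ b ∈ S, Nat.find hex ≤ d m b := by
    by_contra! hcon
    have h1 := hcon s hs
    exact Nat.find_min hex (m := Nat.find hex - 1) (by omega)
      ⟨m, fun b hb => by have := hcon b hb; omega⟩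
  obtain ⟨b', hb', hbb⟩ := hR b hb
  have h1 := hc b hb
  have h2 := hc b' hb'
  have h3 := h.triangle (f c) (f b') b
  have h4 := h.symm b (f b')
  have h5 := h.fourPoint c m (f c) b
  rw [hf] at h3
  rcases max_cases (d c m + d (f c) b) (d m (f c) + d c b) with ⟨h6, -⟩ | ⟨h6, -⟩ <;> omega

section SpecialLinearTwo

open Matrix

/-- The elementary matrix `!![1, t; 0, 1]`. -/
def upperTwo {R : Type*} [CommRing R] (t : R) : SpecialLinearGroup (Fin 2) R :=
  ⟨!![1, t; 0, 1], by simp [Matrix.det_fin_two]⟩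

/-- The elementary matrix `!![1, 0; t, 1]`. -/
def lowerTwo {R : Type*} [CommRing R] (t : R) : SpecialLinearGroup (Fin 2) R :=
  ⟨!![1, 0; t, 1], by simp [Matrix.det_fin_two]⟩

variable {R : Type*} [CommRing R]

theorem upperTwo_coe (t : R) : (upperTwo t : Matrix (Fin 2) (Fin 2) R) = !![1, t; 0, 1] := rfl

theorem lowerTwo_coe (t : R) : (lowerTwo t : Matrix (Fin 2) (Fin 2) R) = !![1, 0; t, 1] := rfl

theorem mul_upperTwo_apply (M : SpecialLinearGroup (Fin 2) R) (t : R) :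
    (M * upperTwo t) 0 0 = M 0 0 ∧ (M * upperTwo t) 0 1 = M 0 1 + M 0 0 * t := by
  simp [upperTwo_coe, Matrix.SpecialLinearGroup.coe_mul, Matrix.mul_apply, Fin.sum_univ_two,
    add_comm]

theorem mul_lowerTwo_apply (M : SpecialLinearGroup (Fin 2) R) (t : R) :
    (M * lowerTwo t) 0 0 = M 0 0 + M 0 1 * t ∧ (M * lowerTwo t) 0 1 = M 0 1 := by
  simp [lowerTwo_coe, Matrix.SpecialLinearGroup.coe_mul, Matrix.mul_apply, Fin.sum_univ_two]

theorem upperTwo_neg (t : R) : upperTwo (-t) = (upperTwo t)⁻¹ := by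
  rw [eq_inv_iff_mul_eq_one]
  ext i j
  fin_cases i <;> fin_cases j <;>
    simp [upperTwo_coe, Matrix.SpecialLinearGroup.coe_mul, Matrix.mul_apply, Fin.sum_univ_two]

theorem lowerTwo_neg (t : R) : lowerTwo (-t) = (lowerTwo t)⁻¹ := by
  rw [eq_inv_iff_mul_eq_one]
  ext i j
  fin_cases i <;> fin_cases j <;>
    simp [lowerTwo_coe, Matrix.SpecialLinearGroup.coe_mul, Matrix.mul_apply, Fin.sum_univ_two]

theorem det_two_eq (M : SpecialLinearGroup (Fin 2) R) : M 0 0 * M 1 1 - M 0 1 * M 1 0 = 1 := by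
  rw [← Matrix.det_fin_two, M.det_coe]

theorem exists_eq_lowerTwo_mul (M N : SpecialLinearGroup (Fin 2) R) (h₀ : M 0 0 = N 0 0)
    (h₁ : M 0 1 = N 0 1) : ∃ t, N = lowerTwo t * M := by
  have hM := det_two_eq M
  have hN := det_two_eq N
  refine ⟨N 1 0 * M 1 1 - N 1 1 * M 1 0, ?_⟩
  rw [← h₀, ← h₁] at hN
  ext i j
  fin_cases i <;> fin_cases j <;>
    simp [lowerTwo_coe, Matrix.SpecialLinearGroup.coe_mul, Matrix.mul_apply, Fin.sum_univ_two,
      ← h₀, ← h₁]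
  · linear_combination (-N 1 0) * hM + M 1 0 * hN
  · linear_combination (-N 1 1) * hM + M 1 1 * hN

end SpecialLinearTwo

section StableRange

variable {R : Type*} [CommRing R]

/-- In a finite commutative ring, a unimodular pair `(b, c)` can be shortened to a unit. -/
theorem exists_isUnit_add_mul_of_finite [Finite R] (b c : R) (h : IsCoprime b c) :
    ∃ t, IsUnit (b + t * c) := by
  obtain ⟨n, hn, hidem⟩ : ∃ n, 0 < n ∧ b ^ n * b ^ n = b ^ n := by
    obtain ⟨i, j, hij, hb⟩ : ∃ i j, i < j ∧ b ^ i = b ^ j := by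
      obtain ⟨i, j, hne, hb⟩ := Finite.exists_ne_map_eq_of_infinite fun n : ℕ => b ^ n
      rcases lt_or_gt_of_ne hne with h | h
      exacts [⟨i, j, h, hb⟩, ⟨j, i, h, hb.symm⟩]
    obtain ⟨p, rfl⟩ := Nat.exists_eq_add_of_lt hij
    have hper : ∀ k l, b ^ (i + l + k * (p + 1)) = b ^ (i + l) := by
      intro k l
      induction k with
      | zero => simp
      | succ k ih =>
        rw [← ih, show i + l + (k + 1) * (p + 1) = (i + p + 1) + (l + k * (p + 1)) by ring,
          pow_add, ← hb, ← pow_add]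
        congr 1
        ring
    refine ⟨(i + 1) * (p + 1), by positivity, ?_⟩
    have := hper (i + 1) (i * p + p + 1)
    rw [← pow_add]
    convert this using 2 <;> ring
  obtain ⟨y, z, hyz⟩ := h
  refine ⟨1 - b ^ n, ?_⟩
  by_contra hu
  obtain ⟨P, hP, hmem⟩ := exists_max_ideal_of_mem_nonunits hu
  have hprime := hP.isPrime
  have hb : b ∈ P := by
    refine hprime.mem_of_pow_mem (n + 1) ?_
    have : b ^ (n + 1) = b ^ n * (b + (1 - b ^ n) * c) := by linear_combination c * hidem
    rw [this]
    exact P.mul_mem_left _ hmem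
  have hbn : b ^ n ∈ P := P.pow_mem_of_mem hb n hn
  have hc : c ∈ P := by
    have : c = (b + (1 - b ^ n) * c) - b + c * b ^ n := by ring
    rw [this]
    exact P.add_mem (P.sub_mem hmem hb) (P.mul_mem_left _ hbn)
  refine hP.ne_top ((Ideal.eq_top_iff_one P).2 ?_)
  rw [← hyz]
  exact P.add_mem (P.mul_mem_left _ hb) (P.mul_mem_left _ hc)

/-- A unimodular triple `(a, b, c)` with `R ⧸ (a)` finite can be shortened. -/
theorem exists_isCoprime_add_mul (a b c : R) [Finite (R ⧸ Ideal.span {a})]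
    (h : ∃ x y z, x * a + y * b + z * c = 1) : ∃ t, IsCoprime a (b + t * c) := by
  obtain ⟨x, y, z, h⟩ := h
  let π := Ideal.Quotient.mk (Ideal.span {a})
  have ha : π a = 0 := Ideal.Quotient.eq_zero_iff_mem.2 (Ideal.mem_span_singleton_self a)
  obtain ⟨t, ht⟩ := exists_isUnit_add_mul_of_finite (π b) (π c)
    ⟨π y, π z, by rw [← map_mul, ← map_mul, ← map_add, ← map_one π, ← h]; simp [ha]⟩
  obtain ⟨t, rfl⟩ := Ideal.Quotient.mk_surjective t
  obtain ⟨u, hu⟩ := ht.exists_left_inv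
  obtain ⟨u, rfl⟩ := Ideal.Quotient.mk_surjective u
  refine ⟨t, ?_⟩
  have h1 : π (1 - u * (b + t * c)) = 0 := by
    simpa [sub_eq_zero] using hu.symm
  obtain ⟨w, hw⟩ := Ideal.mem_span_singleton.1 (Ideal.Quotient.eq_zero_iff_mem.1 h1)
  exact ⟨w, u, by linear_combination -hw⟩

end StableRange

section Mennicke

open Matrix

variable {R : Type*} [CommRing R]

/-- Two matrices of determinant one can be brought to a common nonzero corner entry by at most
three elementary column operations each. -/
theorem exists_common_corner [IsDomain R] (hR : ∀ a : R, a ≠ 0 → Finite (R ⧸ Ideal.span {a}))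
    (M N : SpecialLinearGroup (Fin 2) R) : ∃ s t s' t' : R,
      (M * upperTwo s * lowerTwo t) 0 0 = (N * upperTwo s' * lowerTwo t') 0 0 ∧
      (M * upperTwo s * lowerTwo t) 0 0 ≠ 0 := by
  have hN := det_two_eq N
  obtain ⟨s', hs'⟩ : ∃ s' : R, (N * upperTwo s') 0 1 ≠ 0 := by
    by_cases h : N 0 1 = 0
    · refine ⟨1, fun h' => ?_⟩
      rw [(mul_upperTwo_apply N 1).2, h, zero_add, mul_one] at h'
      rw [h, h'] at hN
      simp at hN
    · exact ⟨0, by rw [(mul_upperTwo_apply N 0).2]; simpa using h⟩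
  have hM := det_two_eq M
  have := hR _ hs'
  obtain ⟨s, u, v, hs⟩ := exists_isCoprime_add_mul ((N * upperTwo s') 0 1) (M 0 1) (M 0 0)
    ⟨0, -M 1 0, M 1 1, by linear_combination hM⟩
  set a := M 0 0
  set b := M 0 1 + M 0 0 * s with hb
  set a' := (N * upperTwo s') 0 0
  set b' := (N * upperTwo s') 0 1
  have key : ∃ t t', a + b * t = a' + b' * t' ∧ a + b * t ≠ 0 := by
    by_cases h : a + b * ((a' - a) * v) = 0
    · refine ⟨(a' - a) * v + b', -((a' - a) * u) + b, ?_, ?_⟩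
      · linear_combination (a' - a) * hs
      · rw [mul_add, ← add_assoc, h, zero_add]
        refine mul_ne_zero (fun h0 => ?_) hs'
        rw [h0, zero_mul, add_zero] at h
        have h1 : M 0 1 = 0 := by linear_combination h0 - s * h
        rw [h1, h] at hM
        simp at hM
    · exact ⟨(a' - a) * v, -((a' - a) * u), by linear_combination (a' - a) * hs, h⟩
  obtain ⟨t, t', h1, h2⟩ := key
  refine ⟨s, t, s', t', ?_, ?_⟩
  · rw [(mul_lowerTwo_apply _ _).1, (mul_lowerTwo_apply _ _).1, (mul_upperTwo_apply M s).1,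
      (mul_upperTwo_apply M s).2]
    exact h1
  · rw [(mul_lowerTwo_apply _ _).1, (mul_upperTwo_apply M s).1, (mul_upperTwo_apply M s).2]
    exact h2

variable {X : Type*} {d : X → X → ℕ} {δ : ℕ} {φ : SpecialLinearGroup (Fin 2) R →* Equiv.Perm X}

theorem IsQuasiTreeAction.exists_center_of_mennicke (h : IsQuasiTreeAction d δ φ) (x : X) (r : ℕ)
    (hu : ∀ t A, d (φ A x) (φ (upperTwo t * A) x) ≤ r)
    (hl : ∀ t A, d (φ A x) (φ (lowerTwo t * A) x) ≤ r)
    (hm : ∀ L M N : SpecialLinearGroup (Fin 2) R, L 0 0 = M 0 0 → M 0 0 = N 0 0 →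
      N 0 1 = L 0 1 * M 0 1 → d (φ (L * M) x) (φ N x) ≤ r)
    (M₀ : SpecialLinearGroup (Fin 2) R) [Finite (R ⧸ Ideal.span {M₀ 0 0})] :
    ∃ c, (∀ t, d c (φ (upperTwo t) c) ≤ 6 * r + 2 * δ + 1) ∧
      (∀ t, d c (φ (lowerTwo t) c) ≤ 6 * r + 2 * δ + 1) ∧
      ∀ M : SpecialLinearGroup (Fin 2) R, M 0 0 = M₀ 0 0 → d c (φ M c) ≤ 6 * r + 2 * δ + 1 := by
  classical
  have near : ∀ (M N : SpecialLinearGroup (Fin 2) R) (s : R), M 0 0 = N 0 0 →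
      N 0 1 = M 0 1 + M 0 0 * s → d (φ M x) (φ N x) ≤ 2 * r := by
    intro M N s h₀ h₁
    obtain ⟨t, rfl⟩ := exists_eq_lowerTwo_mul (M * upperTwo s) N
      (by rw [(mul_upperTwo_apply M s).1, h₀]) (by rw [(mul_upperTwo_apply M s).2, h₁])
    have h2 := hl t (M * upperTwo s)
    have h3 := h.mul_mul_eq M 1 (upperTwo s) x
    have h4 := hu s 1
    rw [mul_one] at h3 h4
    have := h.triangle (φ M x) (φ (M * upperTwo s) x) (φ (lowerTwo t * (M * upperTwo s)) x)
    omega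
  obtain ⟨B, hB⟩ : ∃ B, ∀ M : SpecialLinearGroup (Fin 2) R, M 0 0 = M₀ 0 0 →
      d (φ M₀ x) (φ M x) ≤ B := by
    let π := Ideal.Quotient.mk (Ideal.span {M₀ 0 0})
    have hq : ∀ q : R ⧸ Ideal.span {M₀ 0 0}, ∃ B, ∀ M : SpecialLinearGroup (Fin 2) R,
        M 0 0 = M₀ 0 0 → π (M 0 1) = q → d (φ M₀ x) (φ M x) ≤ B := by
      intro q
      by_cases hq : ∃ N : SpecialLinearGroup (Fin 2) R, N 0 0 = M₀ 0 0 ∧ π (N 0 1) = q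
      · obtain ⟨N, hN, rfl⟩ := hq
        refine ⟨d (φ M₀ x) (φ N x) + 2 * r, fun M hM hMN => ?_⟩
        obtain ⟨s, hs⟩ := Ideal.mem_span_singleton.1 (Ideal.Quotient.eq.1 hMN)
        have h1 := near N M s (hN.trans hM.symm) (by rw [hN]; linear_combination hs)
        have h2 := h.triangle (φ M₀ x) (φ N x) (φ M x)
        omega
      · exact ⟨0, fun M hM hMq => absurd ⟨M, hM, hMq⟩ hq⟩
    choose f hf using hq
    obtain ⟨B, hB⟩ := Finite.exists_le f
    exact ⟨B, fun M hM => (hf _ M hM rfl).trans (hB _)⟩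
  obtain ⟨c, hc⟩ := h.exists_center {y | ∃ M : SpecialLinearGroup (Fin 2) R,
    M 0 0 = M₀ 0 0 ∧ y = φ M x} (φ M₀ x) ⟨M₀, rfl, rfl⟩ B
    (by rintro _ ⟨M, hM, rfl⟩; exact hB M hM)
  have hc' : ∀ g, (∀ M : SpecialLinearGroup (Fin 2) R, M 0 0 = M₀ 0 0 →
      ∃ N : SpecialLinearGroup (Fin 2) R, N 0 0 = M₀ 0 0 ∧ d (φ M x) (φ (g * N) x) ≤ 3 * r) →
      d c (φ g c) ≤ 6 * r + 2 * δ + 1 := by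
    intro g hg
    have := hc (φ g) (3 * r) (h.isom g) (by
      rintro _ ⟨M, hM, rfl⟩
      obtain ⟨N, hN, hMN⟩ := hg M hM
      exact ⟨_, ⟨N, hN, rfl⟩, by rwa [map_mul, Equiv.Perm.mul_apply] at hMN⟩)
    omega
  refine ⟨c, fun t => ?_, fun t => ?_, fun M hM => ?_⟩
  · exact hc' _ fun M hM => ⟨M, hM, (hu t M).trans (by omega)⟩
  · exact hc' _ fun M hM => ⟨M, hM, (hl t M).trans (by omega)⟩
  · refine hc' _ fun M' hM' => ?_
    have h1 : IsCoprime (M₀ 0 0) (M 1 0) := by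
      rw [← hM]; exact ⟨M 1 1, -M 0 1, by linear_combination det_two_eq M⟩
    have h2 : IsCoprime (M₀ 0 0) (M' 0 1) := hM' ▸ M'.isCoprime_row 0
    have h3 : IsCoprime (M₀ 0 0) (M 0 1) := hM ▸ M.isCoprime_row 0
    have h4 := (h1.mul_right h2).neg_right
    obtain ⟨N, hN0, hN1⟩ := h4.exists_SL2_row 0
    obtain ⟨L, hL0, hL1⟩ := (h3.mul_right h4).exists_SL2_row 0
    refine ⟨N, hN0, ?_⟩
    have h5 := hm M N L (hM.trans hN0.symm) (hN0.trans hL0.symm) (by rw [hL1, hN1])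
    have h6 := near M' L (-(M 1 1 * M' 0 1)) (hM'.trans hL0.symm) (by
      rw [hL1, hM', ← hM]
      linear_combination M' 0 1 * det_two_eq M)
    have h7 := h.triangle (φ M' x) (φ L x) (φ (M * N) x)
    have h8 := h.symm (φ L x) (φ (M * N) x)
    omega

/-- Isometric actions of `SL(2, R)` on quasi-trees which are coarsely compatible with elementary
matrices and Mennicke symbols have bounded orbits. -/
theorem IsQuasiTreeAction.exists_le_of_mennicke [IsDomain R]
    (hR : ∀ a : R, a ≠ 0 → Finite (R ⧸ Ideal.span {a}))
    (F : Set (SpecialLinearGroup (Fin 2) R)) (hF : F.Finite)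
    (hgen : Subgroup.closure (F ∪ Set.range upperTwo ∪ Set.range lowerTwo) = ⊤)
    (h : IsQuasiTreeAction d δ φ) (x : X) (r : ℕ)
    (hu : ∀ t A, d (φ A x) (φ (upperTwo t * A) x) ≤ r)
    (hl : ∀ t A, d (φ A x) (φ (lowerTwo t * A) x) ≤ r)
    (hm : ∀ L M N : SpecialLinearGroup (Fin 2) R, L 0 0 = M 0 0 → M 0 0 = N 0 0 →
      N 0 1 = L 0 1 * M 0 1 → d (φ (L * M) x) (φ N x) ≤ r) :
    ∃ B, ∀ A, d x (φ A x) ≤ B := by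
  obtain ⟨D, hD⟩ := (hF.image fun A => d x (φ A x)).bddAbove
  refine h.exists_le_of_common_fixed x _ hgen (D + r) (3 * (6 * r + 2 * δ + 1)) ?_ fun M N => ?_
  · rintro _ ((hA | ⟨t, rfl⟩) | ⟨t, rfl⟩)
    · exact (hD ⟨_, hA, rfl⟩).trans (Nat.le_add_right _ _)
    · have := hu t 1
      rw [mul_one, map_one, Equiv.Perm.one_apply] at this
      omega
    · have := hl t 1
      rw [mul_one, map_one, Equiv.Perm.one_apply] at this
      omega
  · obtain ⟨s, t, s', t', h1, h2⟩ := exists_common_corner hR M N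
    have := hR _ h2
    obtain ⟨c, hcu, hcl, hc⟩ := h.exists_center_of_mennicke x r hu hl hm
      (M * upperTwo s * lowerTwo t)
    have key : ∀ (A : SpecialLinearGroup (Fin 2) R) (s t : R),
        d c (φ (A * upperTwo s * lowerTwo t) c) ≤ 6 * r + 2 * δ + 1 →
        d c (φ A c) ≤ 3 * (6 * r + 2 * δ + 1) := by
      intro A s t hA
      have e : A = A * upperTwo s * lowerTwo t * lowerTwo (-t) * upperTwo (-s) := by
        rw [lowerTwo_neg, upperTwo_neg]; group
      have h3 := h.mul_le (A * upperTwo s * lowerTwo t * lowerTwo (-t)) (upperTwo (-s)) c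
      have h4 := h.mul_le (A * upperTwo s * lowerTwo t) (lowerTwo (-t)) c
      rw [← e] at h3
      have h5 := hcl (-t)
      have h6 := hcu (-s)
      omega
    exact ⟨c, key M s t (hc _ rfl), key N s' t' (hc _ h1.symm)⟩

end Mennicke

/-- Boundedness of root groups: a finitely generated abelian group of commutators of elements
of two further root groups moves points boundedly. -/
theorem IsQuasiTreeAction.exists_le_of_commutator {R : Type*} [CommRing R] [Module.Finite ℤ R]
    {G X : Type*} [Group G] {d : X → X → ℕ} {δ : ℕ} {φ : G →* Equiv.Perm X}
    (h : IsQuasiTreeAction d δ φ) (x : X) (u v w : Multiplicative R →* G)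
    (hcomm : ∀ r s : R, u (.ofAdd (r * s)) = v (.ofAdd r) * w (.ofAdd s) * (v (.ofAdd r))⁻¹ *
      (w (.ofAdd s))⁻¹) :
    ∃ B, ∀ r : R, d x (φ (u (.ofAdd r)) x) ≤ B := by
  have hnat : ∀ r : R, ∃ B, ∀ k : ℕ, d x (φ (u (.ofAdd r) ^ k) x) ≤ B := by
    refine fun r => h.exists_pow_le _ x fun k => ?_
    set a := d x (φ (v (.ofAdd (k * r))) x)
    set b := d x (φ (w (.ofAdd 1)) x)
    refine ⟨(2 * a + 2 * b + 1) ^ 2, ?_⟩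
    set m := 2 * a + 2 * b + 1
    have e : (u (.ofAdd r) ^ k) ^ m ^ 2 = v (.ofAdd (k * r)) ^ m * w (.ofAdd 1) ^ m *
        (v (.ofAdd (k * r)) ^ m)⁻¹ * (w (.ofAdd 1) ^ m)⁻¹ := by
      simp only [← map_pow, ← ofAdd_nsmul]
      rw [← hcomm]
      congr 2
      simp only [nsmul_eq_mul, Nat.cast_pow]
      ring
    rw [e]
    have h1 := h.mul_le (v (.ofAdd (k * r)) ^ m * w (.ofAdd 1) ^ m *
        (v (.ofAdd (k * r)) ^ m)⁻¹) (w (.ofAdd 1) ^ m)⁻¹ x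
    have h2 := h.mul_le (v (.ofAdd (k * r)) ^ m * w (.ofAdd 1) ^ m) (v (.ofAdd (k * r)) ^ m)⁻¹ x
    have h3 := h.mul_le (v (.ofAdd (k * r)) ^ m) (w (.ofAdd 1) ^ m) x
    have h4 : _ ≤ m * a := h.pow_le (v (.ofAdd (k * r))) x m
    have h5 : _ ≤ m * b := h.pow_le (w (.ofAdd 1)) x m
    rw [h.inv_eq] at h1 h2
    have h6 : m ^ 2 = 2 * (m * a) + 2 * (m * b) + m := by
      rw [pow_two]
      nth_rw 2 [show m = 2 * a + 2 * b + 1 from rfl]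
      ring
    have h7 : 0 < m := Nat.succ_pos _
    omega
  have hsub : ∀ N : Submodule ℤ R, N.FG → ∃ B, ∀ r ∈ N, d x (φ (u (.ofAdd r)) x) ≤ B := by
    intro N hN
    induction N, hN using Submodule.fg_induction with
    | singleton r =>
      obtain ⟨B, hB⟩ := hnat r
      refine ⟨B, fun s hs => ?_⟩
      obtain ⟨k, rfl⟩ := Submodule.mem_span_singleton.1 hs
      rw [ofAdd_zsmul, map_zpow]
      obtain ⟨n, rfl | rfl⟩ := k.eq_nat_or_neg
      · rw [zpow_natCast]; exact hB n
      · rw [zpow_neg, h.inv_eq, zpow_natCast]; exact hB n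
    | sup N₁ N₂ _ _ h₁ h₂ =>
      obtain ⟨B₁, hB₁⟩ := h₁
      obtain ⟨B₂, hB₂⟩ := h₂
      refine ⟨B₁ + B₂, fun s hs => ?_⟩
      obtain ⟨y, hy, z, hz, rfl⟩ := Submodule.mem_sup.1 hs
      rw [ofAdd_add, map_mul]
      exact (h.mul_le _ _ x).trans (Nat.add_le_add (hB₁ y hy) (hB₂ z hz))
  obtain ⟨B, hB⟩ := hsub ⊤ Module.Finite.fg_top
  exact ⟨B, fun r => hB r trivial⟩

section Transvection

open Matrix

variable {R ι : Type*} [CommRing R] [Fintype ι] [DecidableEq ι]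

/-- The elementary matrices at a fixed position, as a homomorphism. -/
def transvectionHom {i j : ι} (hij : i ≠ j) : Multiplicative R →* SpecialLinearGroup ι R where
  toFun r := SpecialLinearGroup.transvection hij r.toAdd
  map_one' := by ext; simp
  map_mul' r s := by
    rw [toAdd_mul, SpecialLinearGroup.transvection_add]

theorem transvection_mul_comm {i j k : ι} (hij : i ≠ j) (hik : i ≠ k) (hkj : k ≠ j) (r s : R) :
    SpecialLinearGroup.transvection hij (r * s) =
      SpecialLinearGroup.transvection hik r * SpecialLinearGroup.transvection hkj s *
      (SpecialLinearGroup.transvection hik r)⁻¹ * (SpecialLinearGroup.transvection hkj s)⁻¹ := by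
  rw [eq_mul_inv_iff_mul_eq, eq_mul_inv_iff_mul_eq]
  apply Subtype.ext
  simp only [Matrix.SpecialLinearGroup.coe_mul, SpecialLinearGroup.transvection_coe]
  simp [mul_add, add_mul, hij.symm, hkj.symm]
  abel

/-- All elementary matrices move a given point by a bounded amount. -/
theorem IsQuasiTreeAction.exists_transvection_le [Module.Finite ℤ R] (hι : 3 ≤ Fintype.card ι)
    {X : Type*} {d : X → X → ℕ} {δ : ℕ} {φ : SpecialLinearGroup ι R →* Equiv.Perm X}
    (h : IsQuasiTreeAction d δ φ) (x : X) :
    ∃ B, ∀ (i j : ι) (hij : i ≠ j) (r : R),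
      d x (φ (SpecialLinearGroup.transvection hij r) x) ≤ B := by
  have key : ∀ p : ι × ι, ∃ B, ∀ (hij : p.1 ≠ p.2) (r : R),
      d x (φ (SpecialLinearGroup.transvection hij r) x) ≤ B := by
    rintro ⟨i, j⟩
    by_cases hij : i = j
    · exact ⟨0, fun h => absurd hij h⟩
    obtain ⟨k, hk⟩ : ∃ k, k ∉ ({i, j} : Finset ι) := by
      by_contra! hk
      have := Finset.card_le_two (a := i) (b := j)
      rw [Finset.eq_univ_of_forall hk, Finset.card_univ] at this
      omega
    simp only [Finset.mem_insert, Finset.mem_singleton, not_or] at hk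
    obtain ⟨B, hB⟩ := h.exists_le_of_commutator x (transvectionHom hij)
      (transvectionHom (Ne.symm hk.1)) (transvectionHom hk.2)
      (fun r s => transvection_mul_comm hij (Ne.symm hk.1) hk.2 r s)
    exact ⟨B, fun _ r => hB r⟩
  choose f hf using key
  obtain ⟨B, hB⟩ := Finite.exists_le f
  exact ⟨B, fun i j hij r => (hf (i, j) hij r).trans (hB _)⟩

end Transvection

section Corner

open Matrix

variable {R : Type*} [CommRing R]

/-- The block matrix with `1` in the upper left and `A` in the lower right corner. -/
def cornerMatrix {k : ℕ} (A : Matrix (Fin k) (Fin k) R) : Matrix (Fin (k + 1)) (Fin (k + 1)) R :=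
  of (Fin.cons (Fin.cons 1 0) fun i => Fin.cons 0 (A i))

section

variable {k : ℕ} (A B : Matrix (Fin k) (Fin k) R) (i j : Fin k)

@[simp] theorem cornerMatrix_zero_zero : cornerMatrix A 0 0 = 1 := rfl

@[simp] theorem cornerMatrix_zero_succ : cornerMatrix A 0 j.succ = 0 := rfl

@[simp] theorem cornerMatrix_succ_zero : cornerMatrix A i.succ 0 = 0 := rfl

@[simp] theorem cornerMatrix_succ_succ : cornerMatrix A i.succ j.succ = A i j := rfl

theorem cornerMatrix_one : cornerMatrix (1 : Matrix (Fin k) (Fin k) R) = 1 := by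
  ext i j
  refine Fin.cases ?_ (fun i => ?_) i <;> refine Fin.cases ?_ (fun j => ?_) j <;>
    simp [one_apply, (Fin.succ_ne_zero _).symm]

theorem cornerMatrix_mul : cornerMatrix (A * B) = cornerMatrix A * cornerMatrix B := by
  ext i j
  refine Fin.cases ?_ (fun i => ?_) i <;> refine Fin.cases ?_ (fun j => ?_) j <;>
    simp [mul_apply, Fin.sum_univ_succ]

theorem det_cornerMatrix : (cornerMatrix A).det = A.det := by
  rw [det_succ_row_zero, Fin.sum_univ_succ]
  have : (cornerMatrix A).submatrix Fin.succ Fin.succ = A := by ext i j; simp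
  simp [Fin.succAbove_zero, this]

end

/-- The embedding of `SL(k, R)` into `SL(k + 1, R)` as the lower right corner. -/
def cornerHom (R : Type*) [CommRing R] (k : ℕ) :
    SpecialLinearGroup (Fin k) R →* SpecialLinearGroup (Fin (k + 1)) R where
  toFun A := ⟨cornerMatrix A.1, by rw [det_cornerMatrix, A.2]⟩
  map_one' := Subtype.ext cornerMatrix_one
  map_mul' A B := Subtype.ext (cornerMatrix_mul A.1 B.1)

theorem cornerHom_two_coe (A : SpecialLinearGroup (Fin 2) R) :
    (cornerHom R 2 A : Matrix (Fin 3) (Fin 3) R) =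
      !![1, 0, 0; 0, A 0 0, A 0 1; 0, A 1 0, A 1 1] := by
  ext i j
  fin_cases i <;> fin_cases j <;> rfl

/-- The elementary matrix of size three with entry `t` at position `(i, j)`. -/
def elemThree (i j : Fin 3) (t : R) (hij : i ≠ j := by decide) : SpecialLinearGroup (Fin 3) R :=
  SpecialLinearGroup.transvection hij t

theorem elemThree_coe (i j : Fin 3) (t : R) (hij : i ≠ j) :
    (elemThree i j t hij : Matrix (Fin 3) (Fin 3) R) =
      of fun k l => (if k = l then 1 else 0) + if i = k ∧ j = l then t else 0 := by
  ext k l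
  simp [elemThree, SpecialLinearGroup.transvection_coe, one_apply, single]

theorem elemThree_mul_cornerHom (A : SpecialLinearGroup (Fin 2) R) (t : R) :
    elemThree 0 1 t * cornerHom R 2 A =
      cornerHom R 2 A * (elemThree 0 1 (t * A 0 0) * elemThree 0 2 (t * A 0 1)) ∧
    elemThree 0 2 t * cornerHom R 2 A =
      cornerHom R 2 A * (elemThree 0 1 (t * A 1 0) * elemThree 0 2 (t * A 1 1)) ∧
    elemThree 1 0 t * cornerHom R 2 A =
      cornerHom R 2 A * (elemThree 1 0 (t * A 1 1) * elemThree 2 0 (-(t * A 1 0))) ∧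
    elemThree 2 0 t * cornerHom R 2 A =
      cornerHom R 2 A * (elemThree 1 0 (-(t * A 0 1)) * elemThree 2 0 (t * A 0 0)) := by
  have hA := det_two_eq A
  refine ⟨?_, ?_, ?_, ?_⟩ <;> ext i j <;> fin_cases i <;> fin_cases j <;>
    simp [Matrix.SpecialLinearGroup.coe_mul, elemThree_coe, cornerHom_two_coe, mul_apply,
      Fin.sum_univ_three] <;>
        first | ring1 | linear_combination t * hA | linear_combination - t * hA

end Corner

section MennickeThree

open Matrix

variable {R : Type*} [CommRing R]

/-- A signed permutation matrix. -/
def weylThree : SpecialLinearGroup (Fin 3) R :=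
  ⟨!![0, 0, 1; 0, 1, 0; -1, 0, 0], by simp [det_fin_three]⟩

/-- A cyclic permutation matrix. -/
def cycleThree : SpecialLinearGroup (Fin 3) R :=
  ⟨!![0, 0, 1; 1, 0, 0; 0, 1, 0], by simp [det_fin_three]⟩

theorem weylThree_coe : ((weylThree : SpecialLinearGroup (Fin 3) R) : Matrix (Fin 3) (Fin 3) R) =
    !![0, 0, 1; 0, 1, 0; -1, 0, 0] := rfl

theorem cycleThree_coe : ((cycleThree : SpecialLinearGroup (Fin 3) R) : Matrix (Fin 3) (Fin 3) R) =
    !![0, 0, 1; 1, 0, 0; 0, 1, 0] := rfl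

theorem weylThree_eq :
    (weylThree : SpecialLinearGroup (Fin 3) R) =
      elemThree 0 2 1 * elemThree 2 0 (-1) * elemThree 0 2 1 := by
  ext i j; fin_cases i <;> fin_cases j <;>
    simp [Matrix.SpecialLinearGroup.coe_mul, elemThree_coe, weylThree_coe, mul_apply,
      Fin.sum_univ_three]

theorem cycleThree_eq :
    (cycleThree : SpecialLinearGroup (Fin 3) R) =
      elemThree 2 1 1 * elemThree 1 2 (-1) * elemThree 2 1 1 * weylThree := by
  ext i j; fin_cases i <;> fin_cases j <;>
    simp [Matrix.SpecialLinearGroup.coe_mul, elemThree_coe, weylThree_coe, cycleThree_coe,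
      mul_apply,
      Fin.sum_univ_three]

/-- The embedding of `SL(2, R)` into `SL(3, R)` at the positions `2` and `0`. -/
def cornerTwoZero (M : SpecialLinearGroup (Fin 2) R) : SpecialLinearGroup (Fin 3) R :=
  ⟨!![M 1 1, 0, M 1 0; 0, 1, 0; M 0 1, 0, M 0 0], by
    simp [det_fin_three]; linear_combination det_two_eq M⟩

/-- The embedding of `SL(2, R)` into `SL(3, R)` at the positions `1` and `0`. -/
def cornerOneZero (M : SpecialLinearGroup (Fin 2) R) : SpecialLinearGroup (Fin 3) R :=
  ⟨!![M 1 1, M 1 0, 0; M 0 1, M 0 0, 0; 0, 0, 1], by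
    simp [det_fin_three]; linear_combination det_two_eq M⟩

theorem cornerTwoZero_coe (M : SpecialLinearGroup (Fin 2) R) :
    (cornerTwoZero M : Matrix (Fin 3) (Fin 3) R) =
      !![M 1 1, 0, M 1 0; 0, 1, 0; M 0 1, 0, M 0 0] := rfl

theorem cornerOneZero_coe (M : SpecialLinearGroup (Fin 2) R) :
    (cornerOneZero M : Matrix (Fin 3) (Fin 3) R) =
      !![M 1 1, M 1 0, 0; M 0 1, M 0 0, 0; 0, 0, 1] := rfl

theorem cornerOneZero_mul (M : SpecialLinearGroup (Fin 2) R) :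
    cornerOneZero M * weylThree = weylThree * cornerHom R 2 M := by
  ext i j; fin_cases i <;> fin_cases j <;>
    simp [Matrix.SpecialLinearGroup.coe_mul, cornerOneZero_coe, weylThree_coe, cornerHom_two_coe,
      mul_apply, Fin.sum_univ_three]

theorem cornerTwoZero_mul (M : SpecialLinearGroup (Fin 2) R) :
    cornerTwoZero M * cycleThree = cycleThree * cornerHom R 2 M := by
  ext i j; fin_cases i <;> fin_cases j <;>
    simp [Matrix.SpecialLinearGroup.coe_mul, cornerTwoZero_coe, cycleThree_coe, cornerHom_two_coe,
      mul_apply, Fin.sum_univ_three]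

/-- The matrix with first row `(a, b * c)` witnessing multiplicativity of Mennicke symbols. -/
def mennickeProd (L M : SpecialLinearGroup (Fin 2) R) (h : L 0 0 = M 0 0) :
    SpecialLinearGroup (Fin 2) R :=
  ⟨!![M 0 0, L 0 1 * M 0 1; -(M 1 0 * L 1 0), M 1 1 - M 1 0 * L 1 1 * M 0 1], by
    simp only [det_fin_two_of]
    linear_combination det_two_eq M - M 1 0 * M 0 1 * det_two_eq L + M 1 0 * M 0 1 * L 1 1 * h⟩

theorem mennickeProd_coe (L M : SpecialLinearGroup (Fin 2) R) (h : L 0 0 = M 0 0) :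
    (mennickeProd L M h : Matrix (Fin 2) (Fin 2) R) =
      !![M 0 0, L 0 1 * M 0 1; -(M 1 0 * L 1 0), M 1 1 - M 1 0 * L 1 1 * M 0 1] := rfl

theorem cornerOneZero_mennickeProd (L M : SpecialLinearGroup (Fin 2) R) (h : L 0 0 = M 0 0) :
    cornerHom R 2 L * (elemThree 0 1 (-(M 1 0 * L 1 0)) * elemThree 0 2 (-(M 1 0 * L 1 1)) *
      cornerTwoZero M * (elemThree 1 2 (-L 0 1) * elemThree 2 1 (-L 1 0) *
        elemThree 2 0 (-(L 1 1 * M 0 1)))) = cornerOneZero (mennickeProd L M h) := by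
  have hL := det_two_eq L
  rw [h] at hL
  ext i j
  simp only [Matrix.SpecialLinearGroup.coe_mul, cornerOneZero_coe, cornerTwoZero_coe,
    elemThree_coe, cornerHom_two_coe, mennickeProd_coe, h]
  fin_cases i <;> fin_cases j <;> simp [mul_apply, Fin.sum_univ_three] <;> try ring1
  · linear_combination (M 1 0 * L 1 1 * M 0 1) * hL
  · linear_combination (M 1 0 * L 1 0) * hL
  · linear_combination (-M 1 0) * hL
  · linear_combination (-(L 1 1 * M 0 1)) * hL
  · linear_combination (-L 1 0) * hL
  · linear_combination hL

variable {X : Type*} {d : X → X → ℕ} {δ : ℕ} {φ : SpecialLinearGroup (Fin 3) R →* Equiv.Perm X}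

/-- If all elementary matrices move `x` by at most `r`, then they move all points in the orbit of
`x` under the corner subgroup by at most `8 * r`. -/
theorem IsQuasiTreeAction.elemThree_cornerHom_le (h : IsQuasiTreeAction d δ φ) (x : X) (r : ℕ)
    (hr : ∀ i j t hij, d x (φ (elemThree i j t hij) x) ≤ r) (A : SpecialLinearGroup (Fin 2) R)
    (i j : Fin 3) (t : R) (hij : i ≠ j) :
    d (φ (cornerHom R 2 A) x) (φ (elemThree i j t hij) (φ (cornerHom R 2 A) x)) ≤ 8 * r := by
  set y := φ (cornerHom R 2 A) x
  have hE := elemThree_mul_cornerHom A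
  have aux : ∀ e f g : SpecialLinearGroup (Fin 3) R, e * cornerHom R 2 A =
      cornerHom R 2 A * (f * g) → d x (φ f x) ≤ r → d x (φ g x) ≤ r → d y (φ e y) ≤ 2 * r := by
    intro e f g he hf hg
    have h1 : d y (φ e y) = d x (φ (f * g) x) := by
      have := h.mul_mul_eq (cornerHom R 2 A) 1 (f * g) x
      rwa [mul_one, ← he, map_mul, Equiv.Perm.mul_apply, map_one, Equiv.Perm.one_apply] at this
    have h2 := h.mul_le f g x
    omega
  have h01 : ∀ t, d y (φ (elemThree 0 1 t) y) ≤ 2 * r := fun t =>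
    aux _ _ _ (hE t).1 (hr _ _ _ _) (hr _ _ _ _)
  have h02 : ∀ t, d y (φ (elemThree 0 2 t) y) ≤ 2 * r := fun t =>
    aux _ _ _ (hE t).2.1 (hr _ _ _ _) (hr _ _ _ _)
  have h10 : ∀ t, d y (φ (elemThree 1 0 t) y) ≤ 2 * r := fun t =>
    aux _ _ _ (hE t).2.2.1 (hr _ _ _ _) (hr _ _ _ _)
  have h20 : ∀ t, d y (φ (elemThree 2 0 t) y) ≤ 2 * r := fun t =>
    aux _ _ _ (hE t).2.2.2 (hr _ _ _ _) (hr _ _ _ _)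
  have comm : ∀ e f g : SpecialLinearGroup (Fin 3) R, e = f * g * f⁻¹ * g⁻¹ →
      d y (φ f y) ≤ 2 * r → d y (φ g y) ≤ 2 * r → d y (φ e y) ≤ 8 * r := by
    rintro e f g rfl hf hg
    have h1 := h.mul_le (f * g * f⁻¹) g⁻¹ y
    have h2 := h.mul_le (f * g) f⁻¹ y
    have h3 := h.mul_le f g y
    rw [h.inv_eq] at h1 h2
    omega
  have hle : 2 * r ≤ 8 * r := by omega
  have h12 : ∀ t, d y (φ (elemThree 1 2 t) y) ≤ 8 * r := fun t => by
    refine comm _ _ _ ?_ (h10 t) (h02 1)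
    simpa [elemThree] using transvection_mul_comm (show (1 : Fin 3) ≠ 2 by decide)
      (show (1 : Fin 3) ≠ 0 by decide) (show (0 : Fin 3) ≠ 2 by decide) t (1 : R)
  have h21 : ∀ t, d y (φ (elemThree 2 1 t) y) ≤ 8 * r := fun t => by
    refine comm _ _ _ ?_ (h20 t) (h01 1)
    simpa [elemThree] using transvection_mul_comm (show (2 : Fin 3) ≠ 1 by decide)
      (show (2 : Fin 3) ≠ 0 by decide) (show (0 : Fin 3) ≠ 1 by decide) t (1 : R)
  fin_cases i <;> fin_cases j <;> first
    | exact absurd rfl hij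
    | exact (h01 t).trans hle
    | exact (h02 t).trans hle
    | exact (h10 t).trans hle
    | exact (h20 t).trans hle
    | exact h12 t
    | exact h21 t

theorem elemThree_one_two (t : R) : elemThree 1 2 t = cornerHom R 2 (upperTwo t) := by
  ext i j; fin_cases i <;> fin_cases j <;>
    simp [elemThree_coe, cornerHom_two_coe, upperTwo_coe]

theorem elemThree_two_one (t : R) : elemThree 2 1 t = cornerHom R 2 (lowerTwo t) := by
  ext i j; fin_cases i <;> fin_cases j <;>
    simp [elemThree_coe, cornerHom_two_coe, lowerTwo_coe]

theorem IsQuasiTreeAction.dist_conj_le {G H : Type*} [Group G] [Group H] {X : Type*}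
    {d : X → X → ℕ} {δ : ℕ} {φ : G →* Equiv.Perm X} (h : IsQuasiTreeAction d δ φ) (x : X)
    (ρ : ℕ) (j : H →* G) (σ : G) (hσ : ∀ A, d (φ (j A) x) (φ σ (φ (j A) x)) ≤ ρ) (A : H) (g : G)
    (hg : g * σ = σ * j A) : d (φ (j A) x) (φ g x) ≤ 2 * ρ := by
  have h1 := hσ A
  have h2 := hσ 1
  have h3 := h.mul_mul_eq g σ 1 x
  have h4 := h.triangle (φ (j A) x) (φ σ (φ (j A) x)) (φ g x)
  rw [map_one, map_one, Equiv.Perm.one_apply] at h2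
  rw [hg, mul_one, map_mul, Equiv.Perm.mul_apply, map_one, Equiv.Perm.one_apply,
    h.symm (φ σ x)] at h3
  omega

/-- Boundedness of the corner subgroup `SL(2, R)` in isometric actions of `SL(3, R)` on
quasi-trees. -/
theorem IsQuasiTreeAction.exists_cornerHom_two_le [IsDomain R] [Module.Finite ℤ R]
    (hR : ∀ a : R, a ≠ 0 → Finite (R ⧸ Ideal.span {a}))
    (F : Set (SpecialLinearGroup (Fin 2) R)) (hF : F.Finite)
    (hgen : Subgroup.closure (F ∪ Set.range upperTwo ∪ Set.range lowerTwo) = ⊤)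
    (h : IsQuasiTreeAction d δ φ) (x : X) :
    ∃ B, ∀ A, d x (φ (cornerHom R 2 A) x) ≤ B := by
  obtain ⟨r, hr⟩ := h.exists_transvection_le (by simp) x
  have hr' : ∀ A i j t hij, d (φ (cornerHom R 2 A) x)
      (φ (elemThree i j t hij) (φ (cornerHom R 2 A) x)) ≤ 8 * r := fun A i j t hij =>
    h.elemThree_cornerHom_le x r (fun i j t hij => hr i j hij t) A i j t hij
  have hx : ∀ i j t hij, d x (φ (elemThree i j t hij) x) ≤ r := fun i j t hij => hr i j hij t
  have hmul : ∀ (f g : SpecialLinearGroup (Fin 3) R) (m n : ℕ),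
      (∀ A, d (φ (cornerHom R 2 A) x) (φ f (φ (cornerHom R 2 A) x)) ≤ m) →
      (∀ A, d (φ (cornerHom R 2 A) x) (φ g (φ (cornerHom R 2 A) x)) ≤ n) →
      ∀ A, d (φ (cornerHom R 2 A) x) (φ (f * g) (φ (cornerHom R 2 A) x)) ≤ m + n :=
    fun f g m n hf hg A => (h.mul_le f g _).trans (Nat.add_le_add (hf A) (hg A))
  have hweyl : ∀ A, d (φ (cornerHom R 2 A) x) (φ weylThree (φ (cornerHom R 2 A) x)) ≤
      8 * r + 8 * r + 8 * r := by
    rw [weylThree_eq]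
    exact hmul _ _ _ _ (hmul _ _ _ _ (fun A => hr' A _ _ _ _) fun A => hr' A _ _ _ _)
      fun A => hr' A _ _ _ _
  have hcycle : ∀ A, d (φ (cornerHom R 2 A) x) (φ cycleThree (φ (cornerHom R 2 A) x)) ≤
      8 * r + 8 * r + 8 * r + (8 * r + 8 * r + 8 * r) := by
    rw [cycleThree_eq]
    exact hmul _ _ _ _ (hmul _ _ _ _ (hmul _ _ _ _ (fun A => hr' A _ _ _ _)
      fun A => hr' A _ _ _ _) fun A => hr' A _ _ _ _) hweyl
  refine (h.comp (cornerHom R 2)).exists_le_of_mennicke hR F hF hgen x (500 * r) ?_ ?_ ?_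
  · intro t A
    rw [map_mul, Equiv.Perm.mul_apply, MonoidHom.comp_apply, MonoidHom.comp_apply,
      ← elemThree_one_two]
    exact (hr' A _ _ _ _).trans (by omega)
  · intro t A
    rw [map_mul, Equiv.Perm.mul_apply, MonoidHom.comp_apply, MonoidHom.comp_apply,
      ← elemThree_two_one]
    exact (hr' A _ _ _ _).trans (by omega)
  · intro L M N hLM hMN hN
    simp only [MonoidHom.comp_apply]
    obtain ⟨t, rfl⟩ := exists_eq_lowerTwo_mul (mennickeProd L M hLM) N (by
      rw [← hMN, mennickeProd_coe]; simp) (by rw [hN, mennickeProd_coe]; simp)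
    set P := mennickeProd L M hLM
    have h1 := h.dist_conj_le x _ (cornerHom R 2) _ hcycle M _ (cornerTwoZero_mul M)
    have h2 := h.dist_conj_le x _ (cornerHom R 2) _ hweyl P _ (cornerOneZero_mul P)
    have h3 : _ = cornerOneZero P := cornerOneZero_mennickeProd L M hLM
    set f := elemThree 0 1 (-(M 1 0 * L 1 0)) * elemThree 0 2 (-(M 1 0 * L 1 1))
    set e := elemThree 1 2 (-L 0 1) * elemThree 2 1 (-L 1 0) * elemThree 2 0 (-(L 1 1 * M 0 1))
      with he
    set g := cornerTwoZero M
    have hf : d (φ (cornerHom R 2 M) x) (φ f (φ (cornerHom R 2 M) x)) ≤ 8 * r + 8 * r :=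
      hmul _ _ _ _ (fun A => hr' A _ _ _ _) (fun A => hr' A _ _ _ _) M
    have he' : d x (φ e x) ≤ 3 * r := by
      have h4 := h.mul_le (elemThree 1 2 (-L 0 1) * elemThree 2 1 (-L 1 0))
        (elemThree 2 0 (-(L 1 1 * M 0 1))) x
      have h5 := h.mul_le (elemThree 1 2 (-L 0 1)) (elemThree 2 1 (-L 1 0)) x
      have h6 := hx 1 2 (-L 0 1) (by decide)
      have h7 := hx 2 1 (-L 1 0) (by decide)
      have h8 := hx 2 0 (-(L 1 1 * M 0 1)) (by decide)
      rw [he]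
      omega
    have h4 := h.mul_mul_eq (cornerHom R 2 L) (cornerHom R 2 M) (f * g * e) x
    have h5 := h.mul_mul_eq (f * g) 1 e x
    have h6 := h.isom f (φ (cornerHom R 2 M) x) (φ g x)
    have h7 := h.triangle (φ (cornerHom R 2 M) x) (φ f (φ (cornerHom R 2 M) x)) (φ (f * g) x)
    have h8 := h.triangle (φ (cornerHom R 2 M) x) (φ (f * g) x) (φ (f * g * e) x)
    rw [h3, ← map_mul] at h4
    rw [mul_one, map_one, Equiv.Perm.one_apply] at h5
    rw [← Equiv.Perm.mul_apply (φ f) (φ g), ← map_mul φ f g] at h6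
    have h9 := hr' P 2 1 t (by decide)
    rw [elemThree_two_one, ← Equiv.Perm.mul_apply, ← map_mul, ← map_mul] at h9
    have h10 := h.triangle (φ (cornerHom R 2 (L * M)) x) (φ (cornerOneZero P) x)
      (φ (cornerHom R 2 P) x)
    have h11 := h.triangle (φ (cornerHom R 2 (L * M)) x) (φ (cornerHom R 2 P) x)
      (φ (cornerHom R 2 (lowerTwo t * P)) x)
    have h12 := h.symm (φ (cornerHom R 2 P) x) (φ (cornerOneZero P) x)
    omega

end MennickeThree

section Reduction

open Matrix

variable {R ι : Type*} [CommRing R] [Fintype ι] [DecidableEq ι]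
  {X : Type*} {d : X → X → ℕ} {δ : ℕ}

theorem IsQuasiTreeAction.exists_rowOp {φ : SpecialLinearGroup ι R →* Equiv.Perm X}
    (h : IsQuasiTreeAction d δ φ) (x : X) (r : ℕ)
    (hr : ∀ (i j : ι) (hij : i ≠ j) (t : R),
      d x (φ (SpecialLinearGroup.transvection hij t) x) ≤ r) (q : ι) (t : ι → R) (ht : t q = 0) :
    ∃ g : SpecialLinearGroup ι R, g.1 = 1 + vecMulVec (Pi.single q 1) t ∧
      d x (φ g x) ≤ Fintype.card ι * r := by
  have key : ∀ s : Finset ι, q ∉ s → ∃ g : SpecialLinearGroup ι R,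
      g.1 = 1 + ∑ j ∈ s, single q j (t j) ∧ d x (φ g x) ≤ s.card * r := by
    intro s
    induction s using Finset.induction_on with
    | empty => exact fun _ => ⟨1, by simp, by rw [h.one_eq]; exact Nat.zero_le _⟩
    | insert a s ha ih =>
      intro hq
      rw [Finset.mem_insert, not_or] at hq
      obtain ⟨g, hg, hgr⟩ := ih hq.2
      refine ⟨SpecialLinearGroup.transvection hq.1 (t a) * g, ?_, ?_⟩
      · have : single q a (t a) * ∑ j ∈ s, single q j (t j) = 0 := by
          rw [Finset.mul_sum]
          exact Finset.sum_eq_zero fun j _ => single_mul_single_of_ne _ _ _ _ (Ne.symm hq.1) _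
        rw [Matrix.SpecialLinearGroup.coe_mul, hg, SpecialLinearGroup.transvection_coe,
          add_mul, one_mul, mul_add, mul_one, this, Finset.sum_insert ha]
        abel
      · have h1 := h.mul_le (SpecialLinearGroup.transvection hq.1 (t a)) g x
        have h2 := hr q a hq.1 (t a)
        rw [Finset.card_insert_of_notMem ha, Nat.succ_mul]
        omega
  obtain ⟨g, hg, hgr⟩ := key (Finset.univ.erase q) (by simp)
  refine ⟨g, ?_, hgr.trans (Nat.mul_le_mul_right _ (Finset.card_le_univ _))⟩
  rw [hg]
  congr 1
  ext i j
  rw [Matrix.sum_apply, vecMulVec_apply]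
  simp only [single_apply, Pi.single_apply, ite_mul, one_mul, zero_mul]
  by_cases hi : i = q <;> by_cases hj : j = q
  · simp [hi, hj, ht]
  · simp [hi, hj]
  · simp [hi, Ne.symm hi]
  · simp [hi, Ne.symm hi]

theorem IsQuasiTreeAction.exists_colOp {φ : SpecialLinearGroup ι R →* Equiv.Perm X}
    (h : IsQuasiTreeAction d δ φ) (x : X) (r : ℕ)
    (hr : ∀ (i j : ι) (hij : i ≠ j) (t : R),
      d x (φ (SpecialLinearGroup.transvection hij t) x) ≤ r) (q : ι) (t : ι → R) (ht : t q = 0) :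
    ∃ g : SpecialLinearGroup ι R, g.1 = 1 + vecMulVec t (Pi.single q 1) ∧
      d x (φ g x) ≤ Fintype.card ι * r := by
  have key : ∀ s : Finset ι, q ∉ s → ∃ g : SpecialLinearGroup ι R,
      g.1 = 1 + ∑ j ∈ s, single j q (t j) ∧ d x (φ g x) ≤ s.card * r := by
    intro s
    induction s using Finset.induction_on with
    | empty => exact fun _ => ⟨1, by simp, by rw [h.one_eq]; exact Nat.zero_le _⟩
    | insert a s ha ih =>
      intro hq
      rw [Finset.mem_insert, not_or] at hq
      obtain ⟨g, hg, hgr⟩ := ih hq.2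
      refine ⟨SpecialLinearGroup.transvection (Ne.symm hq.1) (t a) * g, ?_, ?_⟩
      · have : single a q (t a) * ∑ j ∈ s, single j q (t j) = 0 := by
          rw [Finset.mul_sum]
          exact Finset.sum_eq_zero fun j hj => single_mul_single_of_ne _ _ _ _
            (fun e : q = j => hq.2 (e ▸ hj)) _
        rw [Matrix.SpecialLinearGroup.coe_mul, hg, SpecialLinearGroup.transvection_coe,
          add_mul, one_mul, mul_add, mul_one, this, Finset.sum_insert ha]
        abel
      · have h1 := h.mul_le (SpecialLinearGroup.transvection (Ne.symm hq.1) (t a)) g x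
        have h2 := hr a q (Ne.symm hq.1) (t a)
        rw [Finset.card_insert_of_notMem ha, Nat.succ_mul]
        omega
  obtain ⟨g, hg, hgr⟩ := key (Finset.univ.erase q) (by simp)
  refine ⟨g, ?_, hgr.trans (Nat.mul_le_mul_right _ (Finset.card_le_univ _))⟩
  rw [hg]
  congr 1
  ext i j
  rw [Matrix.sum_apply, vecMulVec_apply]
  simp only [single_apply, Pi.single_apply, mul_ite, mul_one, mul_zero]
  by_cases hi : i = q <;> by_cases hj : j = q
  · simp [hi, hj, ht]
  · simp [hj, Ne.symm hj]
  · simp [hi, hj]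
  · simp [hj, Ne.symm hj]

/-- Reduction of boundedness from `SL(k + 1, R)` to the corner subgroup `SL(k, R)`. -/
theorem IsQuasiTreeAction.exists_le_of_cornerHom [IsDomain R]
    (hR : ∀ a : R, a ≠ 0 → Finite (R ⧸ Ideal.span {a})) {m : ℕ}
    {φ : SpecialLinearGroup (Fin (m + 3)) R →* Equiv.Perm X}
    (h : IsQuasiTreeAction d δ φ) (x : X) (r : ℕ)
    (hr : ∀ (i j : Fin (m + 3)) (hij : i ≠ j) (t : R),
      d x (φ (SpecialLinearGroup.transvection hij t) x) ≤ r)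
    (B : ℕ) (hB : ∀ A, d x (φ (cornerHom R (m + 2) A) x) ≤ B) :
    ∃ B, ∀ g, d x (φ g x) ≤ B := by
  set K := Fintype.card (Fin (m + 3)) * r
  have row := h.exists_rowOp x r hr
  have col := h.exists_colOp x r hr
  have hrow : ∀ (q : Fin (m + 3)) (t : Fin (m + 3) → R) (g M : SpecialLinearGroup (Fin (m + 3)) R),
      g.1 = 1 + vecMulVec (Pi.single q 1) t → ∀ i, (g * M).1 i 0 =
        M.1 i 0 + if i = q then ∑ j, t j * M.1 j 0 else 0 := by
    intro q t g M hg i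
    rw [Matrix.SpecialLinearGroup.coe_mul, hg, add_mul, one_mul, Matrix.add_apply, mul_apply]
    simp [vecMulVec_apply, Pi.single_apply]
  have left : ∀ (e g : SpecialLinearGroup (Fin (m + 3)) R) (C D : ℕ), d x (φ e x) ≤ C →
      d x (φ (e * g) x) ≤ D → d x (φ g x) ≤ C + D := by
    intro e g C D he hg
    have h1 := h.mul_le e⁻¹ (e * g) x
    rw [inv_mul_cancel_left, h.inv_eq] at h1
    omega
  have right : ∀ (e g : SpecialLinearGroup (Fin (m + 3)) R) (C D : ℕ), d x (φ e x) ≤ C →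
      d x (φ (g * e) x) ≤ D → d x (φ g x) ≤ C + D := by
    intro e g C D he hg
    have h1 := h.mul_le (g * e) e⁻¹ x
    rw [mul_inv_cancel_right, h.inv_eq] at h1
    omega
  have s1 : ∀ g : SpecialLinearGroup (Fin (m + 3)) R, g.1 0 0 = 1 → (∀ i ≠ 0, g.1 i 0 = 0) →
      (∀ i ≠ 0, g.1 0 i = 0) → d x (φ g x) ≤ B := by
    intro g h0 hc hr
    have e : g.1 = cornerMatrix (g.1.submatrix Fin.succ Fin.succ) := by
      ext i j
      refine Fin.cases ?_ (fun i => ?_) i <;> refine Fin.cases ?_ (fun j => ?_) j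
      · exact h0
      · exact hr _ (Fin.succ_ne_zero _)
      · exact hc _ (Fin.succ_ne_zero _)
      · rfl
    have hdet : (g.1.submatrix Fin.succ Fin.succ).det = 1 := by
      rw [← det_cornerMatrix, ← e, g.2]
    have : g = cornerHom R (m + 2) ⟨_, hdet⟩ := Subtype.ext e
    rw [this]
    exact hB _
  have s2 : ∀ g : SpecialLinearGroup (Fin (m + 3)) R, g.1 0 0 = 1 → (∀ i ≠ 0, g.1 i 0 = 0) →
      d x (φ g x) ≤ K + B := by
    intro g h0 hc
    obtain ⟨e, he, hle⟩ := row 0 (fun j => if j = 0 then 0 else -g.1 0 j) (by simp)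
    have hge : ∀ i l, (g * e).1 i l = g.1 i l + g.1 i 0 * if l = 0 then 0 else -g.1 0 l := by
      intro i l
      rw [Matrix.SpecialLinearGroup.coe_mul, he, mul_add, mul_one, Matrix.add_apply, mul_apply]
      simp [vecMulVec_apply, Pi.single_apply]
    refine right e g K B hle (s1 _ ?_ ?_ ?_)
    · simp [hge, h0]
    · intro i hi; simp [hge, hc i hi]
    · intro i hi; simp [hge, hi, h0]
  have s3 : ∀ g : SpecialLinearGroup (Fin (m + 3)) R, g.1 0 0 = 1 →
      d x (φ g x) ≤ K + (K + B) := by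
    intro g h0
    obtain ⟨e, he, hle⟩ := col 0 (fun j => if j = 0 then 0 else -g.1 j 0) (by simp)
    have hge : ∀ i l, (e * g).1 i l = g.1 i l + (if i = 0 then 0 else -g.1 i 0) * g.1 0 l := by
      intro i l
      rw [Matrix.SpecialLinearGroup.coe_mul, he, add_mul, one_mul, Matrix.add_apply, mul_apply]
      simp [vecMulVec_apply, Pi.single_apply]
    refine left e g K _ hle (s2 _ ?_ ?_)
    · simp [hge, h0]
    · intro i hi; simp [hge, hi, h0]
  have h02 : (0 : Fin (m + 3)) ≠ 2 := by
    rw [Ne, Fin.ext_iff, Fin.val_zero, Fin.val_two]; omega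
  have h12 : (1 : Fin (m + 3)) ≠ 2 := by
    rw [Ne, Fin.ext_iff, Fin.val_one, Fin.val_two]; omega
  have s4 : ∀ g : SpecialLinearGroup (Fin (m + 3)) R, IsCoprime (g.1 1 0) (g.1 2 0) →
      d x (φ g x) ≤ K + (K + (K + B)) := by
    rintro g ⟨a, b, hab⟩
    obtain ⟨e, he, hle⟩ := row 0 (Pi.single 1 ((1 - g.1 0 0) * a) +
      Pi.single 2 ((1 - g.1 0 0) * b)) (by simp [h02])
    refine left e g K _ hle (s3 _ ?_)
    rw [hrow 0 _ e g he]
    simp only [if_true, Pi.add_apply, add_mul, Finset.sum_add_distrib, Pi.single_apply, ite_mul,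
      zero_mul, Finset.sum_ite_eq', Finset.mem_univ]
    linear_combination (1 - g.1 0 0) * hab
  have s5 : ∀ g : SpecialLinearGroup (Fin (m + 3)) R, g.1 1 0 ≠ 0 →
      d x (φ g x) ≤ K + (K + (K + (K + B))) := by
    intro g hg
    have := hR _ hg
    have hinv : ∑ j, g⁻¹.1 0 j * g.1 j 0 = 1 := by
      rw [← mul_apply, ← Matrix.SpecialLinearGroup.coe_mul, inv_mul_cancel]
      simp
    set u : Fin (m + 3) → R := fun j => if j = 1 then 0 else if j = 2 then 0 else g⁻¹.1 0 j
    have hu : g⁻¹.1 0 1 * g.1 1 0 + g⁻¹.1 0 2 * g.1 2 0 + 1 * ∑ j, u j * g.1 j 0 = 1 := by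
      refine Eq.trans ?_ hinv
      have : ∀ j, g⁻¹.1 0 j * g.1 j 0 = (if j = 1 then g⁻¹.1 0 1 * g.1 1 0 else 0) +
          (if j = 2 then g⁻¹.1 0 2 * g.1 2 0 else 0) + u j * g.1 j 0 := by
        intro j
        by_cases h1 : j = 1
        · simp [h1, u, h12]
        · by_cases h2 : j = 2
          · simp [h2, u, h12.symm]
          · simp [h1, h2, u]
      rw [Finset.sum_congr rfl fun j _ => this j]
      simp [Finset.sum_add_distrib]
    obtain ⟨t, ht⟩ := exists_isCoprime_add_mul _ _ _ ⟨_, _, _, hu⟩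
    obtain ⟨e, he, hle⟩ := row 2 (fun j => t * u j) (by simp [u])
    refine left e g K _ hle (s4 _ ?_)
    rw [hrow 2 _ e g he, hrow 2 _ e g he, if_neg h12, if_pos rfl, add_zero]
    simpa only [mul_assoc, ← Finset.mul_sum] using ht
  refine ⟨K + (K + (K + (K + (K + B)))), fun g => ?_⟩
  by_cases hg : g.1 1 0 = 0
  · obtain ⟨j, hj⟩ : ∃ j, g.1 j 0 ≠ 0 := by
      by_contra! hj
      have := g.2
      rw [det_eq_zero_of_column_eq_zero 0 hj] at this
      exact zero_ne_one this
    have hj1 : j ≠ 1 := fun e => hj (e ▸ hg)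
    obtain ⟨e, he, hle⟩ := row 1 (Pi.single j 1) (by simp [hj1.symm])
    refine left e g K _ hle (s5 _ ?_)
    rw [hrow 1 _ e g he]
    simpa [hg, Pi.single_apply] using hj
  · exact (s5 g hg).trans (Nat.le_add_left _ _)

/-- Boundedness of isometric actions of `SL(n, R)`, `n ≥ 3`, on quasi-trees. -/
theorem IsQuasiTreeAction.exists_le_of_closure [IsDomain R] [Module.Finite ℤ R]
    (hR : ∀ a : R, a ≠ 0 → Finite (R ⧸ Ideal.span {a}))
    (F : Set (SpecialLinearGroup (Fin 2) R)) (hF : F.Finite)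
    (hgen : Subgroup.closure (F ∪ Set.range upperTwo ∪ Set.range lowerTwo) = ⊤) (m : ℕ)
    {φ : SpecialLinearGroup (Fin (m + 3)) R →* Equiv.Perm X}
    (h : IsQuasiTreeAction d δ φ) (x : X) : ∃ B, ∀ g, d x (φ g x) ≤ B := by
  obtain ⟨B, hB⟩ : ∃ B, ∀ A, d x (φ (cornerHom R (m + 2) A) x) ≤ B := by
    induction m with
    | zero => exact h.exists_cornerHom_two_le hR F hF hgen x
    | succ m ih =>
      have h' := h.comp (cornerHom R (m + 3))
      obtain ⟨r', hr'⟩ := h'.exists_transvection_le (by simp) x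
      obtain ⟨B, hB⟩ := ih h'
      exact h'.exists_le_of_cornerHom hR x r' hr' B hB
  obtain ⟨r, hr⟩ := h.exists_transvection_le (by simp) x
  exact h.exists_le_of_cornerHom hR x r hr B hB

end Reduction

section Approximation

/-- Absolute value of the norm down to `ℤ`. -/
noncomputable def intNorm {R : Type*} [CommRing R] (a : R) : ℕ := (Algebra.norm ℤ a).natAbs

theorem intNorm_mul {R : Type*} [CommRing R] (a b : R) :
    intNorm (a * b) = intNorm a * intNorm b := by
  simp [intNorm, Int.natAbs_mul]

theorem intNorm_neg {R : Type*} [CommRing R] (a : R) : intNorm (-a) = intNorm a := by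
  rw [← neg_one_mul, intNorm_mul, (show intNorm (-1 : R) = 1 from ?_), one_mul]
  have : intNorm (-1 : R) * intNorm (-1 : R) = 1 := by
    rw [← intNorm_mul]; simp [intNorm]
  exact Nat.eq_one_of_mul_eq_one_left this

variable {R : Type*} [CommRing R] [IsDedekindDomain R]

theorem exists_intNorm_le {ι : Type*} [Fintype ι] (bS : Module.Basis ι ℤ R) :
    ∃ C : ℕ, 1 ≤ C ∧ ∀ (a : R) (y : ℕ), (∀ k, |bS.repr a k| ≤ y) →
      intNorm a ≤ C * y ^ Fintype.card ι := by
  classical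
  have hpos := ClassGroup.normBound_pos AbsoluteValue.abs bS
  refine ⟨(ClassGroup.normBound AbsoluteValue.abs bS).natAbs, by omega, fun a y hy => ?_⟩
  have := ClassGroup.norm_le AbsoluteValue.abs bS a (y := y) hy
  zify
  rwa [intNorm, Int.natCast_natAbs, abs_of_pos hpos]

variable [Module.Free ℤ R] [Module.Finite ℤ R]

theorem intNorm_eq_zero {a : R} : intNorm a = 0 ↔ a = 0 := by
  simp [intNorm, Algebra.norm_eq_zero_iff]

theorem exists_mul_eq_intNorm (a : R) : ∃ b, a * b = (intNorm a : R) := by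
  have := Ideal.absNorm_mem (Ideal.span {a})
  rw [Ideal.absNorm_span_singleton, Ideal.mem_span_singleton] at this
  obtain ⟨b, hb⟩ := this
  exact ⟨b, hb.symm⟩

/-- Approximation of a fraction `p / q` by a fraction whose denominator has smaller norm. -/
theorem exists_approximation [CharZero R] : ∃ C₀ : ℕ, ∀ p q : R, C₀ < intNorm q →
    ∃ u₁ u₂ : R, u₂ ≠ 0 ∧ intNorm u₂ < intNorm q ∧ intNorm (p * u₂ - q * u₁) ≤ C₀ := by
  classical
  let bS := Module.Free.chooseBasis ℤ R
  set ι := Module.Free.ChooseBasisIndex ℤ R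
  set e := Fintype.card ι
  obtain ⟨C, hC1, hC⟩ := exists_intNorm_le bS
  refine ⟨C * C * 2 ^ e + C, fun p q hq => ?_⟩
  set n := intNorm q
  have hn : C * 1 ^ e < n := by rw [one_pow]; nlinarith [Nat.zero_le (C * C * 2 ^ e)]
  have hn0 : 0 < n := by omega
  have he : 0 < e := Fintype.card_pos_iff.2 bS.index_nonempty
  have hbd : ∀ t : ℕ, C * t ^ e < n → t ≤ n := fun t ht => by
    have := Nat.le_self_pow he.ne' t
    nlinarith [Nat.zero_le (t ^ e)]
  set t := Nat.findGreatest (fun t => C * t ^ e < n) n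
  have ht : C * t ^ e < n := Nat.findGreatest_spec (P := fun t => C * t ^ e < n) (hbd 1 hn) hn
  have ht1 : 1 ≤ t := Nat.le_findGreatest (hbd 1 hn) hn
  have ht2 : n ≤ C * (t + 1) ^ e := by
    by_contra! hlt
    have : t + 1 ≤ t := Nat.le_findGreatest (hbd _ hlt) hlt
    omega
  obtain ⟨D, hD⟩ := exists_mul_eq_intNorm q
  have hnZ : (0 : ℤ) < n := by exact_mod_cast hn0
  have htZ : (0 : ℤ) < t := by exact_mod_cast ht1
  let v : (ι → Fin (t + 1)) → R := fun x => bS.equivFun.symm fun i => ((x i : ℕ) : ℤ)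
  let c : (ι → Fin (t + 1)) → ι → ℤ := fun x i => bS.repr (D * p * v x) i
  let w : (ι → Fin (t + 1)) → R := fun x => bS.equivFun.symm fun i => c x i / n
  have hbox : ∀ x i, (t * (c x i % n)) / n < (t : ℤ) ∧ 0 ≤ (t * (c x i % n)) / (n : ℤ) :=
    fun x i => by
      have h1 := Int.emod_lt_of_pos (c x i) hnZ
      have h0 := Int.emod_nonneg (c x i) hnZ.ne'
      exact ⟨Int.ediv_lt_of_lt_mul hnZ (by nlinarith), by positivity⟩
  let f : (ι → Fin (t + 1)) → ι → Fin t := fun x i =>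
    ⟨((t * (c x i % n)) / n : ℤ).toNat, by have := hbox x i; omega⟩
  obtain ⟨x, y, hxy, hf⟩ := Fintype.exists_ne_map_eq_of_card_lt f (by
    simpa using Nat.pow_lt_pow_left (Nat.lt_succ_self t) he.ne')
  refine ⟨w x - w y, v x - v y, ?_, ?_, ?_⟩
  · intro h
    apply hxy
    have := bS.equivFun.symm.injective (sub_eq_zero.1 h)
    funext i
    have := congrFun this i
    exact Fin.ext (by exact_mod_cast this)
  · refine (hC _ t fun k => ?_).trans_lt ht
    have h1 := (x k).2
    have h2 := (y k).2
    simp only [v, map_sub, Finsupp.sub_apply, ← Module.Basis.equivFun_apply,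
      LinearEquiv.apply_symm_apply]
    rw [abs_le]
    omega
  · set r := p * (v x - v y) - q * (w x - w y)
    have key : intNorm ((t : R) * (D * r)) ≤ C * n ^ e := by
      refine hC _ n fun k => ?_
      have hr : (t : R) * (D * r) =
          (t : ℤ) • ((D * p * v x - (n : ℤ) • w x) - (D * p * v y - (n : ℤ) • w y)) := by
        simp only [zsmul_eq_mul, Int.cast_natCast, r]
        rw [← hD]; ring
      have hco : ∀ x, bS.repr (D * p * v x - (n : ℤ) • w x) k = c x k % n := fun x => by
        simp only [map_sub, map_smul, Finsupp.sub_apply, Finsupp.smul_apply]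
        rw [← Module.Basis.equivFun_apply bS (w x)]
        simp only [w, LinearEquiv.apply_symm_apply, smul_eq_mul]
        rw [Int.emod_def]
      have hk := congrArg Fin.val (congrFun hf k)
      simp only [f] at hk
      have hk' : (t * (c x k % n)) / (n : ℤ) = (t * (c y k % n)) / n := by
        have := hbox x k
        have := hbox y k
        omega
      rw [hr, map_smul, Finsupp.smul_apply, map_sub, Finsupp.sub_apply, hco, hco, smul_eq_mul,
        mul_sub]
      have h1 := Int.emod_add_mul_ediv (t * (c x k % n)) n
      have h2 := Int.emod_add_mul_ediv (t * (c y k % n)) n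
      have h3 := Int.emod_lt_of_pos (t * (c x k % n)) hnZ
      have h4 := Int.emod_lt_of_pos (t * (c y k % n)) hnZ
      have h5 := Int.emod_nonneg (t * (c x k % n)) hnZ.ne'
      have h6 := Int.emod_nonneg (t * (c y k % n)) hnZ.ne'
      rw [hk'] at h1
      rw [abs_le]
      constructor <;> linarith
    have hcast : ∀ m : ℕ, intNorm (m : R) = m ^ e := fun m => by
      have := Algebra.norm_algebraMap_of_basis bS (m : ℤ)
      simp only [map_natCast] at this
      rw [intNorm, this, Int.natAbs_pow, Int.natAbs_natCast]
    rw [intNorm_mul, intNorm_mul, hcast, ← hcast n, ← hD, intNorm_mul] at key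
    have hD0 : 0 < intNorm D := by
      rw [Nat.pos_iff_ne_zero, Ne, intNorm_eq_zero]
      rintro rfl
      rw [mul_zero] at hD
      exact hn0.ne (by exact_mod_cast hD)
    have key2 : t ^ e * intNorm r ≤ C * n := by
      refine Nat.le_of_mul_le_mul_left ?_ hD0
      calc _ = t ^ e * (intNorm D * intNorm r) := by ring
        _ ≤ _ := key
        _ = _ := by ring
    have hpw : (t + 1) ^ e ≤ 2 ^ e * t ^ e := by
      rw [← mul_pow]; exact Nat.pow_le_pow_left (by omega) e
    have hte : 0 < t ^ e := by positivity
    have : t ^ e * intNorm r ≤ t ^ e * (C * C * 2 ^ e) := by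
      calc _ ≤ C * n := key2
        _ ≤ C * (C * (2 ^ e * t ^ e)) := by gcongr; exact ht2.trans (by gcongr)
        _ = _ := by ring
    exact (Nat.le_of_mul_le_mul_left this hte).trans (Nat.le_add_right _ _)

end Approximation

section Generation

open Matrix

/-- The determinant of two plane vectors is nonzero of norm at most `C`. -/
def IsNear {R : Type*} [CommRing R] (C : ℕ) (v w : Fin 2 → R) : Prop :=
  v 0 * w 1 - v 1 * w 0 ≠ 0 ∧ intNorm (v 0 * w 1 - v 1 * w 0) ≤ C

theorem IsNear.symm {R : Type*} [CommRing R] {C : ℕ} {v w : Fin 2 → R} (h : IsNear C v w) :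
    IsNear C w v := by
  have : w 0 * v 1 - w 1 * v 0 = -(v 0 * w 1 - v 1 * w 0) := by ring
  rw [IsNear, this, intNorm_neg, neg_ne_zero]
  exact h

theorem IsNear.mulVec {R : Type*} [CommRing R] {C : ℕ} {v w : Fin 2 → R} (h : IsNear C v w)
    (g : SpecialLinearGroup (Fin 2) R) :
    IsNear C (g.1 *ᵥ v) (g.1 *ᵥ w) := by
  have : (g.1 *ᵥ v) 0 * (g.1 *ᵥ w) 1 - (g.1 *ᵥ v) 1 * (g.1 *ᵥ w) 0 = v 0 * w 1 - v 1 * w 0 := by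
    have hg := g.2
    rw [det_fin_two] at hg
    simp only [Matrix.mulVec, dotProduct, Fin.sum_univ_two]
    linear_combination (v 0 * w 1 - v 1 * w 0) * hg
  rw [IsNear, this]
  exact h

variable {R : Type*} [CommRing R] [IsDedekindDomain R] [Module.Free ℤ R] [Module.Finite ℤ R]
  [CharZero R]

theorem exists_reflTransGen_isNear (R : Type*) [CommRing R] [IsDedekindDomain R]
    [Module.Free ℤ R] [Module.Finite ℤ R] [CharZero R] : ∃ C : ℕ, 1 ≤ C ∧ ∀ v w : Fin 2 → R,
    IsNear C v w → Relation.ReflTransGen (IsNear C) w ![1, 0] := by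
  obtain ⟨C₀, hC⟩ := exists_approximation (R := R)
  refine ⟨C₀ + 1, by omega, fun v => ?_⟩
  induction hN : intNorm (v 1) using Nat.strong_induction_on generalizing v with
  | _ N ih =>
  intro w hw
  by_cases hq : v 1 = 0
  · obtain ⟨h0, h1⟩ := hw
    rw [hq, zero_mul, sub_zero] at h0 h1
    refine .single ⟨by simpa using right_ne_zero_of_mul h0, ?_⟩
    rw [intNorm_mul] at h1
    have : 0 < intNorm (v 0) :=
      Nat.pos_of_ne_zero (mt intNorm_eq_zero.1 (left_ne_zero_of_mul h0))
    simp only [Matrix.cons_val_zero, Matrix.cons_val_one, mul_zero, mul_one, zero_sub, intNorm_neg]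
    nlinarith
  by_cases hsm : intNorm (v 1) ≤ C₀ + 1
  · refine .head hw.symm (.single ⟨by simpa using hq, ?_⟩)
    simpa [intNorm_neg] using hsm
  obtain ⟨u₁, u₂, hu, hlt, hle⟩ := hC (v 0) (v 1) (by omega)
  by_cases hz : v 0 * u₂ - v 1 * u₁ = 0
  · refine ih _ (hN ▸ hlt) ![u₁, u₂] rfl w ?_
    have hrel : v 1 * (u₁ * w 1 - u₂ * w 0) = u₂ * (v 0 * w 1 - v 1 * w 0) := by
      linear_combination -w 1 * hz
    have hne := mul_ne_zero hu hw.1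
    rw [← hrel] at hne
    refine ⟨by simpa using right_ne_zero_of_mul hne, ?_⟩
    have := congrArg intNorm hrel
    rw [intNorm_mul, intNorm_mul] at this
    simp only [Matrix.cons_val_zero, Matrix.cons_val_one]
    have h2 := hw.2
    have h3 : 0 < intNorm (v 1) := Nat.pos_of_ne_zero (mt intNorm_eq_zero.1 hq)
    refine Nat.le_of_mul_le_mul_left ?_ h3
    rw [this]
    gcongr
  · refine .head hw.symm (ih _ (hN ▸ hlt) ![u₁, u₂] rfl v (IsNear.symm ⟨by simpa using hz, ?_⟩))
    simpa using hle.trans (Nat.le_succ _)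

/-- Matrices whose determinant has bounded nonzero norm fall in finitely many classes. -/
theorem exists_finite_matrices (C : ℕ) : ∃ Φ : Set (Matrix (Fin 2) (Fin 2) R), Φ.Finite ∧
    (∀ f ∈ Φ, f.det ≠ 0) ∧ ∀ v w : Fin 2 → R, IsNear C v w → ∃ ε : Rˣ, ∃ f ∈ Φ,
      ∃ g : SpecialLinearGroup (Fin 2) R,
        v = g.1 *ᵥ (fun i => f i 0) ∧ (ε : R) • w = g.1 *ᵥ (fun i => f i 1) := by
  obtain ⟨Δ, hΔs, hΔ⟩ := Set.exists_subset_bijOn {a : R | a ≠ 0 ∧ intNorm a ≤ C}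
    (fun a => Ideal.span {a})
  have hΔf : Δ.Finite := by
    rw [hΔ.finite_iff_finite]
    refine (Ideal.finite_setOfPred_absNorm_le (S := R) C).subset ?_
    rintro _ ⟨a, ha, rfl⟩
    simpa [Ideal.absNorm_span_singleton, intNorm] using ha.2
  have hred : ∀ δ ∈ Δ, ∃ Φ : Set (Matrix (Fin 2) (Fin 2) R), Φ.Finite ∧ (∀ f ∈ Φ, f.det = δ) ∧
      ∀ A : Matrix (Fin 2) (Fin 2) R, A.det = δ → ∃ f ∈ Φ, ∃ g : SpecialLinearGroup (Fin 2) R,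
        A = g.1 * f := by
    intro δ hδ
    have hδ0 : δ ≠ 0 := (hΔs hδ).1
    have : Finite (R ⧸ Ideal.span {δ}) :=
      Ideal.finiteQuotientOfFreeOfNeBot _ (by simpa using hδ0)
    obtain ⟨Φ, hΦs, hΦ⟩ := Set.exists_subset_bijOn {A : Matrix (Fin 2) (Fin 2) R | A.det = δ}
      (fun A => A.map (Ideal.Quotient.mk (Ideal.span {δ})))
    refine ⟨Φ, hΦ.finite_iff_finite.2 (Set.toFinite _), hΦs, fun A hA => ?_⟩
    obtain ⟨f, hf, hfA⟩ := hΦ.surjOn ⟨A, hA, rfl⟩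
    have hX : ∀ i j, ∃ c, A i j = f i j + δ * c := fun i j => by
      have := congrFun (congrFun hfA i) j
      simp only [Matrix.map_apply] at this
      rw [Ideal.Quotient.mk_eq_mk_iff_sub_mem, Ideal.mem_span_singleton] at this
      obtain ⟨c, hc⟩ := this
      exact ⟨-c, by linear_combination -hc⟩
    choose X hX using hX
    have hAX : A = f + δ • Matrix.of X := by
      ext i j; simp [hX]
    have hfd : f.det = δ := hΦs hf
    have hmul : (1 + Matrix.of X * f.adjugate) * f = A := by
      rw [add_mul, one_mul, Matrix.mul_assoc, Matrix.adjugate_mul, hfd, hAX, Matrix.mul_smul,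
        Matrix.mul_one]
    refine ⟨f, hf, ⟨1 + Matrix.of X * f.adjugate, ?_⟩, hmul.symm⟩
    have := congrArg Matrix.det hmul
    rw [Matrix.det_mul, hfd, hA] at this
    exact mul_right_cancel₀ hδ0 (by rw [this, one_mul])
  choose! Φ hΦf hΦd hΦ using hred
  refine ⟨⋃ δ ∈ Δ, Φ δ, hΔf.biUnion hΦf, ?_, fun v w hvw => ?_⟩
  · intro f hf
    simp only [Set.mem_iUnion] at hf
    obtain ⟨δ, hδ, hf⟩ := hf
    rw [hΦd δ hδ f hf]
    exact (hΔs hδ).1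
  · obtain ⟨δ, hδ, hs⟩ := hΔ.surjOn ⟨_, hvw, rfl⟩
    obtain ⟨ε, hε⟩ := (Ideal.span_singleton_eq_span_singleton.1 hs).symm
    obtain ⟨f, hf, g, hg⟩ := hΦ δ hδ !![v 0, (ε : R) * w 0; v 1, (ε : R) * w 1] (by
      rw [← hε, det_fin_two_of]; ring)
    refine ⟨ε, f, Set.mem_biUnion hδ hf, g, ?_, ?_⟩
    · ext i
      have := congrFun (congrFun hg i) 0
      simp only [Matrix.mul_apply] at this
      simp only [Matrix.mulVec, dotProduct, ← this]
      fin_cases i <;> simp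
    · ext i
      have := congrFun (congrFun hg i) 1
      simp only [Matrix.mul_apply] at this
      simp only [Matrix.mulVec, dotProduct, ← this]
      fin_cases i <;> simp

/-- Traceless matrices killing the vector `w`. -/
def tracelessKilling {R : Type*} [CommRing R] (w : Fin 2 → R) :
    Submodule ℤ (Matrix (Fin 2) (Fin 2) R) where
  carrier := {N | N *ᵥ w = 0 ∧ N 1 1 = -N 0 0}
  zero_mem' := by simp
  add_mem' := by
    rintro M N ⟨h1, h2⟩ ⟨h3, h4⟩
    exact ⟨by rw [Matrix.add_mulVec, h1, h3, add_zero], by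
      rw [Matrix.add_apply, Matrix.add_apply, h2, h4]; ring⟩
  smul_mem' := by
    rintro c N ⟨h1, h2⟩
    exact ⟨by rw [Matrix.smul_mulVec, h1, smul_zero], by simp [h2]⟩

theorem mul_eq_zero_of_mem_tracelessKilling {R : Type*} [CommRing R] [IsDomain R] {w : Fin 2 → R}
    (hw : w ≠ 0) {M N : Matrix (Fin 2) (Fin 2) R} (hM : M ∈ tracelessKilling w)
    (hN : N ∈ tracelessKilling w) : M * N = 0 := by
  obtain ⟨hM, hMt⟩ := hM
  obtain ⟨hN, hNt⟩ := hN
  have hM0 := congrFun hM 0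
  have hM1 := congrFun hM 1
  have hN0 := congrFun hN 0
  have hN1 := congrFun hN 1
  simp only [Matrix.mulVec, dotProduct, Fin.sum_univ_two, hMt, hNt,
    Pi.zero_apply] at hM0 hM1 hN0 hN1
  have hw' : w 0 ≠ 0 ∨ w 1 ≠ 0 := by
    by_contra! h
    exact hw (by ext i; fin_cases i <;> simp [h])
  rcases hw' with h | h <;> ext i j <;> apply mul_left_cancel₀ h <;> fin_cases i <;>
    fin_cases j <;>
    simp only [Matrix.mul_apply, Fin.sum_univ_two, hMt, hNt, Matrix.zero_apply, Fin.zero_eta,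
      Fin.mk_one, mul_zero]
  · linear_combination N 0 0 * hM0 + M 0 1 * hN1
  · linear_combination N 0 1 * hM0 - M 0 1 * hN0
  · linear_combination N 0 0 * hM1 - M 0 0 * hN1
  · linear_combination N 0 1 * hM1 + M 0 0 * hN0
  · linear_combination N 1 0 * hM0 - M 0 0 * hN1
  · linear_combination - N 0 0 * hM0 + M 0 0 * hN0
  · linear_combination N 1 0 * hM1 - M 1 0 * hN1
  · linear_combination - N 0 0 * hM1 + M 1 0 * hN0

/-- The stabilizer of a nonzero vector is finitely generated. -/
theorem exists_finite_stabilizer {R : Type*} [CommRing R] [IsDomain R] [Module.Finite ℤ R]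
    (w : Fin 2 → R) (hw : w ≠ 0) :
    ∃ S : Set (SpecialLinearGroup (Fin 2) R), S.Finite ∧
      ∀ g : SpecialLinearGroup (Fin 2) R, g.1 *ᵥ w = w → g ∈ Subgroup.closure S := by
  have hdet : ∀ N ∈ tracelessKilling w, (1 + N).det = 1 := fun N hN => by
    have h0 : N.det = 0 := Matrix.exists_mulVec_eq_zero_iff.1 ⟨w, hw, hN.1⟩
    rw [det_fin_two] at h0 ⊢
    simp only [Matrix.add_apply, Matrix.one_apply, Fin.isValue, ↓reduceIte, hN.2] at h0 ⊢
    simp only [zero_ne_one, one_ne_zero, ↓reduceIte, zero_add]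
    linear_combination h0
  let ψ : Multiplicative (tracelessKilling w) →* SpecialLinearGroup (Fin 2) R :=
    { toFun := fun N => ⟨1 + N.toAdd.1, hdet _ N.toAdd.2⟩
      map_one' := by ext; simp
      map_mul' := fun M N => by
        apply Subtype.ext
        have := mul_eq_zero_of_mem_tracelessKilling hw M.toAdd.2 N.toAdd.2
        change 1 + (M.toAdd.1 + N.toAdd.1) = (1 + M.toAdd.1) * (1 + N.toAdd.1)
        rw [add_mul, mul_add, mul_add, this]
        simp only [one_mul, mul_one, add_zero]
        abel }
  have : Module.Finite ℤ (Matrix (Fin 2) (Fin 2) R) :=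
    inferInstanceAs (Module.Finite ℤ (Fin 2 → Fin 2 → R))
  have : IsNoetherian ℤ (Matrix (Fin 2) (Fin 2) R) := isNoetherian_of_isNoetherianRing_of_finite _ _
  have hfin : Module.Finite ℤ (tracelessKilling w) := Module.IsNoetherian.finite _ _
  have hfg : AddGroup.FG (tracelessKilling w) := by
    rw [← Module.Finite.iff_addGroup_fg]; exact hfin
  obtain ⟨S, hS⟩ := (Group.FG.out : (⊤ : Subgroup (Multiplicative (tracelessKilling w))).FG)
  refine ⟨ψ '' S, S.finite_toSet.image _, fun g hg => ?_⟩
  rw [← MonoidHom.map_closure, hS]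
  have hmem : g.1 - 1 ∈ tracelessKilling w := by
    have h1 : (g.1 - 1) *ᵥ w = 0 := by rw [Matrix.sub_mulVec, hg, Matrix.one_mulVec, sub_self]
    refine ⟨h1, ?_⟩
    have h0 : (g.1 - 1).det = 0 := Matrix.exists_mulVec_eq_zero_iff.1 ⟨w, hw, h1⟩
    have hgd := g.2
    rw [det_fin_two] at h0 hgd
    simp only [Matrix.sub_apply, Matrix.one_apply, Fin.isValue, ↓reduceIte, zero_ne_one,
      one_ne_zero, sub_zero] at h0 ⊢
    linear_combination hgd - h0
  exact ⟨Multiplicative.ofAdd ⟨_, hmem⟩, trivial, Subtype.ext (add_sub_cancel 1 g.1)⟩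

end Generation

section FiniteGeneration

open Matrix

theorem coe_mul_mulVec {R : Type*} [CommRing R] (g h : SpecialLinearGroup (Fin 2) R)
    (v : Fin 2 → R) : (g * h).1 *ᵥ v = g.1 *ᵥ (h.1 *ᵥ v) := by
  rw [Matrix.mulVec_mulVec]; rfl

theorem inv_mulVec_eq {R : Type*} [CommRing R] {g : SpecialLinearGroup (Fin 2) R}
    {v w : Fin 2 → R} (h : v = g.1 *ᵥ w) : g⁻¹.1 *ᵥ v = w := by
  rw [h, ← coe_mul_mulVec, inv_mul_cancel]
  exact Matrix.one_mulVec w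

/-- `SL(2, R)` is generated by its elementary matrices together with a finite set. -/
theorem exists_finite_closure_eq_top (R : Type*) [CommRing R] [IsDedekindDomain R]
    [Module.Free ℤ R] [Module.Finite ℤ R] [CharZero R] :
    ∃ F : Set (SpecialLinearGroup (Fin 2) R), F.Finite ∧
      Subgroup.closure (F ∪ Set.range upperTwo ∪ Set.range lowerTwo) = ⊤ := by
  obtain ⟨C, hC1, hC⟩ := exists_reflTransGen_isNear R
  obtain ⟨Φ, hΦf, hΦd, hΦ⟩ := exists_finite_matrices (R := R) C
  set e₁ : Fin 2 → R := ![1, 0]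
  let W : Set (Fin 2 → R) := {e₁} ∪ ((fun f i => f i 0) '' Φ ∪ (fun f i => f i 1) '' Φ)
  have hWf : W.Finite := (Set.finite_singleton _).union ((hΦf.image _).union (hΦf.image _))
  have hW0 : ∀ w ∈ W, w ≠ 0 := by
    rintro w (rfl | ⟨f, hf, rfl⟩ | ⟨f, hf, rfl⟩) h
    · exact one_ne_zero (congrFun h 0)
    · exact hΦd f hf (Matrix.det_eq_zero_of_column_eq_zero 0 (congrFun h))
    · exact hΦd f hf (Matrix.det_eq_zero_of_column_eq_zero 1 (congrFun h))
  choose! S hSf hS using fun w (hw : w ∈ W) => exists_finite_stabilizer w (hW0 w hw)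
  have hT : ∀ p : (Fin 2 → R) × (Fin 2 → R), ∃ t : SpecialLinearGroup (Fin 2) R,
      (∃ g : SpecialLinearGroup (Fin 2) R, p.2 = g.1 *ᵥ p.1) → p.2 = t.1 *ᵥ p.1 := fun p => by
    by_cases h : ∃ g : SpecialLinearGroup (Fin 2) R, p.2 = g.1 *ᵥ p.1
    · exact ⟨h.choose, fun _ => h.choose_spec⟩
    · exact ⟨1, fun h' => absurd h' h⟩
  choose T hT using hT
  refine ⟨(⋃ w ∈ W, S w) ∪ T '' (W ×ˢ W),
    (hWf.biUnion hSf).union ((hWf.prod hWf).image _), ?_⟩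
  set H := Subgroup.closure ((⋃ w ∈ W, S w) ∪ T '' (W ×ˢ W) ∪ Set.range upperTwo ∪
    Set.range lowerTwo)
  have hup : ∀ t, upperTwo t ∈ H := fun t => Subgroup.subset_closure (.inl (.inr ⟨t, rfl⟩))
  have hlow : ∀ t, lowerTwo t ∈ H := fun t => Subgroup.subset_closure (.inr ⟨t, rfl⟩)
  have hP : ∀ w ∈ W, ∀ w' ∈ W, ∀ g : SpecialLinearGroup (Fin 2) R, w' = g.1 *ᵥ w → g ∈ H := by
    intro w hw w' hw' g hg
    have ht := hT (w, w') ⟨g, hg⟩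
    have htH : T (w, w') ∈ H :=
      Subgroup.subset_closure (.inl (.inl (.inr ⟨_, ⟨hw, hw'⟩, rfl⟩)))
    have hst : (T (w, w'))⁻¹ * g ∈ H := by
      refine Subgroup.closure_mono ?_ (hS w hw _ ?_)
      · exact fun s hs => .inl (.inl (.inl (Set.mem_biUnion hw hs)))
      · rw [coe_mul_mulVec, ← hg]
        exact inv_mulVec_eq ht
    simpa using H.mul_mem htH hst
  have he₁ : e₁ ∈ W := .inl rfl
  have hpath : ∀ v, Relation.ReflTransGen (IsNear C) e₁ v → ∃ ε : Rˣ, ∃ h ∈ H, ∃ w ∈ W,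
      (ε : R) • v = h.1 *ᵥ w := by
    intro v hv
    induction hv with
    | refl => exact ⟨1, 1, H.one_mem, e₁, he₁, by simp⟩
    | @tail v v' _ hn ih =>
      obtain ⟨ε, h, hh, w, hw, hv⟩ := ih
      have hwv : (ε : R) • (h⁻¹.1 *ᵥ v) = w := by
        rw [← Matrix.mulVec_smul]; exact inv_mulVec_eq hv
      have hn' := hn.mulVec h⁻¹
      have hnear : IsNear C w ((ε⁻¹ : Rˣ) • (h⁻¹.1 *ᵥ v')) := by
        have heq : w 0 * ((ε⁻¹ : Rˣ) • (h⁻¹.1 *ᵥ v')) 1 - w 1 * ((ε⁻¹ : Rˣ) • (h⁻¹.1 *ᵥ v')) 0 =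
            (h⁻¹.1 *ᵥ v) 0 * (h⁻¹.1 *ᵥ v') 1 - (h⁻¹.1 *ᵥ v) 1 * (h⁻¹.1 *ᵥ v') 0 := by
          rw [← hwv]
          simp only [Pi.smul_apply, Units.smul_def, smul_eq_mul]
          linear_combination ((h⁻¹.1 *ᵥ v) 0 * (h⁻¹.1 *ᵥ v') 1 -
            (h⁻¹.1 *ᵥ v) 1 * (h⁻¹.1 *ᵥ v') 0) * ε.mul_inv
        rw [IsNear, heq]
        exact hn'
      obtain ⟨η, f, hf, g, hg₀, hg₁⟩ := hΦ _ _ hnear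
      have hgH : g ∈ H := hP _ (.inr (.inl ⟨f, hf, rfl⟩)) w hw g hg₀
      refine ⟨η * ε⁻¹, h * g, H.mul_mem hh hgH, _, .inr (.inr ⟨f, hf, rfl⟩), ?_⟩
      rw [coe_mul_mulVec, ← hg₁, Matrix.mulVec_smul, Units.smul_def, Matrix.mulVec_smul,
        ← coe_mul_mulVec, mul_inv_cancel, smul_smul, Units.val_mul]
      exact congrArg _ (Matrix.one_mulVec v').symm
  rw [eq_top_iff]
  intro γ _
  have hconn : Relation.ReflTransGen (IsNear C) e₁ (γ.1 *ᵥ e₁) := by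
    have h₁ : IsNear C e₁ ![0, 1] := ⟨by simp [e₁], by simpa [e₁, intNorm] using hC1⟩
    have h₂ := hC _ _ (h₁.symm.mulVec γ⁻¹)
    have h₃ : Relation.ReflTransGen (IsNear C) (γ.1 *ᵥ (γ⁻¹.1 *ᵥ e₁)) (γ.1 *ᵥ e₁) :=
      h₂.lift (p := IsNear C) (fun v => γ.1 *ᵥ v) fun _ _ h => h.mulVec γ
    have h₄ : γ.1 *ᵥ (γ⁻¹.1 *ᵥ e₁) = e₁ := by
      rw [← coe_mul_mulVec, mul_inv_cancel]; exact Matrix.one_mulVec e₁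
    rwa [h₄] at h₃
  obtain ⟨ε, h, hh, w, hw, hv⟩ := hpath _ hconn
  obtain ⟨D, hD, hDe⟩ : ∃ D ∈ H, D.1 *ᵥ e₁ = (ε : R) • e₁ := by
    refine ⟨upperTwo (ε : R) * lowerTwo (-(ε⁻¹ : Rˣ) : R) * upperTwo (ε : R) * upperTwo (-1) *
      lowerTwo 1, ?_, ?_⟩
    · refine H.mul_mem (H.mul_mem (H.mul_mem (H.mul_mem ?_ ?_) ?_) ?_) ?_ <;>
        first | exact hup _ | exact hlow _
    · simp only [coe_mul_mulVec]
      ext i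
      fin_cases i <;>
        simp [e₁, upperTwo_coe, lowerTwo_coe, Matrix.mulVec, dotProduct, Fin.sum_univ_two]
  have hmem : h⁻¹ * (γ * D) ∈ H := by
    refine hP e₁ he₁ w hw _ ?_
    rw [coe_mul_mulVec, coe_mul_mulVec, hDe, Matrix.mulVec_smul]
    exact (inv_mulVec_eq hv).symm
  have := H.mul_mem (H.mul_mem hh hmem) (H.inv_mem hD)
  simpa [mul_assoc] using this

end FiniteGeneration

theorem hasPropertyQFA_specialLinearGroup (R : Type) [CommRing R] [IsDedekindDomain R]
    [Module.Free ℤ R] [Module.Finite ℤ R] [CharZero R] {n : ℕ} (hn : 3 ≤ n) :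
    HasPropertyQFA (Matrix.SpecialLinearGroup (Fin n) R) := by
  obtain ⟨m, rfl⟩ := Nat.exists_eq_add_of_le' hn
  obtain ⟨F, hF, hgen⟩ := exists_finite_closure_eq_top R
  refine HasBoundedQuasiTreeOrbits.hasPropertyQFA fun X d δ φ hX hφ x => ?_
  exact IsQuasiTreeAction.exists_le_of_closure
    (fun a ha => Ideal.finiteQuotientOfFreeOfNeBot _ (by simpa using ha)) F hF hgen m ⟨hX, hφ⟩ x

/-- for a number field `K` with ring of integers `𝒪` and `n ≥ 3`,
`SL(n,𝒪)` has Property (QFA); in particular `SL(n,ℤ)` has Property (QFA). -/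
theorem stmt_12 (K : Type) [Field K] [NumberField K] (n : ℕ) (hn : 3 ≤ n) :
    HasPropertyQFA (Matrix.SpecialLinearGroup (Fin n) (NumberField.RingOfIntegers K)) ∧
    HasPropertyQFA (Matrix.SpecialLinearGroup (Fin n) ℤ) := by
  exact ⟨hasPropertyQFA_specialLinearGroup _ hn, hasPropertyQFA_specialLinearGroup _ hn⟩
end
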